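/- arXiv:1212.4597 — 2 statements merged into one kernel-verified Lean document; each statement's English description precedes it below -/
import Mathlib

section
/- The F-algebra homomorphism j : C⟨X⟩ → M_n(C ⊗_{T_n} C_y), determined by sending x_k to the matrix whose (i,j) entry is 1 ⊗ y_{ij}^{(k)} and each λ ∈ C to the scalar matrix (λ ⊗ 1)·I, has kernel exactly equal to the T-ideal of C⟨X⟩ generated by the Cayley–Hamilton quasi-polynomial q_n. -/
open scoped TensorProduct

variable (F : Type*) [Field F] [CharZero F] (n : ℕ)

/-- The commutative coefficient ring `C = F[x_{ij}^{(k)}]`. -/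
abbrev CPoly := MvPolynomial (Fin n × Fin n × ℕ) F

/-- The algebra of quasi-polynomials `C⟨X⟩`. -/
abbrev QPoly := FreeAlgebra (CPoly F n) ℕ

/-- The generic matrix `ξ_k`. -/
noncomputable def genMat (k : ℕ) : Matrix (Fin n) (Fin n) (CPoly F n) :=
  Matrix.of fun i j => MvPolynomial.X (i, j, k)

/-- `Φ : C⟨X⟩ → M_n(C)`, the `C`-algebra map sending `x_k` to `ξ_k`. -/
noncomputable def PhiQ : QPoly F n →ₐ[CPoly F n] Matrix (Fin n) (Fin n) (CPoly F n) :=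
  FreeAlgebra.lift _ (genMat F n)

/-- Evaluation of `C` at a sequence of matrices. -/
noncomputable def evalC (A : ℕ → Matrix (Fin n) (Fin n) F) : CPoly F n →ₐ[F] F :=
  MvPolynomial.aeval fun p => A p.2.2 p.1 p.2.1

/-- Evaluation `ev_A : C⟨X⟩ → M_n(F)`. -/
noncomputable def evalQ (A : ℕ → Matrix (Fin n) (Fin n) F) :
    QPoly F n →ₐ[F] Matrix (Fin n) (Fin n) F :=
  ((evalC F n A).mapMatrix).comp ((PhiQ F n).restrictScalars F)

def IsQuasiIdentity (P : QPoly F n) : Prop :=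
  ∀ A : ℕ → Matrix (Fin n) (Fin n) F, evalQ F n A P = 0

/-- Substitution endomorphisms of `C⟨X⟩`. -/
def IsSubstEndo (φ : QPoly F n →ₐ[F] QPoly F n) : Prop :=
  ∀ (i j : Fin n) (k : ℕ),
    φ (algebraMap (CPoly F n) (QPoly F n) (MvPolynomial.X (i, j, k))) =
      algebraMap (CPoly F n) (QPoly F n) (PhiQ F n (φ (FreeAlgebra.ι (CPoly F n) k)) i j)

def IsTIdeal (I : Set (QPoly F n)) : Prop :=
  (0 : QPoly F n) ∈ I ∧
  (∀ a b : QPoly F n, a ∈ I → b ∈ I → a + b ∈ I) ∧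
  (∀ r a : QPoly F n, a ∈ I → r * a ∈ I) ∧
  (∀ r a : QPoly F n, a ∈ I → a * r ∈ I) ∧
  (∀ φ : QPoly F n →ₐ[F] QPoly F n, IsSubstEndo F n φ → ∀ p ∈ I, φ p ∈ I)

/-- The T-ideal generated by a set. -/
def TIdealSpan (S : Set (QPoly F n)) : Set (QPoly F n) :=
  ⋂₀ {I : Set (QPoly F n) | IsTIdeal F n I ∧ S ⊆ I}

/-- The Cayley–Hamilton quasi-polynomial `q_n`. -/
noncomputable def chQ : QPoly F n :=
  ∑ i ∈ Finset.range (n + 1),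
    algebraMap (CPoly F n) (QPoly F n) ((genMat F n 0).charpoly.coeff i) *
      FreeAlgebra.ι (CPoly F n) 0 ^ i

/-- Noncommutative polynomials over `F`. -/
abbrev NCPoly := FreeAlgebra F ℕ

noncomputable def evalNC (A : ℕ → Matrix (Fin n) (Fin n) F) :
    NCPoly F →ₐ[F] Matrix (Fin n) (Fin n) F :=
  FreeAlgebra.lift F A

def IsCentralPoly (c : NCPoly F) : Prop :=
  ∀ A : ℕ → Matrix (Fin n) (Fin n) F, ∃ α : F,
    evalNC F n A c = α • (1 : Matrix (Fin n) (Fin n) F)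

def IsPolyIdentity (c : NCPoly F) : Prop :=
  ∀ A : ℕ → Matrix (Fin n) (Fin n) F, evalNC F n A c = 0

/-- The constant term of a noncommutative polynomial. -/
noncomputable def constantTerm : NCPoly F →ₐ[F] F :=
  FreeAlgebra.lift F (fun _ : ℕ => (0 : F))

/-- The inclusion `F⟨X⟩ → C⟨X⟩`. -/
noncomputable def toQPoly : NCPoly F →ₐ[F] QPoly F n :=
  FreeAlgebra.lift F (fun k => FreeAlgebra.ι (CPoly F n) k)

/-- A general lift: the `F`-algebra map `C⟨X⟩ → B` determined by an `F`-algebra map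
`g` on the coefficients `C` (with central image) and a choice `f` of images of the
noncommuting variables. -/
noncomputable def liftQ {F : Type*} [Field F] [CharZero F] {n : ℕ}
    {B : Type*} [Semiring B] [Algebra F B]
    (g : CPoly F n →ₐ[F] B) (f : ℕ → B) (hg : ∀ c b, Commute (g c) b) :
    QPoly F n →ₐ[F] B :=
  (Algebra.TensorProduct.lift g (FreeAlgebra.lift F f) (fun c b => hg c _)).comp
    ((FreeAlgebra.lift (CPoly F n)
        (fun k => (1 : CPoly F n) ⊗ₜ[F] FreeAlgebra.ι F k)).restrictScalars F)

/-- `T_n ⊆ C`, the subalgebra generated by the traces of monomials in the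
generic matrices. -/
noncomputable def TnAlg : Subalgebra F (CPoly F n) :=
  Algebra.adjoin F
    {c : CPoly F n | ∃ l : List ℕ, l ≠ [] ∧ c = Matrix.trace ((l.map (genMat F n)).prod)}

/-- The ring `C ⊗_{T_n} C_y` (with `C_y` a second copy of `C`, here realized as `C`
itself with the identity renaming). -/
noncomputable abbrev CCTensor := (CPoly F n) ⊗[TnAlg F n] (CPoly F n)


noncomputable def jg :
    CPoly F n →ₐ[F] Matrix (Fin n) (Fin n) (CCTensor F n) :=
  (IsScalarTower.toAlgHom F (CCTensor F n)
      (Matrix (Fin n) (Fin n) (CCTensor F n))).comp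
    (Algebra.TensorProduct.includeLeft)

noncomputable def jf (k : ℕ) : Matrix (Fin n) (Fin n) (CCTensor F n) :=
  (genMat F n k).map (Algebra.TensorProduct.includeRight (R := TnAlg F n))

set_option maxHeartbeats 1000000 in
theorem jg_comm : ∀ (c : CPoly F n) (b : Matrix (Fin n) (Fin n) (CCTensor F n)),
    Commute (jg F n c) b := by
  intro c b
  show jg F n c * b = b * jg F n c
  rw [jg, AlgHom.comp_apply, IsScalarTower.coe_toAlgHom']
  exact Algebra.commutes _ b

/-- The universal map `j : C⟨X⟩ → M_n(C ⊗_{T_n} C_y)`, sending `x_k` to the matrix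
with entries `1 ⊗ y_{ij}^{(k)}` and `λ ∈ C` to the scalar matrix `(λ ⊗ 1)·I`. -/
noncomputable def jmap :
    QPoly F n →ₐ[F] Matrix (Fin n) (Fin n) (CCTensor F n) :=
  liftQ (jg F n) (jf F n) (jg_comm F n)

section Ptr

open Equiv Finset

variable {γ δ β B : Type*} [Fintype γ] [DecidableEq γ] [Fintype δ] [DecidableEq δ]
  [Fintype β] [CommRing B]

/-- The product of the traces of `H` along the cycles of `σ`. -/
def ptr (σ : Perm γ) (H : γ → Matrix β β B) : B :=
  ∑ I : γ → β, ∏ s, H s (I s) (I (σ s))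

theorem ptr_permCongr (e : γ ≃ δ) (σ : Perm γ) (H : δ → Matrix β β B) :
    ptr (e.permCongr σ) H = ptr σ (H ∘ e) := by
  unfold ptr
  refine Fintype.sum_equiv (e.arrowCongr (Equiv.refl β)).symm _ _ fun I => ?_
  refine Fintype.prod_equiv e.symm _ _ fun s => ?_
  simp [Equiv.arrowCongr, Equiv.permCongr_apply]

theorem ptr_optionCongr (σ : Perm γ) (H : Option γ → Matrix β β B) :
    ptr (optionCongr σ) H = (H none).trace * ptr σ (H ∘ some) := by
  unfold ptr
  rw [Fintype.sum_equiv (Equiv.piOptionEquivProd (β := fun _ => β)) _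
    (fun q : β × (γ → β) => H none q.1 q.1 * ∏ s, H (some s) (q.2 s) (q.2 (σ s)))]
  · rw [Fintype.sum_prod_type, Matrix.trace, Finset.sum_mul_sum]
    simp
  · intro I
    rw [Fintype.prod_option]
    simp [Equiv.piOptionEquivProd]

theorem ptr_optionCongr_swap (σ : Perm γ) (x : γ) (H : Option γ → Matrix β β B) :
    ptr (optionCongr σ * swap none (some x)) H =
      ptr σ (Function.update (H ∘ some) x (H (some x) * H none)) := by
  unfold ptr
  rw [Fintype.sum_equiv (Equiv.piOptionEquivProd (β := fun _ => β)) _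
    (fun q : β × (γ → β) => (H (some x) (q.2 x) q.1 * H none q.1 (q.2 (σ x))) *
      ∏ s ∈ univ.erase x, H (some s) (q.2 s) (q.2 (σ s)))]
  · rw [Fintype.sum_prod_type_right]
    refine Finset.sum_congr rfl fun I _ => ?_
    rw [← Finset.mul_prod_erase univ _ (mem_univ x)]
    simp only [Function.update_self, Matrix.mul_apply]
    rw [Finset.sum_mul]
    refine Finset.sum_congr rfl fun b _ => ?_
    congr 1
    refine Finset.prod_congr rfl fun s hs => ?_
    rw [Function.update_of_ne (Finset.ne_of_mem_erase hs)]
    rfl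
  · intro I
    rw [Fintype.prod_option, ← Finset.mul_prod_erase univ _ (mem_univ x)]
    have : ∀ s ∈ univ.erase x, H (some s) (I (some s))
        (I ((optionCongr σ * swap none (some x)) (some s))) =
        H (some s) (I (some s)) (I (some (σ s))) := by
      intro s hs
      rw [Perm.mul_apply, swap_apply_of_ne_of_ne (by simp)
        (by simpa using Finset.ne_of_mem_erase hs)]
      simp
    rw [Finset.prod_congr rfl this]
    simp [Equiv.piOptionEquivProd]
    ring

/-- Every permutation of `Option γ` is uniquely of the form
`optionCongr τ * swap none i`. -/
def decomposeOptionRight : Option γ × Perm γ ≃ Perm (Option γ) :=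
  ((Equiv.refl _).prodCongr (Equiv.inv _)).trans
    (Perm.decomposeOption.symm.trans (Equiv.inv _))

omit [Fintype γ] in
theorem decomposeOptionRight_apply (i : Option γ) (τ : Perm γ) :
    decomposeOptionRight (i, τ) = optionCongr τ * swap none i := by
  simp only [decomposeOptionRight, trans_apply, prodCongr_apply, Prod.map, coe_refl, id_eq,
    Perm.decomposeOption_symm_apply, inv_apply, mul_inv_rev, swap_inv]
  rfl

theorem sign_decomposeOptionRight_none (τ : Perm γ) :
    Perm.sign (decomposeOptionRight (none, τ)) = Perm.sign τ := by
  simp [decomposeOptionRight_apply]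

theorem sign_decomposeOptionRight_some (x : γ) (τ : Perm γ) :
    Perm.sign (decomposeOptionRight (some x, τ)) = - Perm.sign τ := by
  simp [decomposeOptionRight_apply]

omit [Fintype γ] in
theorem optionCongr_mul_decomposeOptionRight (i : Option γ) (ρ τ : Perm γ) :
    optionCongr ρ * decomposeOptionRight (i, τ) = decomposeOptionRight (i, ρ * τ) := by
  rw [decomposeOptionRight_apply, decomposeOptionRight_apply, ← mul_assoc]
  congr 1
  exact (optionCongr_trans τ ρ).symm

/-- The alternating sum of the products of traces of `H` over all permutations. -/
def altTr (H : γ → Matrix β β B) : B :=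
  ∑ σ : Perm γ, (Perm.sign σ : ℤ) • ptr σ H

theorem altTr_reindex (e : γ ≃ δ) (H : δ → Matrix β β B) : altTr (H ∘ e) = altTr H := by
  unfold altTr
  refine Fintype.sum_equiv e.permCongr _ _ fun σ => ?_
  rw [ptr_permCongr, Perm.sign_permCongr]

theorem altTr_option (H : Option γ → Matrix β β B) :
    altTr H = (H none).trace * altTr (H ∘ some) -
      ∑ x, altTr (Function.update (H ∘ some) x (H (some x) * H none)) := by
  conv_lhs => unfold altTr
  rw [← Fintype.sum_equiv decomposeOptionRight (fun q => (Perm.sign (decomposeOptionRight q) : ℤ) •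
    ptr (decomposeOptionRight q) H) _ (fun _ => rfl), Fintype.sum_prod_type,
    Fintype.sum_option, sub_eq_add_neg, ← Finset.sum_neg_distrib]
  congr 1
  · unfold altTr
    rw [Finset.mul_sum]
    refine Finset.sum_congr rfl fun σ _ => ?_
    rw [sign_decomposeOptionRight_none, decomposeOptionRight_apply, swap_self, mul_smul_comm,
      ← ptr_optionCongr]
    rfl
  · refine Finset.sum_congr rfl fun x _ => ?_
    unfold altTr
    rw [← Finset.sum_neg_distrib]
    refine Finset.sum_congr rfl fun σ _ => ?_
    rw [sign_decomposeOptionRight_some, decomposeOptionRight_apply, ptr_optionCongr_swap]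
    simp

/-- `altTr` of one matrix `Z` together with `k` copies of `H`. -/
def altTrConst (H : Matrix β β B) (k : ℕ) (Z : Matrix β β B) : B :=
  altTr (fun o : Option (Fin k) => o.elim Z fun _ => H)

theorem altTr_update_const (H Z : Matrix β β B) (k : ℕ) (x : Fin (k + 1)) :
    altTr (Function.update (fun _ : Fin (k + 1) => H) x Z) = altTrConst H k Z := by
  rw [altTrConst, ← altTr_reindex (finSuccEquiv' x)]
  congr 1
  funext y
  by_cases h : y = x
  · subst h; simp
  · obtain ⟨z, rfl⟩ := Fin.exists_succAbove_eq h
    simp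

theorem altTr_const_succ (H : Matrix β β B) (k : ℕ) :
    altTr (fun _ : Fin (k + 1) => H) = altTrConst H k H := by
  rw [← altTr_update_const H H k 0, Function.update_eq_self_iff.2 rfl]

theorem altTrConst_zero (H Z : Matrix β β B) : altTrConst H 0 Z = Z.trace := by
  rw [altTrConst, altTr_option]
  simp [altTr, ptr]

theorem altTrConst_succ (H Z : Matrix β β B) (k : ℕ) :
    altTrConst H (k + 1) Z =
      Z.trace * altTr (fun _ : Fin (k + 1) => H) - (k + 1) * altTrConst H k (H * Z) := by
  rw [altTrConst, altTr_option]
  congr 1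
  simp only [Option.elim_none, Option.elim_some]
  have : ((fun o : Option (Fin (k + 1)) => o.elim Z fun _ => H) ∘ some) = fun _ => H := rfl
  simp only [this, altTr_update_const]
  simp

theorem altTrConst_eq (H : Matrix β β B) (ε : ℕ → B)
    (hε : ∀ i, altTr (fun _ : Fin i => H) = (i.factorial : B) * ε i) [DecidableEq β]
    (k : ℕ) (Z : Matrix β β B) :
    altTrConst H k Z = (k.factorial : B) *
      ∑ i ∈ range (k + 1), (-1) ^ (k - i) * ε i * (H ^ (k - i) * Z).trace := by
  induction k generalizing Z with
  | zero =>
    have h0 := hε 0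
    simp [altTr, ptr] at h0
    simp [altTrConst_zero, ← h0]
  | succ k ih =>
    rw [altTrConst_succ, hε, ih, Finset.sum_range_succ _ (k + 1), mul_add]
    simp only [tsub_self, pow_zero, one_mul]
    rw [Nat.factorial_succ, sub_eq_add_neg, add_comm]
    push_cast
    congr 1
    · rw [← mul_assoc, Finset.mul_sum, Finset.mul_sum, ← Finset.sum_neg_distrib]
      refine Finset.sum_congr rfl fun i hi => ?_
      have : k + 1 - i = k - i + 1 := by
        have := Finset.mem_range.1 hi; omega
      rw [this, pow_succ, pow_succ, Matrix.mul_assoc]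
      ring
    · ring

theorem altTrConst_eq_of_trace_eq {β' : Type*} [Fintype β'] [DecidableEq β] [DecidableEq β']
    (H : Matrix β β B) (H' : Matrix β' β' B)
    (h : ∀ i, (H ^ (i + 1)).trace = (H' ^ (i + 1)).trace) (k : ℕ) :
    ∀ j, altTrConst H k (H ^ (j + 1)) = altTrConst H' k (H' ^ (j + 1)) := by
  induction k with
  | zero => simpa [altTrConst_zero] using h
  | succ k ih =>
    intro j
    have h0 := ih 0
    rw [zero_add, pow_one, pow_one] at h0
    rw [altTrConst_succ, altTrConst_succ, ← pow_succ', ← pow_succ', ih, altTr_const_succ,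
      altTr_const_succ, h0, h]

theorem altTr_const_eq_of_trace_eq {β' : Type*} [Fintype β'] [DecidableEq β] [DecidableEq β']
    (H : Matrix β β B) (H' : Matrix β' β' B)
    (h : ∀ i, (H ^ (i + 1)).trace = (H' ^ (i + 1)).trace) (k : ℕ) :
    altTr (fun _ : Fin k => H) = altTr (fun _ : Fin k => H') := by
  cases k with
  | zero => simp [altTr, ptr]
  | succ k =>
    have h0 := altTrConst_eq_of_trace_eq H H' h k 0
    rwa [zero_add, pow_one, pow_one, ← altTr_const_succ, ← altTr_const_succ] at h0

theorem altTrConst_mem {A : Subring B} [DecidableEq β] (H : Matrix β β B)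
    (h : ∀ i, (H ^ (i + 1)).trace ∈ A) (k : ℕ) :
    ∀ j, altTrConst H k (H ^ (j + 1)) ∈ A := by
  induction k with
  | zero => simpa [altTrConst_zero] using h
  | succ k ih =>
    intro j
    have h0 := ih 0
    rw [zero_add, pow_one] at h0
    rw [altTrConst_succ, ← pow_succ', altTr_const_succ]
    refine sub_mem (mul_mem (h _) h0) (mul_mem ?_ (ih _))
    exact_mod_cast natCast_mem A (k + 1)

theorem altTr_const_mem {A : Subring B} [DecidableEq β] (H : Matrix β β B)
    (h : ∀ i, (H ^ (i + 1)).trace ∈ A) (k : ℕ) :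
    altTr (fun _ : Fin k => H) ∈ A := by
  cases k with
  | zero => simp [altTr, ptr]
  | succ k =>
    have h0 := altTrConst_mem H h k 0
    rwa [zero_add, pow_one, ← altTr_const_succ] at h0

theorem altTr_const_eq_sum_det (H : Matrix β β B) (k : ℕ) :
    altTr (fun _ : Fin k => H) = ∑ I : Fin k → β, (H.submatrix I I).det := by
  unfold altTr ptr
  simp_rw [Finset.smul_sum]
  rw [Finset.sum_comm]
  refine Finset.sum_congr rfl fun I _ => ?_
  rw [← Matrix.det_transpose, Matrix.det_apply]
  refine Finset.sum_congr rfl fun σ _ => ?_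
  simp [Units.smul_def]

theorem altTr_const_eq_charpoly [DecidableEq β] (H : Matrix β β B) (k : ℕ)
    (hk : k ≤ Fintype.card β) :
    altTr (fun _ : Fin k => H) =
      (k.factorial : B) * ((-1) ^ k * H.charpoly.coeff (Fintype.card β - k)) := by
  rw [Matrix.charpoly_coeff_eq_sum_minors _ _ hk, ← mul_assoc ((-1) ^ k), ← mul_pow, neg_mul_neg,
    one_mul, one_pow, one_mul, altTr_const_eq_sum_det, Finset.mul_sum]
  rw [← Finset.sum_filter_add_sum_filter_not univ (fun I : Fin k → β => Function.Injective I)]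
  have h0 : ∑ I : Fin k → β with ¬ Function.Injective I, (H.submatrix I I).det = 0 := by
    refine Finset.sum_eq_zero fun I hI => ?_
    simp only [mem_filter, mem_univ, true_and, Function.Injective, not_forall] at hI
    obtain ⟨a, b, hab, hne⟩ := hI
    exact Matrix.det_zero_of_row_eq hne (by ext j; simp [hab])
  rw [h0, add_zero, ← Finset.sum_fiberwise_of_maps_to (g := fun I => univ.image I)
    (t := powersetCard k univ)]
  · refine Finset.sum_congr rfl fun s hs => ?_
    rw [mem_powersetCard_univ] at hs
    rw [Finset.sum_congr rfl (g := fun _ => (H.submatrix (Subtype.val : s → β) Subtype.val).det),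
      Finset.sum_const, nsmul_eq_mul]
    · congr 2
      have hc : Fintype.card (Fin k ≃ s) = k.factorial := by
        rw [Fintype.card_equiv (finCongr hs.symm |>.trans s.equivFin.symm), Fintype.card_fin]
      rw [← hc, ← Finset.card_univ]
      symm
      refine Finset.card_bij (fun (e : Fin k ≃ s) _ i => (e i : β)) ?_ ?_ ?_
      · intro e _
        simp only [mem_filter, mem_univ, true_and]
        refine ⟨Subtype.val_injective.comp e.injective, ?_⟩
        ext b
        simp only [mem_image, mem_univ, true_and]
        constructor
        · rintro ⟨a, rfl⟩; exact (e a).2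
        · intro hb; exact ⟨e.symm ⟨b, hb⟩, by simp⟩
      · intro e _ e' _ h
        ext i
        exact congrFun h i
      · intro I hI
        simp only [mem_filter, mem_univ, true_and] at hI
        obtain ⟨hI, rfl⟩ := hI
        refine ⟨Equiv.ofBijective (fun i => ⟨I i, mem_image_of_mem _ (mem_univ i)⟩) ⟨?_, ?_⟩,
          mem_univ _, rfl⟩
        · intro a b h; exact hI (congrArg Subtype.val h)
        · rintro ⟨b, hb⟩
          obtain ⟨a, -, rfl⟩ := mem_image.1 hb
          exact ⟨a, rfl⟩
    · intro I hI
      simp only [mem_filter, mem_univ, true_and] at hI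
      obtain ⟨hI, rfl⟩ := hI
      let e : Fin k ≃ (univ.image I : Finset β) :=
        Equiv.ofBijective (fun i => ⟨I i, mem_image_of_mem _ (mem_univ i)⟩)
          ⟨fun a b h => hI (congrArg Subtype.val h), by
            rintro ⟨b, hb⟩
            obtain ⟨a, -, rfl⟩ := mem_image.1 hb
            exact ⟨a, rfl⟩⟩
      rw [← Matrix.det_submatrix_equiv_self e, Matrix.submatrix_submatrix]
      rfl
  · intro I hI
    simp only [mem_filter, mem_univ, true_and] at hI
    rw [mem_powersetCard_univ, card_image_of_injective _ hI, card_univ, Fintype.card_fin]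

theorem altTr_const_eq_zero (H : Matrix β β B) (k : ℕ) (hk : Fintype.card β < k) :
    altTr (fun _ : Fin k => H) = 0 := by
  rw [altTr_const_eq_sum_det]
  refine Finset.sum_eq_zero fun I _ => ?_
  obtain ⟨a, b, hne, hab⟩ := Fintype.exists_ne_map_eq_of_card_lt I (by simpa using hk)
  exact Matrix.det_zero_of_row_eq hne (by ext j; simp [hab])

theorem ptr_add_disjoint (σ : Perm γ) (τ : Perm δ) (H : γ ⊕ δ → Matrix β β B) :
    ptr (Equiv.sumCongr σ τ) H = ptr σ (H ∘ Sum.inl) * ptr τ (H ∘ Sum.inr) := by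
  unfold ptr
  rw [Finset.sum_mul_sum, ← Fintype.sum_prod_type']
  refine Fintype.sum_equiv (Equiv.sumArrowEquivProdArrow γ δ β) _ _ fun I => ?_
  rw [Fintype.prod_sum_type]
  simp [Equiv.sumArrowEquivProdArrow]

end Ptr

section QuasiPolynomials

open Finset

variable {K : Type*} [Field K] [CharZero K] {m : ℕ}

/-- The monomial of `C⟨X⟩` given by a list of variables. -/
noncomputable def wordQ (K : Type*) [Field K] (m : ℕ) (w : List ℕ) : QPoly K m :=
  (w.map (FreeAlgebra.ι (CPoly K m))).prod

/-- The monomial in the generic matrices given by a list of variables. -/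
noncomputable def wordMat (K : Type*) [Field K] (m : ℕ) (w : List ℕ) :
    Matrix (Fin m) (Fin m) (CPoly K m) :=
  (w.map (genMat K m)).prod

omit [CharZero K] in
theorem wordQ_append (v w : List ℕ) : wordQ K m (v ++ w) = wordQ K m v * wordQ K m w := by
  simp [wordQ]

omit [CharZero K] in
theorem span_wordQ : Submodule.span (CPoly K m) (Set.range (wordQ K m)) = ⊤ := by
  rw [eq_top_iff]
  rintro P -
  have key : ∀ P : QPoly K m, ∀ x ∈ Submodule.span (CPoly K m) (Set.range (wordQ K m)),
      P * x ∈ Submodule.span (CPoly K m) (Set.range (wordQ K m)) := by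
    intro P
    induction P using FreeAlgebra.induction with
    | grade0 r =>
      intro x hx
      rw [← Algebra.smul_def]
      exact Submodule.smul_mem _ _ hx
    | grade1 k =>
      intro x hx
      induction hx using Submodule.span_induction with
      | mem x h =>
        obtain ⟨w, rfl⟩ := h
        exact Submodule.subset_span ⟨k :: w, by simp [wordQ]⟩
      | zero => simp
      | add x y _ _ hx hy => rw [mul_add]; exact add_mem hx hy
      | smul c x _ hx => rw [mul_smul_comm]; exact Submodule.smul_mem _ _ hx
    | mul a b ha hb => intro x hx; rw [mul_assoc]; exact ha _ (hb _ hx)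
    | add a b ha hb => intro x hx; rw [add_mul]; exact add_mem (ha _ hx) (hb _ hx)
  rw [← mul_one P]
  exact key P 1 (Submodule.subset_span ⟨[], by simp [wordQ]⟩)

omit [CharZero K] in
theorem QPoly.ringHom_ext {B : Type*} [Semiring B] {f g : QPoly K m →+* B}
    (hC : ∀ c : CPoly K m, f (algebraMap _ _ c) = g (algebraMap _ _ c))
    (hX : ∀ k, f (FreeAlgebra.ι _ k) = g (FreeAlgebra.ι _ k)) (P : QPoly K m) : f P = g P := by
  induction P using FreeAlgebra.induction with
  | grade0 r => exact hC r
  | grade1 k => exact hX k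
  | mul a b ha hb => rw [map_mul, map_mul, ha, hb]
  | add a b ha hb => rw [map_add, map_add, ha, hb]

theorem liftQ_algebraMap {B : Type*} [Semiring B] [Algebra K B]
    (g : CPoly K m →ₐ[K] B) (f : ℕ → B) (hg : ∀ c b, Commute (g c) b) (c : CPoly K m) :
    liftQ g f hg (algebraMap _ _ c) = g c := by
  simp [liftQ, Algebra.TensorProduct.algebraMap_apply]

theorem liftQ_ι {B : Type*} [Semiring B] [Algebra K B]
    (g : CPoly K m →ₐ[K] B) (f : ℕ → B) (hg : ∀ c b, Commute (g c) b) (k : ℕ) :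
    liftQ g f hg (FreeAlgebra.ι _ k) = f k := by
  simp [liftQ]

theorem jmap_algebraMap (c : CPoly K m) :
    jmap K m (algebraMap _ _ c) = algebraMap (CCTensor K m) _ (c ⊗ₜ 1) :=
  liftQ_algebraMap _ _ _ c

theorem jmap_smul (c : CPoly K m) (P : QPoly K m) :
    jmap K m (c • P) = (c ⊗ₜ[TnAlg K m] (1 : CPoly K m)) • jmap K m P := by
  rw [Algebra.smul_def, map_mul, jmap_algebraMap, ← Algebra.smul_def]

theorem jmap_ι (k : ℕ) : jmap K m (FreeAlgebra.ι _ k) = jf K m k :=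
  liftQ_ι _ _ _ k

/-- The inclusion of `C_y` in `C ⊗ C_y`, as a map of rings. -/
noncomputable def inclR (K : Type*) [Field K] (m : ℕ) : CPoly K m →+* CCTensor K m :=
  (Algebra.TensorProduct.includeRight (R := TnAlg K m) (A := CPoly K m)
    (B := CPoly K m)).toRingHom

omit [CharZero K] in
theorem inclR_apply (c : CPoly K m) : inclR K m c = 1 ⊗ₜ c := rfl

omit [CharZero K] in
theorem inclR_of_mem {t : CPoly K m} (ht : t ∈ TnAlg K m) : inclR K m t = t ⊗ₜ 1 := by
  have := TensorProduct.smul_tmul (R := TnAlg K m) (⟨t, ht⟩ : TnAlg K m) (1 : CPoly K m)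
    (1 : CPoly K m)
  simpa [Algebra.smul_def, inclR_apply, Subalgebra.smul_def] using this.symm

theorem jmap_wordQ (w : List ℕ) :
    jmap K m (wordQ K m w) = (inclR K m).mapMatrix (wordMat K m w) := by
  rw [wordQ, wordMat, map_list_prod, map_list_prod, List.map_map, List.map_map]
  congr 1
  refine List.map_congr_left fun k _ => ?_
  simp only [Function.comp, jmap_ι]
  rfl

omit [CharZero K] in
theorem PhiQ_wordQ (w : List ℕ) : PhiQ K m (wordQ K m w) = wordMat K m w := by
  rw [wordQ, wordMat, map_list_prod, List.map_map]
  congr 1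
  refine List.map_congr_left fun k _ => ?_
  simp [PhiQ]

omit [CharZero K] in
theorem trace_wordMat_mem (w : List ℕ) : (wordMat K m w).trace ∈ TnAlg K m := by
  by_cases h : w = []
  · subst h
    simp only [wordMat, List.map_nil, List.prod_nil, Matrix.trace_one]
    exact natCast_mem _ _
  · exact Algebra.subset_adjoin ⟨w, h, rfl⟩

theorem trace_jmap (P : QPoly K m) :
    (jmap K m P).trace = (PhiQ K m P).trace ⊗ₜ[TnAlg K m] (1 : CPoly K m) := by
  have : P ∈ Submodule.span (CPoly K m) (Set.range (wordQ K m)) := by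
    rw [span_wordQ]; trivial
  induction this using Submodule.span_induction with
  | mem x h =>
    obtain ⟨w, rfl⟩ := h
    rw [jmap_wordQ, PhiQ_wordQ, ← inclR_of_mem (trace_wordMat_mem w)]
    exact (AddMonoidHom.map_trace (inclR K m) _).symm
  | zero => simp
  | add x y _ _ hx hy => simp only [map_add, Matrix.trace_add, hx, hy, TensorProduct.add_tmul]
  | smul c x _ hx =>
    rw [jmap_smul, map_smul, Matrix.trace_smul, Matrix.trace_smul, hx]
    simp

/-- The endomorphism of `C` induced by a sequence of elements of `C⟨X⟩`. -/
noncomputable def substC (H : ℕ → QPoly K m) : CPoly K m →ₐ[K] CPoly K m :=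
  MvPolynomial.aeval fun p => PhiQ K m (H p.2.2) p.1 p.2.1

omit [CharZero K] in
theorem IsSubstEndo.apply_algebraMap {φ : QPoly K m →ₐ[K] QPoly K m} (h : IsSubstEndo K m φ)
    (c : CPoly K m) : φ (algebraMap _ _ c) =
      algebraMap _ _ (substC (fun k => φ (FreeAlgebra.ι _ k)) c) := by
  have : φ.comp (IsScalarTower.toAlgHom K (CPoly K m) (QPoly K m)) =
      (IsScalarTower.toAlgHom K (CPoly K m) (QPoly K m)).comp
        (substC (fun k => φ (FreeAlgebra.ι _ k))) := by
    apply MvPolynomial.algHom_ext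
    rintro ⟨i, j, k⟩
    simpa [substC] using h i j k
  exact DFunLike.congr_fun this c

/-- The substitution endomorphism determined by a sequence of elements of `C⟨X⟩`. -/
noncomputable def substQ (H : ℕ → QPoly K m) : QPoly K m →ₐ[K] QPoly K m :=
  liftQ ((IsScalarTower.toAlgHom K (CPoly K m) (QPoly K m)).comp (substC H)) H
    fun c b => Algebra.commutes (A := QPoly K m) (substC H c) b

theorem substQ_algebraMap (H : ℕ → QPoly K m) (c : CPoly K m) :
    substQ H (algebraMap _ _ c) = algebraMap _ _ (substC H c) :=
  liftQ_algebraMap _ _ _ _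

theorem substQ_ι (H : ℕ → QPoly K m) (k : ℕ) : substQ H (FreeAlgebra.ι _ k) = H k :=
  liftQ_ι _ _ _ _

theorem isSubstEndo_substQ (H : ℕ → QPoly K m) : IsSubstEndo K m (substQ H) := by
  intro i j k
  rw [substQ_algebraMap, substQ_ι]
  simp [substC]

omit [CharZero K] in
theorem PhiQ_algebraMap (c : CPoly K m) : PhiQ K m (algebraMap _ _ c) = algebraMap _ _ c :=
  AlgHom.commutes _ _

omit [CharZero K] in
theorem PhiQ_ι (k : ℕ) : PhiQ K m (FreeAlgebra.ι _ k) = genMat K m k := by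
  simp [PhiQ]

omit [CharZero K] in
theorem PhiQ_subst {φ : QPoly K m →ₐ[K] QPoly K m} (h : IsSubstEndo K m φ) (P : QPoly K m) :
    PhiQ K m (φ P) =
      (substC (fun k => φ (FreeAlgebra.ι _ k))).mapMatrix (PhiQ K m P) := by
  refine QPoly.ringHom_ext (f := (PhiQ K m).toRingHom.comp φ.toRingHom)
    (g := (substC (fun k => φ (FreeAlgebra.ι _ k))).mapMatrix.toRingHom.comp
      (PhiQ K m).toRingHom) ?_ ?_ P
  · intro c
    change PhiQ K m (φ (algebraMap _ _ c)) = (substC _).mapMatrix (PhiQ K m (algebraMap _ _ c))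
    rw [h.apply_algebraMap, PhiQ_algebraMap, PhiQ_algebraMap]
    ext i j : 1
    by_cases hij : i = j <;> simp [Matrix.algebraMap_matrix_apply, hij]
  · intro k
    change PhiQ K m (φ (FreeAlgebra.ι _ k)) = (substC _).mapMatrix (PhiQ K m (FreeAlgebra.ι _ k))
    rw [PhiQ_ι]
    ext i j
    simp [genMat, substC]

omit [CharZero K] in
theorem exists_ringHom_CCTensor {B : Type*} [CommRing B] (g f : CPoly K m →+* B)
    (h : ∀ t ∈ TnAlg K m, g t = f t) :
    ∃ θ : CCTensor K m →+* B, ∀ c d, θ (c ⊗ₜ d) = g c * f d := by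
  let _ : Algebra (TnAlg K m) B := (g.comp (TnAlg K m).val.toRingHom).toAlgebra
  let g' : CPoly K m →ₐ[TnAlg K m] B := { g with commutes' := fun t => rfl }
  let f' : CPoly K m →ₐ[TnAlg K m] B := { f with commutes' := fun t => (h t t.2).symm }
  exact ⟨(Algebra.TensorProduct.lift g' f' fun _ _ => Commute.all _ _).toRingHom,
    fun c d => Algebra.TensorProduct.lift_tmul _ _ _ c d⟩

theorem jmap_subst_eq_zero {φ : QPoly K m →ₐ[K] QPoly K m} (h : IsSubstEndo K m φ)
    {P : QPoly K m} (hP : jmap K m P = 0) : jmap K m (φ P) = 0 := by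
  let ψ := substC (fun k => φ (FreeAlgebra.ι _ k))
  let g : CPoly K m →ₐ[K] CCTensor K m := Algebra.TensorProduct.includeLeft.comp ψ
  let f : CPoly K m →ₐ[K] CCTensor K m :=
    MvPolynomial.aeval fun p => jmap K m (φ (FreeAlgebra.ι _ p.2.2)) p.1 p.2.1
  have hf : ∀ w, f.mapMatrix (wordMat K m w) = jmap K m (φ (wordQ K m w)) := by
    intro w
    rw [wordQ, wordMat, map_list_prod, map_list_prod, map_list_prod, List.map_map, List.map_map,
      List.map_map]
    congr 1
    refine List.map_congr_left fun k _ => ?_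
    ext i j
    simp [f, genMat]
  have hgf : ∀ t ∈ TnAlg K m, g t = f t := by
    intro t ht
    induction ht using Algebra.adjoin_induction with
    | mem t ht =>
      obtain ⟨w, -, rfl⟩ := ht
      change g (wordMat K m w).trace = f (wordMat K m w).trace
      have h1 : f (wordMat K m w).trace = (f.mapMatrix (wordMat K m w)).trace :=
        AddMonoidHom.map_trace f _
      have h2 : ψ (wordMat K m w).trace = (ψ.mapMatrix (wordMat K m w)).trace :=
        AddMonoidHom.map_trace ψ _
      rw [h1, hf, trace_jmap, PhiQ_subst h, PhiQ_wordQ, ← h2]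
      rfl
    | algebraMap r => rw [AlgHom.commutes, AlgHom.commutes]
    | add x y _ _ hx hy => rw [map_add, map_add, hx, hy]
    | mul x y _ _ hx hy => rw [map_mul, map_mul, hx, hy]
  obtain ⟨θ, hθ⟩ := exists_ringHom_CCTensor g.toRingHom f.toRingHom hgf
  have key : ∀ P, jmap K m (φ P) = θ.mapMatrix (jmap K m P) := by
    refine QPoly.ringHom_ext (f := (jmap K m).toRingHom.comp φ.toRingHom)
      (g := θ.mapMatrix.comp (jmap K m).toRingHom) ?_ ?_
    · intro c
      change jmap K m (φ (algebraMap _ _ c)) = θ.mapMatrix (jmap K m (algebraMap _ _ c))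
      rw [h.apply_algebraMap, jmap_algebraMap, jmap_algebraMap]
      ext i j
      have : θ (c ⊗ₜ 1) = ψ c ⊗ₜ 1 := by
        rw [hθ, map_one, mul_one]; rfl
      simp only [Matrix.algebraMap_matrix_apply, RingHom.mapMatrix_apply, Matrix.map_apply,
        apply_ite θ, map_zero]
      simp only [Algebra.algebraMap_self, RingHom.id_apply, this]
      rfl
    · intro k
      change jmap K m (φ (FreeAlgebra.ι _ k)) = θ.mapMatrix (jmap K m (FreeAlgebra.ι _ k))
      rw [jmap_ι]
      ext i j
      have : θ (1 ⊗ₜ MvPolynomial.X (i, j, k)) = f (MvPolynomial.X (i, j, k)) := by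
        rw [hθ, map_one, one_mul]; rfl
      simp only [RingHom.mapMatrix_apply, Matrix.map_apply, jf, genMat, Matrix.of_apply,
        Algebra.TensorProduct.includeRight_apply, this]
      simp [f]
  rw [key, hP, map_zero]

theorem charpoly_coeff_eq (M : Matrix (Fin m) (Fin m) (CPoly K m)) (k : ℕ) (hk : k ≤ m) :
    M.charpoly.coeff (m - k) =
      ((-1 : K) ^ k * (k.factorial : K)⁻¹) • altTr (fun _ : Fin k => M) := by
  rw [altTr_const_eq_charpoly M k (by simpa using hk), Fintype.card_fin,
    Algebra.smul_def, map_mul, map_pow, map_neg, map_one]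
  have h1 : algebraMap K (CPoly K m) (k.factorial : K)⁻¹ * (k.factorial : CPoly K m) = 1 := by
    rw [← map_natCast (algebraMap K (CPoly K m)), ← map_mul,
      inv_mul_cancel₀ (by exact_mod_cast k.factorial_ne_zero), map_one]
  have h2 : ((-1 : CPoly K m) ^ k) * (-1) ^ k = 1 := by
    rw [← mul_pow, neg_mul_neg, one_mul, one_pow]
  linear_combination (-M.charpoly.coeff (m - k)) * h1 -
    (algebraMap K (CPoly K m) (k.factorial : K)⁻¹ * k.factorial * M.charpoly.coeff (m - k)) * h2

theorem charpoly_coeff_mem (k : ℕ) : (genMat K m 0).charpoly.coeff k ∈ TnAlg K m := by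
  by_cases hk : k ≤ m
  · have := charpoly_coeff_eq (genMat K m 0) (m - k) (Nat.sub_le _ _)
    rw [Nat.sub_sub_self hk] at this
    rw [this]
    refine Subalgebra.smul_mem _ ?_ _
    refine altTr_const_mem (A := (TnAlg K m).toSubring) _ (fun i => ?_) _
    have := trace_wordMat_mem (K := K) (m := m) (List.replicate (i + 1) 0)
    rwa [wordMat, List.map_replicate, List.prod_replicate] at this
  · rw [Polynomial.coeff_eq_zero_of_natDegree_lt]
    · exact zero_mem _
    · rw [Matrix.charpoly_natDegree_eq_dim, Fintype.card_fin]; omega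

theorem jmap_chQ : jmap K m (chQ K m) = 0 := by
  have h := congrArg (inclR K m).mapMatrix (Matrix.aeval_self_charpoly (genMat K m 0))
  rw [map_zero, Polynomial.aeval_eq_sum_range, Matrix.charpoly_natDegree_eq_dim,
    Fintype.card_fin, map_sum] at h
  rw [chQ, map_sum, ← h]
  refine Finset.sum_congr rfl fun i _ => ?_
  rw [map_mul, map_pow, jmap_ι, jmap_algebraMap, ← inclR_of_mem (charpoly_coeff_mem i),
    ← Algebra.smul_def]
  have : jf K m 0 = (inclR K m).mapMatrix (genMat K m 0) := rfl
  rw [this, ← map_pow]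
  ext a b
  simp

theorem isTIdeal_ker_jmap : IsTIdeal K m {P | jmap K m P = 0} := by
  refine ⟨map_zero _, ?_, ?_, ?_, ?_⟩
  · intro a b ha hb
    simp only [Set.mem_ofPred_eq] at *
    rw [map_add, ha, hb, add_zero]
  · intro r a ha
    simp only [Set.mem_ofPred_eq] at *
    rw [map_mul, ha, mul_zero]
  · intro r a ha
    simp only [Set.mem_ofPred_eq] at *
    rw [map_mul, ha, zero_mul]
  · intro φ hφ p hp
    exact jmap_subst_eq_zero hφ hp

end QuasiPolynomials

section

open Finset MvPolynomial

theorem exists_sub_orthogonal {k V : Type*} [Field k] [AddCommGroup V] [Module k V]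
    (b : V →ₗ[k] V →ₗ[k] k) (W : Submodule k V) [FiniteDimensional k W]
    (hb : ∀ x ∈ W, b x x = 0 → x = 0) (v : V) : ∃ w ∈ W, ∀ u ∈ W, b (v - w) u = 0 := by
  let L : W →ₗ[k] Module.Dual k W := (b.compl₁₂ W.subtype W.subtype)
  have hL : Function.Injective L := by
    rw [← LinearMap.ker_eq_bot, LinearMap.ker_eq_bot']
    intro x hx
    exact Subtype.ext (hb x x.2 (DFunLike.congr_fun hx x))
  have hs : Function.Surjective L :=
    (LinearMap.injective_iff_surjective_of_finrank_eq_finrank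
      Subspace.dual_finrank_eq.symm).1 hL
  obtain ⟨w, hw⟩ := hs ((b v).comp W.subtype)
  refine ⟨w, w.2, fun u hu => ?_⟩
  have h := DFunLike.congr_fun hw ⟨u, hu⟩
  rw [map_sub, LinearMap.sub_apply, sub_eq_zero]
  exact h.symm

section Fischer
variable {ι : Type*}

/-- The Fischer inner product on polynomials. -/
noncomputable def fischer : MvPolynomial ι ℚ →ₗ[ℚ] MvPolynomial ι ℚ →ₗ[ℚ] ℚ :=
  (basisMonomials ι ℚ).constr ℚ fun e =>
    (e.prod fun _ k => (k.factorial : ℚ)) • lcoeff ℚ e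

theorem fischer_monomial (e : ι →₀ ℕ) (a : ℚ) (g : MvPolynomial ι ℚ) :
    fischer (monomial e a) g = a * ((e.prod fun _ k => (k.factorial : ℚ)) * coeff e g) := by
  have h : monomial e a = a • basisMonomials ι ℚ e := by
    rw [coe_basisMonomials, smul_monomial, smul_eq_mul, mul_one]
  rw [h, map_smul, fischer, Module.Basis.constr_basis]
  simp

theorem fischer_eq_sum (f g : MvPolynomial ι ℚ) :
    fischer f g =
      ∑ e ∈ f.support, coeff e f * ((e.prod fun _ k => (k.factorial : ℚ)) * coeff e g) := by
  conv_lhs => rw [f.as_sum]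
  rw [map_sum, LinearMap.sum_apply]
  simp_rw [fischer_monomial]

theorem eq_zero_of_fischer_self (f : MvPolynomial ι ℚ) (h : fischer f f = 0) : f = 0 := by
  have hpos : ∀ e : ι →₀ ℕ, 0 < e.prod fun _ k => (k.factorial : ℚ) := fun e =>
    Finset.prod_pos fun i _ => Nat.cast_pos.2 (e i).factorial_pos
  rw [fischer_eq_sum, Finset.sum_eq_zero_iff_of_nonneg] at h
  · ext e
    by_contra hne
    have h0 := h e (mem_support_iff.2 hne)
    rw [mul_left_comm] at h0
    rcases mul_eq_zero.1 h0 with h0 | h0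
    · exact (hpos e).ne' h0
    · exact hne (mul_self_eq_zero.1 h0)
  · intro e _
    rw [mul_left_comm]
    exact mul_nonneg (hpos e).le (mul_self_nonneg _)

theorem fischer_mul_X [DecidableEq ι] (v : ι) (f g : MvPolynomial ι ℚ) :
    fischer (f * X v) g = fischer f (pderiv v g) := by
  induction f using MvPolynomial.induction_on' with
  | add p q hp hq => rw [add_mul, map_add, map_add, LinearMap.add_apply, LinearMap.add_apply, hp, hq]
  | monomial e a =>
    have h : monomial e a * X v = monomial (e + Finsupp.single v 1) a := by
      rw [X, monomial_mul, mul_one]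
    rw [h, fischer_monomial, fischer_monomial, coeff_pderiv]
    have h1 : ∀ d : ι →₀ ℕ, (d.prod fun _ k => (k.factorial : ℚ)) =
        (d v).factorial * (d.erase v).prod fun _ k => (k.factorial : ℚ) := fun d =>
      (Finsupp.mul_prod_erase' d v (fun _ k => (k.factorial : ℚ)) (by simp)).symm
    have h2 : (e + Finsupp.single v 1).erase v = e.erase v := by
      rw [Finsupp.erase_add, Finsupp.erase_single, add_zero]
    rw [h1 (e + Finsupp.single v 1), h1 e, h2]
    simp only [Finsupp.coe_add, Pi.add_apply, Finsupp.single_eq_same, Nat.factorial_succ]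
    push_cast
    ring

end Fischer

section TraceModule
variable {K : Type*} [Field K] {m : ℕ}

/-- The module of covariants: the `T_n`-span of the monomials in the generic matrices. -/
noncomputable def wordSpan (K : Type*) [Field K] (m : ℕ) :
    Submodule (TnAlg K m) (Matrix (Fin m) (Fin m) (CPoly K m)) :=
  Submodule.span _ (Set.range (wordMat K m))

theorem wordMat_append (v w : List ℕ) : wordMat K m (v ++ w) = wordMat K m v * wordMat K m w := by
  simp [wordMat]

theorem mul_mem_wordSpan {G H : Matrix (Fin m) (Fin m) (CPoly K m)} (hG : G ∈ wordSpan K m)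
    (hH : H ∈ wordSpan K m) : G * H ∈ wordSpan K m := by
  induction hG using Submodule.span_induction with
  | mem x hx =>
    obtain ⟨v, rfl⟩ := hx
    induction hH using Submodule.span_induction with
    | mem x hx =>
      obtain ⟨w, rfl⟩ := hx
      exact Submodule.subset_span ⟨v ++ w, wordMat_append v w⟩
    | zero => rw [mul_zero]; exact zero_mem _
    | add x y _ _ hx hy => rw [mul_add]; exact add_mem hx hy
    | smul c x _ hx => rw [mul_smul_comm]; exact Submodule.smul_mem _ _ hx
  | zero => rw [zero_mul]; exact zero_mem _
  | add x y _ _ hx hy => rw [add_mul]; exact add_mem hx hy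
  | smul c x _ hx => rw [smul_mul_assoc]; exact Submodule.smul_mem _ _ hx

theorem wordMat_mem_wordSpan (w : List ℕ) : wordMat K m w ∈ wordSpan K m :=
  Submodule.subset_span ⟨w, rfl⟩

theorem one_mem_wordSpan : (1 : Matrix (Fin m) (Fin m) (CPoly K m)) ∈ wordSpan K m :=
  Submodule.subset_span ⟨[], by simp [wordMat]⟩

theorem genMat_mem_wordSpan (k : ℕ) : genMat K m k ∈ wordSpan K m :=
  Submodule.subset_span ⟨[k], by simp [wordMat]⟩

theorem smul_mem_wordSpan {t : CPoly K m} (ht : t ∈ TnAlg K m)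
    {G : Matrix (Fin m) (Fin m) (CPoly K m)} (hG : G ∈ wordSpan K m) :
    t • G ∈ wordSpan K m :=
  Submodule.smul_mem _ (⟨t, ht⟩ : TnAlg K m) hG

theorem trace_mem_of_mem_wordSpan {G : Matrix (Fin m) (Fin m) (CPoly K m)}
    (hG : G ∈ wordSpan K m) : G.trace ∈ TnAlg K m := by
  induction hG using Submodule.span_induction with
  | mem x hx => obtain ⟨v, rfl⟩ := hx; exact trace_wordMat_mem v
  | zero => rw [Matrix.trace_zero]; exact zero_mem _
  | add x y _ _ hx hy => rw [Matrix.trace_add]; exact add_mem hx hy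
  | smul c x _ hx =>
    have : (c • x).trace = (c : CPoly K m) * x.trace := by
      rw [Matrix.trace_smul]; rfl
    rw [this]
    exact mul_mem c.2 hx

/-- The matrix gradient of a polynomial in the entries of the `k`-th generic matrix. -/
noncomputable def nablaMat (k : ℕ) (t : CPoly K m) : Matrix (Fin m) (Fin m) (CPoly K m) :=
  Matrix.of fun c b => pderiv (b, c, k) t

theorem pderiv_matrix_mul (v : Fin m × Fin m × ℕ) (G H : Matrix (Fin m) (Fin m) (CPoly K m)) :
    (G * H).map (pderiv v) = G * H.map (pderiv v) + G.map (pderiv v) * H := by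
  ext i j : 1
  simp only [Matrix.map_apply, Matrix.mul_apply, Matrix.add_apply, map_sum, Derivation.leibniz,
    Finset.sum_add_distrib, smul_eq_mul]
  refine congrArg₂ (· + ·) rfl (Finset.sum_congr rfl fun _ _ => mul_comm _ _)

theorem trace_mul_pderiv_wordMat_mem (k : ℕ) (w : List ℕ)
    {G : Matrix (Fin m) (Fin m) (CPoly K m)} (hG : G ∈ wordSpan K m) :
    (Matrix.of fun c b => (G * (wordMat K m w).map (pderiv (b, c, k))).trace) ∈ wordSpan K m := by
  induction w generalizing G with
  | nil =>
    convert zero_mem (wordSpan K m) using 1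
    ext c b : 1
    have : (wordMat K m []).map (pderiv (b, c, k)) = 0 := by
      ext i j : 1
      by_cases h : i = j <;> simp [wordMat, h]
    simp [this]
  | cons l w ih =>
    have hw : wordMat K m (l :: w) = genMat K m l * wordMat K m w := by simp [wordMat]
    have h1 := ih (mul_mem_wordSpan hG (genMat_mem_wordSpan l))
    have h2 : (if l = k then wordMat K m w * G else 0) ∈ wordSpan K m := by
      split_ifs
      · exact mul_mem_wordSpan (wordMat_mem_wordSpan w) hG
      · exact zero_mem _
    convert add_mem h1 h2 using 1
    ext c b : 1
    rw [Matrix.of_apply, hw, pderiv_matrix_mul, mul_add, Matrix.trace_add, Matrix.add_apply,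
      Matrix.of_apply, Matrix.mul_assoc]
    congr 1
    have h3 : (genMat K m l).map (pderiv (b, c, k)) =
        if l = k then Matrix.single b c 1 else 0 := by
      ext i j : 1
      rw [Matrix.map_apply, genMat, Matrix.of_apply, pderiv_X]
      split_ifs with h
      · subst h
        simp only [Matrix.single_apply, Pi.single_apply, Prod.mk.injEq, and_true]
        simp only [eq_comm]
      · rw [Pi.single_eq_of_ne]
        · rfl
        · simp [h]
    rw [h3]
    split_ifs
    · rw [← Matrix.mul_assoc, Matrix.trace_mul_comm, ← Matrix.mul_assoc, Matrix.trace_mul_comm,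
        Matrix.trace_single_mul]
      simp
    · simp

theorem nablaMat_mem (k : ℕ) {t : CPoly K m} (ht : t ∈ TnAlg K m) :
    nablaMat k t ∈ wordSpan K m := by
  induction ht using Algebra.adjoin_induction with
  | mem t ht =>
    obtain ⟨w, -, rfl⟩ := ht
    convert trace_mul_pderiv_wordMat_mem k w (one_mem_wordSpan (K := K) (m := m)) using 1
    ext c b : 1
    rw [nablaMat, Matrix.of_apply, Matrix.of_apply, one_mul]
    simp [Matrix.trace, wordMat]
  | algebraMap r =>
    convert zero_mem (wordSpan K m) using 1
    ext c b : 1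
    simp [nablaMat]
  | add x y _ _ hx hy =>
    convert add_mem hx hy using 1
    ext c b : 1
    simp [nablaMat]
  | mul x y hx' hy' hx hy =>
    convert add_mem (smul_mem_wordSpan hx' hy) (smul_mem_wordSpan hy' hx) using 1
    ext c b : 1
    simp [nablaMat]

/-- The operator adjoint to right multiplication by the `k`-th generic matrix. -/
noncomputable def divMat (k : ℕ) (G : Matrix (Fin m) (Fin m) (CPoly K m)) :
    Matrix (Fin m) (Fin m) (CPoly K m) :=
  Matrix.of fun a c => ∑ b, pderiv (c, b, k) (G a b)

theorem divMat_add (k : ℕ) (G H : Matrix (Fin m) (Fin m) (CPoly K m)) :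
    divMat k (G + H) = divMat k G + divMat k H := by
  ext a c : 1
  simp [divMat, Finset.sum_add_distrib]

theorem divMat_smul (k : ℕ) (t : CPoly K m) (G : Matrix (Fin m) (Fin m) (CPoly K m)) :
    divMat k (t • G) = G * nablaMat k t + t • divMat k G := by
  ext a c : 1
  simp only [divMat, nablaMat, Matrix.of_apply, Matrix.smul_apply, Matrix.add_apply,
    Matrix.mul_apply, smul_eq_mul, Derivation.leibniz, Finset.sum_add_distrib, Finset.mul_sum]
  rw [add_comm]

theorem divMat_genMat_mul (k l : ℕ) (G : Matrix (Fin m) (Fin m) (CPoly K m)) :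
    divMat k (genMat K m l * G) =
      (if l = k then G.trace • 1 else 0) + genMat K m l * divMat k G := by
  ext a c : 1
  simp only [divMat, Matrix.of_apply, Matrix.mul_apply, Matrix.add_apply, map_sum,
    Derivation.leibniz, Finset.sum_add_distrib, smul_eq_mul, Finset.mul_sum]
  rw [add_comm]
  refine congrArg₂ (· + ·) ?_ ?_
  · split_ifs with h
    · subst h
      simp only [genMat, Matrix.of_apply, pderiv_X, Pi.single_apply, Prod.mk.injEq, and_true,
        Matrix.smul_apply, Matrix.one_apply, smul_eq_mul]
      by_cases hac : a = c
      · subst hac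
        simp [Matrix.trace]
      · simp [hac]
    · refine Finset.sum_eq_zero fun b _ => Finset.sum_eq_zero fun e _ => ?_
      rw [genMat, Matrix.of_apply, pderiv_X, Pi.single_eq_of_ne, mul_zero]
      simp [h]
  · exact Finset.sum_comm

theorem divMat_mem (k : ℕ) {G : Matrix (Fin m) (Fin m) (CPoly K m)} (hG : G ∈ wordSpan K m) :
    divMat k G ∈ wordSpan K m := by
  induction hG using Submodule.span_induction with
  | mem x hx =>
    obtain ⟨w, rfl⟩ := hx
    induction w with
    | nil =>
      convert zero_mem (wordSpan K m) using 1
      ext a c : 1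
      simp only [divMat, Matrix.of_apply, Matrix.zero_apply, wordMat, List.map_nil,
        List.prod_nil]
      refine Finset.sum_eq_zero fun b _ => ?_
      by_cases h : a = b <;> simp [Matrix.one_apply, h]
    | cons l w ih =>
      have hw : wordMat K m (l :: w) = genMat K m l * wordMat K m w := by simp [wordMat]
      rw [hw, divMat_genMat_mul]
      refine add_mem ?_ (mul_mem_wordSpan (genMat_mem_wordSpan l) ih)
      split_ifs
      · exact smul_mem_wordSpan (trace_wordMat_mem w) one_mem_wordSpan
      · exact zero_mem _
  | zero =>
    convert zero_mem (wordSpan K m) using 1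
    ext a c : 1
    simp [divMat]
  | add x y _ _ hx hy => rw [divMat_add]; exact add_mem hx hy
  | smul c x hx' hx =>
    have : c • x = (c : CPoly K m) • x := rfl
    rw [this, divMat_smul]
    exact add_mem (mul_mem_wordSpan hx' (nablaMat_mem k c.2)) (smul_mem_wordSpan c.2 hx)

theorem TnAlg_eq_span : Subalgebra.toSubmodule (TnAlg K m) = Submodule.span K
    (Submonoid.closure {c : CPoly K m | ∃ l : List ℕ, l ≠ [] ∧
      c = Matrix.trace ((l.map (genMat K m)).prod)} : Set (CPoly K m)) :=
  Algebra.adjoin_eq_span K _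

end TraceModule

end

section Homogeneity

open Finset MvPolynomial

variable {K : Type*} [Field K] {m : ℕ}

/-- The multidegree which records how often each generic matrix occurs. -/
noncomputable def matWeight (m : ℕ) : Fin m × Fin m × ℕ → (ℕ →₀ ℕ) :=
  fun p => Finsupp.single p.2.2 1

theorem isWeightedHomogeneous_wordMat (w : List ℕ) (i j : Fin m) :
    IsWeightedHomogeneous (matWeight m) (wordMat K m w i j)
      ((w.map fun k => Finsupp.single k 1).sum) := by
  induction w generalizing i j with
  | nil =>
    by_cases h : i = j
    · subst h
      simpa [wordMat] using isWeightedHomogeneous_one K (matWeight m)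
    · simpa [wordMat, h] using isWeightedHomogeneous_zero K (matWeight m) 0
  | cons l w ih =>
    have hw : wordMat K m (l :: w) i j = ∑ e, genMat K m l i e * wordMat K m w e j := by
      simp [wordMat, Matrix.mul_apply]
    rw [hw, List.map_cons, List.sum_cons]
    refine IsWeightedHomogeneous.sum _ _ _ fun e _ => ?_
    exact (isWeightedHomogeneous_X K (matWeight m) (i, e, l)).mul (ih e j)

theorem weightedHomogeneousComponent_mem_TnAlg (d : ℕ →₀ ℕ) {t : CPoly K m}
    (ht : t ∈ TnAlg K m) : weightedHomogeneousComponent (matWeight m) d t ∈ TnAlg K m := by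
  have ht' : t ∈ Subalgebra.toSubmodule (TnAlg K m) := ht
  rw [TnAlg_eq_span] at ht'
  induction ht' using Submodule.span_induction with
  | mem x hx =>
    clear ht
    have hh : ∃ e, IsWeightedHomogeneous (matWeight m) x e := by
      induction hx using Submonoid.closure_induction with
      | mem x hx =>
        obtain ⟨w, -, rfl⟩ := hx
        exact ⟨_, IsWeightedHomogeneous.sum _ _ _ fun i _ => isWeightedHomogeneous_wordMat w i i⟩
      | one => exact ⟨_, isWeightedHomogeneous_one _ _⟩
      | mul x y _ _ hx hy =>
        obtain ⟨e, he⟩ := hx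
        obtain ⟨e', he'⟩ := hy
        exact ⟨_, he.mul he'⟩
    obtain ⟨e, he⟩ := hh
    have hx : x ∈ Subalgebra.toSubmodule (TnAlg K m) := by
      rw [TnAlg_eq_span]; exact Submodule.subset_span hx
    classical
    rw [weightedHomogeneousComponent_of_mem he]
    split_ifs
    · exact hx
    · exact zero_mem _
  | zero => rw [map_zero]; exact zero_mem _
  | add x y hx hy hx' hy' =>
    rw [← TnAlg_eq_span] at hx hy
    rw [map_add]; exact add_mem (hx' hx) (hy' hy)
  | smul c x hx hx' =>
    rw [← TnAlg_eq_span] at hx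
    rw [map_smul]; exact Subalgebra.smul_mem _ (hx' hx) _

theorem finite_weight_eq (d : ℕ →₀ ℕ) : {e : Fin m × Fin m × ℕ →₀ ℕ | Finsupp.weight (matWeight m) e = d}.Finite := by
  classical
  let D : Fin m × Fin m × ℕ →₀ ℕ :=
    ∑ i : Fin m, ∑ j : Fin m, d.embDomain ⟨fun k => (i, j, k), fun a b h => by simpa using h⟩
  refine (Set.finite_Iic D).subset fun e he => ?_
  have he : Finsupp.weight (matWeight m) e = d := he
  intro ⟨i, j, k⟩
  have h1 : e (i, j, k) ≤ d k := by
    rw [← he, Finsupp.weight_apply, Finsupp.sum_apply]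
    simp only [matWeight, Finsupp.smul_apply, Finsupp.single_apply, smul_eq_mul, mul_ite, mul_one,
      mul_zero]
    by_cases h : (i, j, k) ∈ e.support
    · refine le_trans ?_ (Finset.single_le_sum (fun _ _ => Nat.zero_le _) h)
      simp
    · rw [Finsupp.notMem_support_iff.1 h]
      exact Nat.zero_le _
  refine h1.trans ?_
  simp only [D, Finsupp.coe_finsetSum, Finset.sum_apply]
  refine le_trans ?_ (Finset.single_le_sum (fun _ _ => Nat.zero_le _) (mem_univ i))
  refine le_trans ?_ (Finset.single_le_sum (fun _ _ => Nat.zero_le _) (mem_univ j))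
  exact (Finsupp.embDomain_apply_self ⟨fun k => (i, j, k), fun a b h => by simpa using h⟩ d k).ge

instance finiteDimensional_weightedHomogeneousSubmodule (d : ℕ →₀ ℕ) :
    FiniteDimensional K (weightedHomogeneousSubmodule K (matWeight m) d) := by
  have hle : weightedHomogeneousSubmodule K (matWeight m) d ≤
      Submodule.span K ((fun e => monomial e (1 : K)) ''
        {e | Finsupp.weight (matWeight m) e = d}) := by
    intro f hf
    rw [f.as_sum]
    refine Submodule.sum_mem _ fun e he => ?_
    have : monomial e (coeff e f) = coeff e f • monomial e (1 : K) := by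
      rw [smul_monomial, smul_eq_mul, mul_one]
    rw [this]
    exact Submodule.smul_mem _ _ (Submodule.subset_span ⟨e, hf (mem_support_iff.1 he), rfl⟩)
  have : FiniteDimensional K (Submodule.span K ((fun e => monomial e (1 : K)) ''
        {e : Fin m × Fin m × ℕ →₀ ℕ | Finsupp.weight (matWeight m) e = d})) :=
    FiniteDimensional.span_of_finite K ((finite_weight_eq d).image _)
  exact Submodule.finiteDimensional_of_le hle

end Homogeneity

section Retraction

open Finset MvPolynomial

variable {m : ℕ}

/-- The orthogonal complement of the trace ring for the Fischer inner product. -/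
noncomputable def fischerOrtho (m : ℕ) : Submodule ℚ (CPoly ℚ m) where
  carrier := {p | ∀ t ∈ TnAlg ℚ m, fischer p t = 0}
  zero_mem' := fun t _ => by rw [map_zero, LinearMap.zero_apply]
  add_mem' := fun {a b} ha hb t ht => by
    rw [map_add, LinearMap.add_apply, ha t ht, hb t ht, add_zero]
  smul_mem' := fun c a ha t ht => by
    rw [map_smul, LinearMap.smul_apply, ha t ht, smul_zero]

theorem fischer_component (d : ℕ →₀ ℕ) {p : CPoly ℚ m}
    (hp : IsWeightedHomogeneous (matWeight m) p d) (t : CPoly ℚ m) :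
    fischer p t = fischer p (weightedHomogeneousComponent (matWeight m) d t) := by
  classical
  rw [fischer_eq_sum, fischer_eq_sum]
  refine Finset.sum_congr rfl fun e he => ?_
  rw [coeff_weightedHomogeneousComponent, if_pos (hp (mem_support_iff.1 he))]

theorem isCompl_fischerOrtho :
    IsCompl (Subalgebra.toSubmodule (TnAlg ℚ m)) (fischerOrtho m) := by
  constructor
  · rw [Submodule.disjoint_def]
    exact fun x hx hx' => eq_zero_of_fischer_self x (hx' x hx)
  · rw [codisjoint_iff, eq_top_iff]
    rintro f -
    induction f using MvPolynomial.induction_on' with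
    | add p q hp hq => exact add_mem hp hq
    | monomial e a =>
      let d := Finsupp.weight (matWeight m) e
      have hf : IsWeightedHomogeneous (matWeight m) (monomial e a) d :=
        isWeightedHomogeneous_monomial _ _ _ rfl
      let W : Submodule ℚ (CPoly ℚ m) :=
        Subalgebra.toSubmodule (TnAlg ℚ m) ⊓ weightedHomogeneousSubmodule ℚ (matWeight m) d
      have : FiniteDimensional ℚ W := Submodule.finiteDimensional_of_le inf_le_right
      obtain ⟨w, hw, h⟩ := exists_sub_orthogonal fischer W
        (fun x _ hx => eq_zero_of_fischer_self x hx) (monomial e a)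
      refine Submodule.mem_sup.2 ⟨w, hw.1, monomial e a - w, fun t ht => ?_, by simp⟩
      rw [fischer_component d (hf.sub hw.2)]
      exact h _ ⟨weightedHomogeneousComponent_mem_TnAlg d ht,
        weightedHomogeneousComponent_mem _ _ _⟩

/-- The adjoint of multiplication by a monomial in the generic matrices. -/
theorem sum_fischer_mul_wordMat (w : List ℕ) :
    ∃ D : Matrix (Fin m) (Fin m) (CPoly ℚ m) → Matrix (Fin m) (Fin m) (CPoly ℚ m),
      (∀ G ∈ wordSpan ℚ m, D G ∈ wordSpan ℚ m) ∧
      ∀ G H : Matrix (Fin m) (Fin m) (CPoly ℚ m),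
        ∑ a, ∑ b, fischer ((G * wordMat ℚ m w) a b) (H a b) =
          ∑ a, ∑ b, fischer (G a b) (D H a b) := by
  induction w with
  | nil => exact ⟨id, fun _ h => h, fun G H => by simp [wordMat]⟩
  | cons k w ih =>
    obtain ⟨D, hD, hD'⟩ := ih
    refine ⟨fun H => divMat k (D H), fun G hG => divMat_mem k (hD G hG), fun G H => ?_⟩
    have hw : G * wordMat ℚ m (k :: w) = (G * genMat ℚ m k) * wordMat ℚ m w := by
      simp [wordMat, mul_assoc]
    rw [hw, hD']
    refine Finset.sum_congr rfl fun a _ => ?_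
    simp only [Matrix.mul_apply, divMat, Matrix.of_apply, map_sum, LinearMap.sum_apply]
    rw [Finset.sum_comm]
    refine Finset.sum_congr rfl fun c _ => Finset.sum_congr rfl fun b _ => ?_
    rw [genMat, Matrix.of_apply, fischer_mul_X]

theorem trace_wordMat_mul_mem_fischerOrtho (w : List ℕ) {p : CPoly ℚ m}
    (hp : p ∈ fischerOrtho m) : (wordMat ℚ m w).trace * p ∈ fischerOrtho m := by
  intro t ht
  obtain ⟨D, hD, hD'⟩ := sum_fischer_mul_wordMat (m := m) w
  have h := hD' (p • 1) (t • 1)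
  have h1 : ∀ (q : CPoly ℚ m) (G : Matrix (Fin m) (Fin m) (CPoly ℚ m)),
      ∑ a, ∑ b, fischer (G a b) ((q • (1 : Matrix (Fin m) (Fin m) (CPoly ℚ m))) a b) =
        fischer G.trace q := by
    intro q G
    simp only [Matrix.trace, Matrix.diag, map_sum, LinearMap.sum_apply]
    refine Finset.sum_congr rfl fun a _ => ?_
    rw [Finset.sum_eq_single a]
    · simp
    · intro b _ hb
      simp [Ne.symm hb]
    · simp
  have h2 : ∀ (q : CPoly ℚ m) (G : Matrix (Fin m) (Fin m) (CPoly ℚ m)),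
      ∑ a, ∑ b, fischer ((q • (1 : Matrix (Fin m) (Fin m) (CPoly ℚ m))) a b) (G a b) =
        fischer q G.trace := by
    intro q G
    simp only [Matrix.trace, Matrix.diag, map_sum]
    refine Finset.sum_congr rfl fun a _ => ?_
    rw [Finset.sum_eq_single a]
    · simp
    · intro b _ hb
      simp [Ne.symm hb]
    · simp
  rw [h1, h2, smul_mul_assoc, one_mul, Matrix.trace_smul, smul_eq_mul, mul_comm] at h
  rw [h]
  exact hp _ (trace_mem_of_mem_wordSpan (hD _ (smul_mem_wordSpan ht one_mem_wordSpan)))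

theorem mul_mem_fischerOrtho {t p : CPoly ℚ m} (ht : t ∈ TnAlg ℚ m) (hp : p ∈ fischerOrtho m) :
    t * p ∈ fischerOrtho m := by
  induction ht using Algebra.adjoin_induction generalizing p with
  | mem t ht =>
    obtain ⟨w, -, rfl⟩ := ht
    exact trace_wordMat_mul_mem_fischerOrtho w hp
  | algebraMap r => rw [← Algebra.smul_def]; exact Submodule.smul_mem _ _ hp
  | add x y _ _ hx hy => rw [add_mul]; exact add_mem (hx hp) (hy hp)
  | mul x y _ _ hx hy => rw [mul_assoc]; exact hx (hy hp)

theorem exists_reynolds_rat (m : ℕ) : ∃ π : CPoly ℚ m →ₗ[ℚ] CPoly ℚ m,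
    (∀ c, π c ∈ TnAlg ℚ m) ∧ (∀ t ∈ TnAlg ℚ m, π t = t) ∧
      ∀ t ∈ TnAlg ℚ m, ∀ c, π (t * c) = t * π c := by
  have hc := isCompl_fischerOrtho (m := m)
  refine ⟨Submodule.projection _ _ hc, fun c => Submodule.projection_apply_mem hc c,
    fun t ht => Submodule.projection_apply_of_mem_left hc ht, fun t ht c => ?_⟩
  have h1 : t * c = t * Submodule.projection _ _ hc c + t * (c - Submodule.projection _ _ hc c) := by
    ring
  conv_lhs => rw [h1]
  rw [map_add, Submodule.projection_apply_of_mem_left hc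
    (mul_mem ht (Submodule.projection_apply_mem hc c) : _ ∈ TnAlg ℚ m),
    (Submodule.projection_apply_eq_zero_iff hc).2
      (mul_mem_fischerOrtho ht (Submodule.sub_projection_mem hc c)), add_zero]

variable {K : Type*} [Field K] [CharZero K]

/-- The base change from rational coefficients. -/
noncomputable def ratC (K : Type*) [Field K] [CharZero K] (m : ℕ) : CPoly ℚ m →+* CPoly K m :=
  MvPolynomial.map (algebraMap ℚ K)

theorem ratC_wordMat (w : List ℕ) : (ratC K m).mapMatrix (wordMat ℚ m w) = wordMat K m w := by
  rw [wordMat, wordMat, map_list_prod, List.map_map]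
  congr 1
  refine List.map_congr_left fun k _ => ?_
  ext i j : 1
  simp [genMat, ratC]

theorem ratC_trace_wordMat (w : List ℕ) :
    ratC K m (wordMat ℚ m w).trace = (wordMat K m w).trace := by
  rw [← ratC_wordMat (K := K)]
  simp only [Matrix.trace, Matrix.diag, map_sum, RingHom.mapMatrix_apply, Matrix.map_apply]

theorem ratC_mem_TnAlg {t : CPoly ℚ m} (ht : t ∈ TnAlg ℚ m) : ratC K m t ∈ TnAlg K m := by
  induction ht using Algebra.adjoin_induction with
  | mem t ht =>
    obtain ⟨w, -, rfl⟩ := ht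
    have := trace_wordMat_mem (K := K) (m := m) w
    rw [← ratC_trace_wordMat] at this
    exact this
  | algebraMap r =>
    have : ratC K m (algebraMap ℚ _ r) = algebraMap K _ (algebraMap ℚ K r) := by
      simp [ratC, MvPolynomial.algebraMap_eq]
    rw [this]
    exact Subalgebra.algebraMap_mem _ _
  | add x y _ _ hx hy => rw [map_add]; exact add_mem hx hy
  | mul x y _ _ hx hy => rw [map_mul]; exact mul_mem hx hy

theorem TnAlg_le_span_ratC {t : CPoly K m} (ht : t ∈ TnAlg K m) :
    t ∈ Submodule.span K (ratC K m '' (TnAlg ℚ m : Set (CPoly ℚ m))) := by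
  have ht' : t ∈ Subalgebra.toSubmodule (TnAlg K m) := ht
  rw [TnAlg_eq_span] at ht'
  refine Submodule.span_mono ?_ ht'
  intro x hx
  induction hx using Submonoid.closure_induction with
  | mem x hx =>
    obtain ⟨w, -, rfl⟩ := hx
    exact ⟨_, trace_wordMat_mem w, ratC_trace_wordMat w⟩
  | one => exact ⟨1, one_mem _, map_one _⟩
  | mul x y _ _ hx hy =>
    obtain ⟨a, ha, rfl⟩ := hx
    obtain ⟨b, hb, rfl⟩ := hy
    exact ⟨a * b, mul_mem ha hb, map_mul _ _ _⟩

theorem span_ratC : Submodule.span K (Set.range (ratC K m)) = ⊤ := by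
  rw [eq_top_iff]
  rintro f -
  induction f using MvPolynomial.induction_on' with
  | add p q hp hq => exact add_mem hp hq
  | monomial e a =>
    have : monomial e a = a • ratC K m (monomial e 1) := by
      simp [ratC, MvPolynomial.map_monomial, smul_monomial]
    rw [this]
    exact Submodule.smul_mem _ _ (Submodule.subset_span ⟨_, rfl⟩)

theorem exists_reynolds (K : Type*) [Field K] [CharZero K] (m : ℕ) :
    ∃ π : CPoly K m →ₗ[K] CPoly K m,
    (∀ c, π c ∈ TnAlg K m) ∧ (∀ t ∈ TnAlg K m, π t = t) ∧
      ∀ t ∈ TnAlg K m, ∀ c, π (t * c) = t * π c := by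
  obtain ⟨p, h1, h2, h3⟩ := exists_reynolds_rat m
  let π : CPoly K m →ₗ[K] CPoly K m :=
    (basisMonomials _ K).constr K fun e => ratC K m (p (monomial e 1))
  have hπ : ∀ f, π (ratC K m f) = ratC K m (p f) := by
    intro f
    induction f using MvPolynomial.induction_on' with
    | add f g hf hg => rw [map_add, map_add, map_add, map_add, hf, hg]
    | monomial e a =>
      have e1 : ratC K m (monomial e a) = algebraMap ℚ K a • basisMonomials _ K e := by
        simp [ratC, MvPolynomial.map_monomial, smul_monomial]
      have e2 : monomial e a = a • (monomial e 1 : CPoly ℚ m) := by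
        rw [smul_monomial, smul_eq_mul, mul_one]
      have e3 : ∀ q : CPoly ℚ m, ratC K m (a • q) = algebraMap ℚ K a • ratC K m q := by
        intro q
        rw [MvPolynomial.smul_eq_C_mul, MvPolynomial.smul_eq_C_mul, map_mul]
        simp [ratC]
      rw [e1, map_smul, Module.Basis.constr_basis, e2, map_smul, e3]
  refine ⟨π, fun c => ?_, fun t ht => ?_, fun t ht c => ?_⟩
  · have hc : c ∈ Submodule.span K (Set.range (ratC K m)) := by rw [span_ratC]; trivial
    induction hc using Submodule.span_induction with
    | mem x hx => obtain ⟨f, rfl⟩ := hx; rw [hπ]; exact ratC_mem_TnAlg (h1 f)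
    | zero => rw [map_zero]; exact zero_mem _
    | add x y _ _ hx hy => rw [map_add]; exact add_mem hx hy
    | smul a x _ hx => rw [map_smul]; exact Subalgebra.smul_mem _ hx _
  · have ht' := TnAlg_le_span_ratC ht
    clear ht
    induction ht' using Submodule.span_induction with
    | mem x hx => obtain ⟨f, hf, rfl⟩ := hx; rw [hπ, h2 f hf]
    | zero => rw [map_zero]
    | add x y _ _ hx hy => rw [map_add, hx, hy]
    | smul a x _ hx => rw [map_smul, hx]
  · have ht' := TnAlg_le_span_ratC ht
    clear ht
    induction ht' using Submodule.span_induction with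
    | mem x hx =>
      obtain ⟨f, hf, rfl⟩ := hx
      have hc : c ∈ Submodule.span K (Set.range (ratC K m)) := by rw [span_ratC]; trivial
      induction hc using Submodule.span_induction with
      | mem x hx =>
        obtain ⟨g, rfl⟩ := hx
        rw [← map_mul, hπ, hπ, h3 f hf, map_mul]
      | zero => rw [mul_zero, map_zero, mul_zero]
      | add x y _ _ hx hy => rw [mul_add, map_add, hx, hy, map_add, mul_add]
      | smul a x _ hx => rw [mul_smul_comm, map_smul, hx, map_smul, mul_smul_comm]
    | zero => rw [zero_mul, map_zero, zero_mul]
    | add x y _ _ hx hy => rw [add_mul, map_add, hx, hy, add_mul]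
    | smul a x _ hx => rw [smul_mul_assoc, map_smul, hx, smul_mul_assoc]

end Retraction

section MatrixRetraction

open Finset MvPolynomial

variable {K : Type*} [Field K] {m : ℕ}

/-- The shift of the generic matrices. -/
noncomputable def shiftC (K : Type*) [Field K] (m : ℕ) : CPoly K m →ₐ[K] CPoly K m :=
  rename fun p => (p.1, p.2.1, p.2.2 + 1)

/-- The left inverse of the shift which kills the first generic matrix. -/
noncomputable def unshiftC (K : Type*) [Field K] (m : ℕ) : CPoly K m →ₐ[K] CPoly K m :=
  aeval fun p => match p.2.2 with
    | 0 => 0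
    | k + 1 => X (p.1, p.2.1, k)

theorem unshiftC_shiftC (c : CPoly K m) : unshiftC K m (shiftC K m c) = c := by
  have : (unshiftC K m).comp (shiftC K m) = AlgHom.id _ _ := by
    apply MvPolynomial.algHom_ext
    intro p
    simp [unshiftC, shiftC]
  exact DFunLike.congr_fun this c

theorem shiftC_wordMat (w : List ℕ) :
    (shiftC K m).mapMatrix (wordMat K m w) = wordMat K m (w.map Nat.succ) := by
  rw [wordMat, wordMat, map_list_prod, List.map_map, List.map_map]
  congr 1
  refine List.map_congr_left fun k _ => ?_
  ext i j : 1
  simp [genMat, shiftC]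

theorem shiftC_trace_wordMat (w : List ℕ) :
    shiftC K m (wordMat K m w).trace = (wordMat K m (w.map Nat.succ)).trace := by
  rw [← shiftC_wordMat]
  exact AddMonoidHom.map_trace (shiftC K m) _

theorem shiftC_mem_TnAlg {t : CPoly K m} (ht : t ∈ TnAlg K m) : shiftC K m t ∈ TnAlg K m := by
  induction ht using Algebra.adjoin_induction with
  | mem t ht =>
    obtain ⟨w, -, rfl⟩ := ht
    have := trace_wordMat_mem (K := K) (m := m) (w.map Nat.succ)
    rw [← shiftC_trace_wordMat] at this
    exact this
  | algebraMap r => rw [AlgHom.commutes]; exact Subalgebra.algebraMap_mem _ _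
  | add x y _ _ hx hy => rw [map_add]; exact add_mem hx hy
  | mul x y _ _ hx hy => rw [map_mul]; exact mul_mem hx hy

theorem unshiftC_wordMat_mem (w : List ℕ) :
    (unshiftC K m).mapMatrix (wordMat K m w) ∈ wordSpan K m := by
  induction w with
  | nil =>
    rw [wordMat, List.map_nil, List.prod_nil, map_one]
    exact one_mem_wordSpan
  | cons k w ih =>
    have hw : wordMat K m (k :: w) = genMat K m k * wordMat K m w := by simp [wordMat]
    rw [hw, map_mul]
    refine mul_mem_wordSpan ?_ ih
    cases k with
    | zero =>
      convert zero_mem (wordSpan K m) using 1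
      ext i j : 1
      simp [genMat, unshiftC]
    | succ k =>
      convert genMat_mem_wordSpan k using 1
      ext i j : 1
      simp [genMat, unshiftC]

theorem unshiftC_mem_TnAlg {t : CPoly K m} (ht : t ∈ TnAlg K m) :
    unshiftC K m t ∈ TnAlg K m := by
  induction ht using Algebra.adjoin_induction with
  | mem t ht =>
    obtain ⟨w, -, rfl⟩ := ht
    have h := trace_mem_of_mem_wordSpan (unshiftC_wordMat_mem (K := K) (m := m) w)
    have h' : unshiftC K m (wordMat K m w).trace =
        ((unshiftC K m).mapMatrix (wordMat K m w)).trace :=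
      AddMonoidHom.map_trace (unshiftC K m) _
    rw [← h'] at h
    exact h
  | algebraMap r => rw [AlgHom.commutes]; exact Subalgebra.algebraMap_mem _ _
  | add x y _ _ hx hy => rw [map_add]; exact add_mem hx hy
  | mul x y _ _ hx hy => rw [map_mul]; exact mul_mem hx hy

theorem unshiftC_smul (c : CPoly K m) (G : Matrix (Fin m) (Fin m) (CPoly K m)) :
    (unshiftC K m).mapMatrix (c • G) = unshiftC K m c • (unshiftC K m).mapMatrix G := by
  ext i j : 1
  simp

theorem shiftC_smul (c : CPoly K m) (G : Matrix (Fin m) (Fin m) (CPoly K m)) :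
    (shiftC K m).mapMatrix (c • G) = shiftC K m c • (shiftC K m).mapMatrix G := by
  ext i j : 1
  simp

theorem unshiftC_mem_wordSpan {G : Matrix (Fin m) (Fin m) (CPoly K m)}
    (hG : G ∈ wordSpan K m) : (unshiftC K m).mapMatrix G ∈ wordSpan K m := by
  induction hG using Submodule.span_induction with
  | mem x hx => obtain ⟨w, rfl⟩ := hx; exact unshiftC_wordMat_mem w
  | zero => rw [map_zero]; exact zero_mem _
  | add x y _ _ hx hy => rw [map_add]; exact add_mem hx hy
  | smul c x _ hx =>
    have : c • x = (c : CPoly K m) • x := rfl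
    rw [this, unshiftC_smul]
    exact smul_mem_wordSpan (unshiftC_mem_TnAlg c.2) hx

theorem pderiv_shiftC (i j : Fin m) (c : CPoly K m) : pderiv (i, j, 0) (shiftC K m c) = 0 := by
  induction c using MvPolynomial.induction_on with
  | C a => simp [shiftC]
  | add p q hp hq => rw [map_add, map_add, hp, hq, add_zero]
  | mul_X p v hp =>
    rw [map_mul, Derivation.leibniz, hp, shiftC, rename_X, pderiv_X, Pi.single_eq_of_ne]
    · simp
    · simp

theorem nablaMat_shiftC_mul (t u : CPoly K m) :
    nablaMat 0 (shiftC K m t * u) = shiftC K m t • nablaMat 0 u := by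
  ext i j : 1
  simp [nablaMat, pderiv_shiftC]

theorem nablaMat_trace_shiftC_mul (G : Matrix (Fin m) (Fin m) (CPoly K m)) :
    nablaMat 0 ((shiftC K m).mapMatrix G * genMat K m 0).trace = (shiftC K m).mapMatrix G := by
  ext c b : 1
  simp only [nablaMat, Matrix.of_apply, Matrix.trace, Matrix.diag, Matrix.mul_apply, map_sum,
    AlgHom.mapMatrix_apply, Matrix.map_apply, Derivation.leibniz, pderiv_shiftC, genMat, pderiv_X,
    smul_eq_mul, Pi.single_apply, Prod.mk.injEq, and_true]
  rw [Finset.sum_eq_single c, Finset.sum_eq_single b]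
  · simp
  · intro e _ he; simp [he]
  · simp
  · intro e _ he; simp [he]
  · simp

theorem nablaMat_add (k : ℕ) (s t : CPoly K m) :
    nablaMat k (s + t) = nablaMat k s + nablaMat k t := by
  ext c b : 1
  simp [nablaMat]

theorem exists_matrix_retraction (K : Type*) [Field K] [CharZero K] (m : ℕ) :
    ∃ r : Matrix (Fin m) (Fin m) (CPoly K m) →ₗ[TnAlg K m] Matrix (Fin m) (Fin m) (CPoly K m),
      (∀ G, r G ∈ wordSpan K m) ∧ ∀ w, r (wordMat K m w) = wordMat K m w := by
  obtain ⟨π, h1, h2, h3⟩ := exists_reynolds K m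
  refine ⟨{ toFun := fun G => (unshiftC K m).mapMatrix
              (nablaMat 0 (π ((shiftC K m).mapMatrix G * genMat K m 0).trace))
            map_add' := fun G H => ?_
            map_smul' := fun t G => ?_ }, fun G => ?_, fun w => ?_⟩
  · rw [map_add, add_mul, Matrix.trace_add, map_add, nablaMat_add, map_add]
  · have ht : t • G = (t : CPoly K m) • G := rfl
    rw [ht, shiftC_smul, smul_mul_assoc, Matrix.trace_smul, smul_eq_mul,
      h3 _ (shiftC_mem_TnAlg t.2), nablaMat_shiftC_mul, unshiftC_smul, unshiftC_shiftC]
    rfl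
  · exact unshiftC_mem_wordSpan (nablaMat_mem 0 (h1 _))
  · change (unshiftC K m).mapMatrix
      (nablaMat 0 (π ((shiftC K m).mapMatrix (wordMat K m w) * genMat K m 0).trace)) = _
    have hm : ((shiftC K m).mapMatrix (wordMat K m w) * genMat K m 0).trace ∈ TnAlg K m := by
      rw [shiftC_wordMat]
      exact trace_mem_of_mem_wordSpan (mul_mem_wordSpan (wordMat_mem_wordSpan _)
        (genMat_mem_wordSpan 0))
    rw [h2 _ hm, nablaMat_trace_shiftC_mul]
    ext i j : 1
    simp [unshiftC_shiftC]

end MatrixRetraction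

section SecondFundamental

open Finset Equiv

theorem viaEmbeddingHom_lt {d k : ℕ} (σ : Perm (Fin d)) (e : Fin k ↪ Fin d) (he : StrictMono e)
    (hd : StrictAnti (σ ∘ e)) (ρ : Perm (Fin k)) (hρ : ρ ≠ 1) :
    toLex (⇑(σ * Perm.viaEmbeddingHom e ρ)) < toLex ⇑σ := by
  have hex : (univ.filter fun i => ρ i ≠ i).Nonempty := by
    by_contra h
    rw [not_nonempty_iff_eq_empty, filter_eq_empty_iff] at h
    exact hρ (Equiv.ext fun i => by simpa using h (mem_univ i))
  set i := (univ.filter fun i => ρ i ≠ i).min' hex with hi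
  have him : ρ i ≠ i := (mem_filter.1 (min'_mem _ hex)).2
  have hlt : ∀ j < i, ρ j = j := by
    intro j hj
    by_contra h
    exact absurd (min'_le _ j (mem_filter.2 ⟨mem_univ _, h⟩)) (not_le.2 hj)
  have hgt : i < ρ i := by
    refine lt_of_le_of_ne (not_lt.1 fun h => him ?_) (Ne.symm him)
    exact ρ.injective (hlt _ h)
  refine ⟨e i, fun j hj => ?_, ?_⟩
  · show σ (Perm.viaEmbedding ρ e j) = σ j
    congr 1
    by_cases hr : j ∈ Set.range e
    · obtain ⟨j, rfl⟩ := hr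
      rw [Perm.viaEmbedding_apply, hlt j (he.lt_iff_lt.1 hj)]
    · rw [Perm.viaEmbedding_apply_of_notMem _ _ _ hr]
  · show σ (Perm.viaEmbedding ρ e (e i)) < σ (e i)
    rw [Perm.viaEmbedding_apply]
    exact hd hgt

/-- A relation without long chains has a strictly monotone colouring. -/
theorem exists_coloring {α : Type*} (r : α → α → Prop) [IsTrans α r] (k : ℕ)
    (h : ¬ ∃ e : Fin (k + 1) → α, ∀ a b, a < b → r (e a) (e b)) :
    ∃ c : α → Fin k, ∀ i j, r i j → c i < c j := by
  classical
  let P : α → ℕ → Prop := fun i l => ∃ e : Fin (l + 1) → α, (∀ a b, a < b → r (e a) (e b)) ∧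
    e (Fin.last l) = i
  have h0 : ∀ i, P i 0 := fun i => ⟨fun _ => i, fun a b hab => by omega, rfl⟩
  have hk : ∀ i, ¬ P i k := fun i ⟨e, he, _⟩ => h ⟨e, he⟩
  have hlt : ∀ i, Nat.findGreatest (P i) k < k := by
    intro i
    refine lt_of_le_of_ne (Nat.findGreatest_le k) fun heq => hk i ?_
    have := Nat.findGreatest_spec (P := P i) (Nat.zero_le k) (h0 i)
    rwa [heq] at this
  refine ⟨fun i => ⟨_, hlt i⟩, fun i j hij => ?_⟩
  show Nat.findGreatest (P i) k < Nat.findGreatest (P j) k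
  refine Nat.lt_of_succ_le (Nat.le_findGreatest (hlt i) ?_)
  obtain ⟨e, he, hl⟩ := Nat.findGreatest_spec (P := P i) (Nat.zero_le k) (h0 i)
  refine ⟨Fin.snoc (α := fun _ => α) e j, fun a b hab => ?_, by simp⟩
  induction b using Fin.lastCases with
  | last =>
    obtain ⟨a, rfl⟩ := Fin.exists_castSucc_eq.2 hab.ne
    rw [Fin.snoc_castSucc, Fin.snoc_last]
    rcases (Fin.le_last a).eq_or_lt with rfl | ha
    · rwa [hl]
    · have h1 := he _ _ ha
      rw [hl] at h1
      exact _root_.trans h1 hij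
  | cast b =>
    obtain ⟨a, rfl⟩ := Fin.exists_castSucc_eq.2 (hab.trans (Fin.castSucc_lt_last b)).ne
    rw [Fin.snoc_castSucc, Fin.snoc_castSucc]
    exact he _ _ (Fin.castSucc_lt_castSucc_iff.1 hab)

theorem lt_of_coloring {d : ℕ} {α : Type*} (σ τ : Perm (Fin d)) (c : Fin d → α)
    (hc : ∀ i j, i < j → c i = c j → σ i < σ j) (hτ : (c ∘ σ.symm) ∘ τ = c) (hne : τ ≠ σ) :
    toLex ⇑σ < toLex ⇑τ := by
  have hex : (univ.filter fun i => τ i ≠ σ i).Nonempty := by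
    by_contra h
    rw [not_nonempty_iff_eq_empty, filter_eq_empty_iff] at h
    exact hne (Equiv.ext fun i => by simpa using h (mem_univ i))
  set i := (univ.filter fun i => τ i ≠ σ i).min' hex with hi
  have him : τ i ≠ σ i := (mem_filter.1 (min'_mem _ hex)).2
  have hlt : ∀ j < i, τ j = σ j := by
    intro j hj
    by_contra h
    exact absurd (min'_le _ j (mem_filter.2 ⟨mem_univ _, h⟩)) (not_le.2 hj)
  refine ⟨i, fun j hj => (hlt j hj).symm, ?_⟩
  show σ i < τ i
  have h1 : i < σ.symm (τ i) := by
    refine lt_of_le_of_ne (not_lt.1 fun h => ?_) fun h => him ?_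
    · have := hlt _ h
      rw [σ.apply_symm_apply] at this
      rw [τ.injective this] at h
      exact lt_irrefl _ h
    · conv_rhs => rw [h, σ.apply_symm_apply]
  have := hc _ _ h1 (congrFun hτ i).symm
  rwa [σ.apply_symm_apply] at this

theorem sum_sign_ite_eq_zero {K : Type*} [Field K] [CharZero K] {δ : Type*} [DecidableEq δ] {m : ℕ}
    (σ : Perm δ) (e : Fin (m + 1) ↪ δ) (I J : δ → Fin m) 
    [∀ σ : Perm δ, Decidable (I ∘ ⇑σ = J)] :
    ∑ ρ : Perm (Fin (m + 1)), (if I ∘ ⇑(σ * Perm.viaEmbeddingHom e ρ) = J then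
      ((Perm.sign ρ : ℤ) : K) else 0) = 0 := by
  obtain ⟨s, t, hst, heq⟩ := Fintype.exists_ne_map_eq_of_card_lt (I ∘ σ ∘ e) (by simp)
  have key : ∀ ρ, I ∘ ⇑(σ * Perm.viaEmbeddingHom e (swap s t * ρ)) =
      I ∘ ⇑(σ * Perm.viaEmbeddingHom e ρ) := by
    intro ρ
    have h1 : I ∘ ⇑(σ * Perm.viaEmbeddingHom e (swap s t)) = I ∘ ⇑σ := by
      funext x
      show I (σ (Perm.viaEmbedding (swap s t) e x)) = I (σ x)
      by_cases hr : x ∈ Set.range e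
      · obtain ⟨j, rfl⟩ := hr
        rw [Perm.viaEmbedding_apply]
        rcases eq_or_ne j s with rfl | hs
        · rw [swap_apply_left]; exact heq.symm
        rcases eq_or_ne j t with rfl | ht
        · rw [swap_apply_right]; exact heq
        · rw [swap_apply_of_ne_of_ne hs ht]
      · rw [Perm.viaEmbedding_apply_of_notMem _ _ _ hr]
    rw [map_mul, ← mul_assoc]
    exact congrArg (· ∘ ⇑(Perm.viaEmbeddingHom e ρ)) h1
  set S := ∑ ρ : Perm (Fin (m + 1)), (if I ∘ ⇑(σ * Perm.viaEmbeddingHom e ρ) = J then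
      ((Perm.sign ρ : ℤ) : K) else 0) with hS
  have h2 : S = -S := by
    conv_lhs => rw [hS, ← Equiv.sum_comp (Equiv.mulLeft (swap s t))]
    rw [hS, ← sum_neg_distrib]
    refine sum_congr rfl fun ρ _ => ?_
    simp only [Equiv.coe_mulLeft, key, Perm.sign_mul, Perm.sign_swap hst]
    split_ifs <;> simp
  exact self_eq_neg.1 h2

/-- The span of all antisymmetrizers over `m + 1` positions. -/
def antisymSpan (K : Type*) [Field K] (d m : ℕ) : Submodule K (Perm (Fin d) → K) :=
  Submodule.span K {x | ∃ (σ : Perm (Fin d)) (e : Fin (m + 1) ↪ Fin d),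
    x = ∑ ρ : Perm (Fin (m + 1)),
      ((Perm.sign ρ : ℤ) : K) • Pi.single (σ * Perm.viaEmbeddingHom e ρ) 1}

theorem sum_smul_eq_zero_of_mem_antisymSpan {K : Type*} [Field K] {N : Type*} [AddCommGroup N]
    [Module K N] {m d : ℕ} (f : Perm (Fin d) → N)
    (hf : ∀ (σ : Perm (Fin d)) (e : Fin (m + 1) ↪ Fin d),
      ∑ ρ : Perm (Fin (m + 1)), ((Perm.sign ρ : ℤ) : K) • f (σ * Perm.viaEmbeddingHom e ρ) = 0)
    {x : Perm (Fin d) → K} (hx : x ∈ antisymSpan K d m) : ∑ σ, x σ • f σ = 0 := by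
  induction hx using Submodule.span_induction with
  | mem x hx =>
    obtain ⟨σ, e, rfl⟩ := hx
    rw [← hf σ e]
    simp only [Finset.sum_apply, Pi.smul_apply, Pi.single_apply, sum_smul]
    rw [sum_comm]
    refine sum_congr rfl fun ρ _ => ?_
    simp
  | zero => simp
  | add x y _ _ hx hy => simp only [Pi.add_apply, add_smul, sum_add_distrib, hx, hy, add_zero]
  | smul c x _ hx => simp only [Pi.smul_apply, smul_assoc, ← smul_sum, hx, smul_zero]

/-- The second fundamental theorem, in the form of a statement about the group algebra of the
symmetric group. -/
theorem sum_smul_eq_zero_of_kernel {K : Type*} [Field K] [CharZero K] {N : Type*} [AddCommGroup N]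
    [Module K N] {m d : ℕ} (a : Perm (Fin d) → K) (f : Perm (Fin d) → N)
    (ha : ∀ I J : Fin d → Fin m, ∑ σ : Perm (Fin d), (if I ∘ ⇑σ = J then a σ else 0) = 0)
    (hf : ∀ (σ : Perm (Fin d)) (e : Fin (m + 1) ↪ Fin d),
      ∑ ρ : Perm (Fin (m + 1)), ((Perm.sign ρ : ℤ) : K) • f (σ * Perm.viaEmbeddingHom e ρ) = 0) :
    ∑ σ, a σ • f σ = 0 := by
  classical
  let good : Perm (Fin d) → Prop := fun σ =>
    ¬ ∃ e : Fin (m + 1) → Fin d, ∀ a b, a < b → e a < e b ∧ σ (e b) < σ (e a)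
  let G : Submodule K (Perm (Fin d) → K) :=
    { carrier := {x | ∀ σ, ¬ good σ → x σ = 0}
      add_mem' := fun hx hy σ h => by simp [hx σ h, hy σ h]
      zero_mem' := fun σ _ => rfl
      smul_mem' := fun c x hx σ h => by simp [hx σ h] }
  have hsingle : ∀ σ : Perm (Fin d),
      (Pi.single σ 1 : Perm (Fin d) → K) ∈ antisymSpan K d m ⊔ G := by
    have wf : WellFounded (fun σ τ : Perm (Fin d) => toLex ⇑σ < toLex ⇑τ) :=
      InvImage.wf (fun σ : Perm (Fin d) => toLex ⇑σ) wellFounded_lt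
    intro σ
    induction σ using wf.induction with
    | _ σ ih =>
      by_cases hg : good σ
      · refine Submodule.mem_sup_right fun τ hτ => Pi.single_eq_of_ne ?_ _
        rintro rfl
        exact hτ hg
      · obtain ⟨e, he⟩ := not_not.1 hg
        have hm : StrictMono e := fun a b hab => (he a b hab).1
        let e' : Fin (m + 1) ↪ Fin d := ⟨e, hm.injective⟩
        have hx : (∑ ρ : Perm (Fin (m + 1)), ((Perm.sign ρ : ℤ) : K) •
            (Pi.single (σ * Perm.viaEmbeddingHom e' ρ) 1 : Perm (Fin d) → K)) ∈
            antisymSpan K d m := Submodule.subset_span ⟨σ, e', rfl⟩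
        rw [← add_sum_erase _ _ (mem_univ (1 : Perm (Fin (m + 1))))] at hx
        have hy : (∑ ρ ∈ univ.erase (1 : Perm (Fin (m + 1))), ((Perm.sign ρ : ℤ) : K) •
            (Pi.single (σ * Perm.viaEmbeddingHom e' ρ) 1 : Perm (Fin d) → K)) ∈
            antisymSpan K d m ⊔ G :=
          Submodule.sum_mem _ fun ρ hρ => Submodule.smul_mem _ _ (ih _
            (viaEmbeddingHom_lt σ e' hm (fun a b hab => (he a b hab).2) ρ (ne_of_mem_erase hρ)))
        have := Submodule.sub_mem _ (Submodule.mem_sup_left (T := G) hx) hy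
        simpa using this
  have htop : a ∈ antisymSpan K d m ⊔ G := by
    have : a = ∑ σ, a σ • (Pi.single σ 1 : Perm (Fin d) → K) := by
      funext τ
      simp [Finset.sum_apply, Pi.single_apply]
    rw [this]
    exact Submodule.sum_mem _ fun σ _ => Submodule.smul_mem _ _ (hsingle σ)
  obtain ⟨x, hx, g, hg, rfl⟩ := Submodule.mem_sup.1 htop
  have hga : ∀ I J : Fin d → Fin m,
      ∑ σ : Perm (Fin d), (if I ∘ ⇑σ = J then g σ else 0) = 0 := by
    intro I J
    have h1 := sum_smul_eq_zero_of_mem_antisymSpan (m := m)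
      (fun σ : Perm (Fin d) => if I ∘ ⇑σ = J then (1 : K) else 0) (fun σ e => by
        simpa only [smul_eq_mul, mul_ite, mul_one, mul_zero] using
          sum_sign_ite_eq_zero (K := K) σ e I J) hx
    have h2 := ha I J
    simp only [Pi.add_apply, smul_eq_mul, mul_ite, mul_one, mul_zero] at h1 h2
    have h3 : (∑ σ : Perm (Fin d), if I ∘ ⇑σ = J then x σ + g σ else 0) =
        (∑ σ : Perm (Fin d), if I ∘ ⇑σ = J then x σ else 0) +
          ∑ σ : Perm (Fin d), if I ∘ ⇑σ = J then g σ else 0 := by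
      rw [← sum_add_distrib]
      refine sum_congr rfl fun σ _ => ?_
      split_ifs
      · rfl
      · exact (add_zero _).symm
    rwa [h3, h1, zero_add] at h2
  have hg0 : g = 0 := by
    by_contra hne
    have hex : (univ.filter fun σ => g σ ≠ 0).Nonempty := by
      by_contra h
      rw [not_nonempty_iff_eq_empty, filter_eq_empty_iff] at h
      exact hne (funext fun σ => by simpa using h (mem_univ σ))
    obtain ⟨σ, hσ, hmax⟩ := exists_max_image _ (fun σ : Perm (Fin d) => toLex ⇑σ) hex
    have hσ0 : g σ ≠ 0 := (mem_filter.1 hσ).2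
    have hgood : good σ := not_not.1 fun h => hσ0 (hg σ h)
    let r : Fin d → Fin d → Prop := fun i j => i < j ∧ σ j < σ i
    have : IsTrans (Fin d) r := ⟨fun i j k h h' => ⟨h.1.trans h'.1, h'.2.trans h.2⟩⟩
    obtain ⟨c, hc⟩ := exists_coloring r m hgood
    refine hσ0 ?_
    rw [← hga (c ∘ σ.symm) c, sum_eq_single σ, if_pos]
    · funext i; simp
    · intro τ _ hτ
      by_cases hcτ : (c ∘ σ.symm) ∘ ⇑τ = c
      · rw [if_pos hcτ]
        by_contra hτ0
        refine absurd (hmax τ (mem_filter.2 ⟨mem_univ _, hτ0⟩)) (not_le.2 ?_)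
        refine lt_of_coloring σ τ c (fun i j hij hcij => ?_) hcτ hτ
        refine lt_of_le_of_ne (not_lt.1 fun h => (hc i j ⟨hij, h⟩).ne hcij) fun h => ?_
        exact hij.ne (σ.injective h)
      · rw [if_neg hcτ]
    · simp
  rw [hg0, add_zero]
  exact sum_smul_eq_zero_of_mem_antisymSpan f hf hx

end SecondFundamental

section FormalTraces

open Finset Equiv

theorem sum_single_one_apply {γ A : Type*} [Fintype γ] [DecidableEq A] (p : γ → A) (c : A) :
    (∑ s, Finsupp.single (p s) 1 : A →₀ ℕ) c = Fintype.card {s // p s = c} := by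
  rw [Finsupp.finsetSum_apply, Fintype.card_subtype, card_filter]
  simp [Finsupp.single_apply]

theorem exists_equiv_of_sum_single_eq {γ δ A : Type*} [Fintype γ] [Fintype δ]
    (p : γ → A) (q : δ → A)
    (h : (∑ s, Finsupp.single (p s) 1 : A →₀ ℕ) = ∑ s, Finsupp.single (q s) 1) :
    ∃ e : δ ≃ γ, p ∘ e = q := by
  classical
  have hc : ∀ c, Nonempty ({s // q s = c} ≃ {s // p s = c}) := fun c =>
    ⟨Fintype.equivOfCardEq (by rw [← sum_single_one_apply q, ← sum_single_one_apply p, h])⟩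
  let e := fun c => (hc c).some
  exact ⟨Equiv.ofFiberEquiv e, funext fun s => Equiv.ofFiberEquiv_map e s⟩

variable {K : Type*} [Field K] [CharZero K] {m : ℕ}

open MvPolynomial in
theorem card_mul_coeff_prod_X {A : Type*} [DecidableEq A] {γ : Type*} [Fintype γ] [DecidableEq γ]
    (p q : γ → A) :
    (#{τ : Perm γ | q ∘ ⇑τ = q} : K) *
        (∏ s, X (p s) : MvPolynomial A K).coeff (∑ s, Finsupp.single (q s) 1) =
      (#{τ : Perm γ | p ∘ ⇑τ = q} : K) := by
  have hprod : (∏ s, X (p s) : MvPolynomial A K) = monomial (∑ s, Finsupp.single (p s) 1) 1 := by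
    rw [monomial_sum_one]
    rfl
  rw [hprod, coeff_monomial]
  split_ifs with h
  · obtain ⟨τ₀, h₀⟩ := exists_equiv_of_sum_single_eq p q h
    rw [mul_one]
    congr 1
    refine card_bij (fun τ _ => τ₀ * τ) (fun τ hτ => ?_) (fun τ _ τ' _ h => mul_left_cancel h)
      fun τ hτ => ⟨τ₀⁻¹ * τ, ?_, mul_inv_cancel_left _ _⟩
    · rw [mem_filter] at hτ ⊢
      refine ⟨mem_univ _, ?_⟩
      rw [Perm.coe_mul, ← Function.comp_assoc, h₀, hτ.2]
    · rw [mem_filter] at hτ ⊢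
      refine ⟨mem_univ _, ?_⟩
      conv_lhs => rw [← h₀]
      rw [Function.comp_assoc, ← Perm.coe_mul, mul_inv_cancel_left, hτ.2]
  · rw [mul_zero, eq_comm, Nat.cast_eq_zero, card_eq_zero, filter_eq_empty_iff]
    rintro τ - rfl
    exact h (Equiv.sum_comp τ (fun s => Finsupp.single (p s) 1)).symm

theorem card_mul_coeff_ptr {d : ℕ} (κ : Fin d → ℕ) (I J : Fin d → Fin m) (σ : Perm (Fin d)) :
    (#{τ : Perm (Fin d) | (fun s => (I s, J s, κ s)) ∘ ⇑τ = fun s => (I s, J s, κ s)} : K) *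
      (ptr σ (genMat K m ∘ κ)).coeff (∑ s, Finsupp.single (I s, J s, κ s) 1) =
    ∑ τ ∈ univ.filter fun τ : Perm (Fin d) => κ ∘ ⇑τ = κ, if I ∘ ⇑(τ⁻¹ * σ * τ) = J then 1 else 0 := by
  have h1 : ptr σ (genMat K m ∘ κ) =
      ∑ L : Fin d → Fin m, ∏ s, MvPolynomial.X (L s, L (σ s), κ s) := rfl
  rw [h1, MvPolynomial.coeff_sum, mul_sum]
  simp_rw [card_mul_coeff_prod_X (K := K), card_filter, Nat.cast_sum]
  rw [sum_comm, sum_filter]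
  refine sum_congr rfl fun τ _ => ?_
  rw [sum_eq_single (I ∘ ⇑τ⁻¹)]
  · have h2 : ((fun s => ((I ∘ ⇑τ⁻¹) s, (I ∘ ⇑τ⁻¹) (σ s), κ s)) ∘ ⇑τ = fun s => (I s, J s, κ s)) ↔
        (κ ∘ ⇑τ = κ ∧ I ∘ ⇑(τ⁻¹ * σ * τ) = J) := by
      simp only [funext_iff, Function.comp_apply, Prod.mk.injEq, Perm.inv_def, symm_apply_apply,
        true_and, Perm.mul_apply]
      exact ⟨fun h => ⟨fun s => (h s).2, fun s => (h s).1⟩, fun h s => ⟨h.2 s, h.1 s⟩⟩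
    simp only [h2, ite_and]
    split_ifs <;> simp
  · intro L _ hL
    rw [if_neg, Nat.cast_zero]
    intro h
    refine hL (funext fun s => ?_)
    have := congrArg Prod.fst (congrFun h (τ⁻¹ s))
    simpa using this
  · simp

/-- The second fundamental theorem for a fixed assignment of generic matrices. -/
theorem sum_smul_eq_zero_of_sum_ptr {N : Type*} [AddCommGroup N] [Module K N] {d : ℕ}
    (κ : Fin d → ℕ) (a : Perm (Fin d) → K) (f : Perm (Fin d) → N)
    (ha : ∑ σ, a σ • ptr σ (genMat K m ∘ κ) = 0)
    (hnat : ∀ τ σ : Perm (Fin d), κ ∘ ⇑τ = κ → f (τ⁻¹ * σ * τ) = f σ)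
    (hf : ∀ (σ : Perm (Fin d)) (e : Fin (m + 1) ↪ Fin d),
      ∑ ρ : Perm (Fin (m + 1)), ((Perm.sign ρ : ℤ) : K) • f (σ * Perm.viaEmbeddingHom e ρ) = 0) :
    ∑ σ, a σ • f σ = 0 := by
  have key := sum_smul_eq_zero_of_kernel
    (fun σ => ∑ τ ∈ univ.filter fun τ : Perm (Fin d) => κ ∘ ⇑τ = κ, a (τ * σ * τ⁻¹)) f (fun I J => ?_) hf
  · have h1 : (#{τ : Perm (Fin d) | κ ∘ ⇑τ = κ} : K) • ∑ σ, a σ • f σ = 0 := by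
      rw [← key]
      simp_rw [sum_smul]
      rw [sum_comm, Nat.cast_smul_eq_nsmul, ← sum_const]
      refine sum_congr rfl fun τ hτ => ?_
      rw [← Equiv.sum_comp (MulAut.conj τ).toEquiv (fun σ => a σ • f σ)]
      refine sum_congr rfl fun σ _ => ?_
      have h2 : (MulAut.conj τ).toEquiv σ = τ * σ * τ⁻¹ := rfl
      rw [h2, ← hnat τ (τ * σ * τ⁻¹) (mem_filter.1 hτ).2]
      congr 2
      group
    refine (smul_eq_zero.1 h1).resolve_left ?_
    rw [Nat.cast_eq_zero, ← Ne, Finset.card_ne_zero]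
    exact ⟨1, by simp⟩
  · have h0 := congrArg (fun c : CPoly K m =>
      (#{τ : Perm (Fin d) | (fun s => (I s, J s, κ s)) ∘ ⇑τ = fun s => (I s, J s, κ s)} : K) *
        c.coeff (∑ s, Finsupp.single (I s, J s, κ s) 1)) ha
    simp only [MvPolynomial.coeff_sum, MvPolynomial.coeff_smul, smul_eq_mul, mul_sum,
      MvPolynomial.coeff_zero, mul_zero] at h0
    refine Eq.trans ?_ h0
    simp_rw [mul_left_comm _ (a _), card_mul_coeff_ptr, mul_sum]
    rw [sum_comm]
    have h1 : ∀ σ : Perm (Fin d), (if I ∘ ⇑σ = J then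
        ∑ τ ∈ univ.filter fun τ : Perm (Fin d) => κ ∘ ⇑τ = κ, a (τ * σ * τ⁻¹) else 0) =
        ∑ τ ∈ univ.filter fun τ : Perm (Fin d) => κ ∘ ⇑τ = κ, (if I ∘ ⇑σ = J then a (τ * σ * τ⁻¹) else 0) := by
      intro σ
      split_ifs <;> simp
    simp_rw [h1]
    rw [sum_comm]
    refine sum_congr rfl fun τ hτ => ?_
    conv_rhs => rw [← Equiv.sum_comp (MulAut.conj τ).toEquiv]
    refine sum_congr rfl fun σ _ => ?_
    have h2 : (MulAut.conj τ).toEquiv σ = τ * σ * τ⁻¹ := rfl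
    have h3 : τ⁻¹ * (τ * σ * τ⁻¹) * τ = σ := by group
    rw [h2, h3, mul_ite, mul_one, mul_zero]

/-- Formal products of traces of words. -/
abbrev TrTerm := Σ d : ℕ, (Fin d → ℕ) × Perm (Fin d)

/-- The multidegree of a formal product of traces. -/
noncomputable def TrTerm.weight (t : TrTerm) : ℕ →₀ ℕ := ∑ s, Finsupp.single (t.2.1 s) 1

/-- Evaluation of a formal product of traces. -/
def TrTerm.eval {β B : Type*} [Fintype β] [CommRing B] (H : ℕ → Matrix β β B) (t : TrTerm) : B :=
  ptr t.2.2 (H ∘ t.2.1)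

omit [CharZero K] in
theorem isWeightedHomogeneous_eval (t : TrTerm) :
    MvPolynomial.IsWeightedHomogeneous (matWeight m) (t.eval (genMat K m)) t.weight := by
  refine MvPolynomial.IsWeightedHomogeneous.sum _ _ _ fun I _ => ?_
  refine MvPolynomial.IsWeightedHomogeneous.prod _ _ _ fun s _ => ?_
  exact MvPolynomial.isWeightedHomogeneous_X K (matWeight m) _

theorem sum_filter_smul_fiber {ι ω α R N : Type*} [Semiring R] [AddCommMonoid N] [Module R N]
    [Fintype α] [DecidableEq α] [DecidableEq ω] (x : ι →₀ R) {F : ι → N} (F' : α → N) {g : ι → α}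
    {wt : ι → ω} {w : ω} (h : ∀ t, wt t = w → F t = F' (g t)) :
    ∑ t ∈ x.support with wt t = w, x t • F t =
      ∑ σ, (∑ t ∈ x.support with wt t = w ∧ g t = σ, x t) • F' σ := by
  rw [← sum_fiberwise _ g]
  refine sum_congr rfl fun σ _ => ?_
  rw [filter_filter, sum_smul]
  refine sum_congr rfl fun t ht => ?_
  obtain ⟨-, hw, rfl⟩ := mem_filter.1 ht
  rw [h t hw]

/-- The second fundamental theorem for formal linear combinations of products of traces. -/
theorem sum_smul_eq_zero_of_eval_eq_zero {N : Type*} [AddCommGroup N] [Module K N]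
    (x : TrTerm →₀ K) (f : TrTerm → N) (hx : (x.sum fun t c => c • t.eval (genMat K m)) = 0)
    (hnat : ∀ (d d' : ℕ) (e : Fin d ≃ Fin d') (κ : Fin d' → ℕ) (σ : Perm (Fin d')),
      f ⟨d, κ ∘ e, e.symm.permCongr σ⟩ = f ⟨d', κ, σ⟩)
    (hf : ∀ (d : ℕ) (κ : Fin d → ℕ) (σ : Perm (Fin d)) (e : Fin (m + 1) ↪ Fin d),
      ∑ ρ : Perm (Fin (m + 1)),
        ((Perm.sign ρ : ℤ) : K) • f ⟨d, κ, σ * Perm.viaEmbeddingHom e ρ⟩ = 0) :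
    (x.sum fun t c => c • f t) = 0 := by
  classical
  have hw : ∀ w : ℕ →₀ ℕ, ∑ t ∈ x.support with t.weight = w, x t • f t = 0 := by
    intro w
    have hxw : ∑ t ∈ x.support with t.weight = w, x t • t.eval (genMat K m) = 0 := by
      have h := congrArg (MvPolynomial.weightedHomogeneousComponent (matWeight m) w) hx
      rw [map_zero, Finsupp.sum, map_sum] at h
      rw [sum_filter]
      refine Eq.trans ?_ h
      refine sum_congr rfl fun t _ => ?_
      rw [map_smul]
      split_ifs with ht
      · rw [MvPolynomial.IsWeightedHomogeneous.weightedHomogeneousComponent_same]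
        exact ht ▸ isWeightedHomogeneous_eval t
      · rw [MvPolynomial.IsWeightedHomogeneous.weightedHomogeneousComponent_ne _
          (isWeightedHomogeneous_eval t) (Ne.symm ht), smul_zero]
    rcases (x.support.filter fun t => t.weight = w).eq_empty_or_nonempty with he | ⟨⟨d, κ, σ₀⟩, h₀⟩
    · rw [he, sum_empty]
    have hg : ∀ t : TrTerm, ∃ σ : Perm (Fin d), t.weight = w →
        f t = f ⟨d, κ, σ⟩ ∧ t.eval (genMat K m) = ptr σ (genMat K m ∘ κ) := by
      rintro ⟨d', κ', σ'⟩
      by_cases ht : TrTerm.weight ⟨d', κ', σ'⟩ = w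
      · obtain ⟨e, he⟩ := exists_equiv_of_sum_single_eq κ' κ (ht.trans (mem_filter.1 h₀).2.symm)
        refine ⟨e.symm.permCongr σ', fun _ => ⟨?_, ?_⟩⟩
        · rw [← he, hnat]
        · rw [ptr_permCongr, ← he, Function.comp_assoc, Function.comp_assoc, Equiv.self_comp_symm]
          rfl
      · exact ⟨1, fun h => absurd h ht⟩
    choose g hg using hg
    rw [sum_filter_smul_fiber x (fun σ => f ⟨d, κ, σ⟩) fun t ht => (hg t ht).1]
    refine sum_smul_eq_zero_of_sum_ptr κ _ (fun σ => f ⟨d, κ, σ⟩) ?_ (fun τ σ hτ => ?_)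
      fun σ e => hf d κ σ e
    · rw [← hxw, sum_filter_smul_fiber x (fun σ => ptr σ (genMat K m ∘ κ)) fun t ht => (hg t ht).2]
    · conv_rhs => rw [← hnat d d τ κ σ, hτ]
      rfl
  rw [Finsupp.sum, ← sum_fiberwise_of_maps_to (g := TrTerm.weight)
    (t := x.support.image TrTerm.weight) fun t ht => mem_image_of_mem _ ht]
  exact sum_eq_zero fun w _ => hw w

end FormalTraces

section Lift

open Finset Equiv

theorem exists_perm_ptr_eq_trace (B : Type*) [CommRing B] (r : ℕ) : ∃ σ : Perm (Fin (r + 1)),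
    ∀ (β : Type) [Fintype β] [DecidableEq β] (H : Fin (r + 1) → Matrix β β B),
      ptr σ H = (List.ofFn H).prod.trace := by
  induction r with
  | zero =>
    refine ⟨1, fun β _ _ H => ?_⟩
    rw [List.ofFn_succ, List.ofFn_zero, List.prod_singleton, ptr, Matrix.trace]
    rw [← (Equiv.funUnique (Fin 1) β).symm.sum_comp]
    simp
  | succ r ih =>
    obtain ⟨σ, hσ⟩ := ih
    refine ⟨(finSuccEquivLast (n := r + 1)).symm.permCongr
      (optionCongr σ * swap none (some (Fin.last r))), fun β _ _ H => ?_⟩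
    rw [ptr_permCongr, ptr_optionCongr_swap, hσ, List.ofFn_succ', List.ofFn_succ' (f := H),
      List.ofFn_succ' (n := r)]
    simp [List.concat_eq_append]

variable {K : Type*} [Field K] {m : ℕ}

/-- A family of matrices whose traces of words not involving `H 0` specialise the generic ones. -/
def TraceCompatible {β : Type} [Fintype β] [DecidableEq β] (H : ℕ → Matrix β β (CPoly K m))
    (ψ : CPoly K m →ₐ[K] CPoly K m) : Prop :=
  ∀ v : List ℕ, v ≠ [] →
    ((v.map fun k => H (k + 1)).prod).trace = ψ (wordMat K m v).trace

theorem exists_term_eval_eq_trace (B : Type*) [CommRing B] (u : List ℕ) (hu : u ≠ []) :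
    ∃ t : TrTerm, t.weight = (u.map fun k => Finsupp.single k 1).sum ∧
      ∀ (β : Type) [Fintype β] [DecidableEq β] (H : ℕ → Matrix β β B),
        t.eval H = (u.map H).prod.trace := by
  obtain ⟨r, hr⟩ := Nat.exists_eq_succ_of_ne_zero (List.length_pos_of_ne_nil hu).ne'
  obtain ⟨σ, hσ⟩ := exists_perm_ptr_eq_trace B r
  obtain ⟨κ, rfl⟩ : ∃ κ : Fin (r + 1) → ℕ, List.ofFn κ = u :=
    ⟨fun i => u.get (i.cast hr.symm), List.ext_get (by simp [hr]) fun i h1 h2 => by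
      simp only [List.get_eq_getElem, List.getElem_ofFn, Fin.val_cast]⟩
  refine ⟨⟨r + 1, κ, σ⟩, ?_, fun β _ _ H => ?_⟩
  · rw [TrTerm.weight, List.map_ofFn, List.sum_ofFn]
    rfl
  · rw [TrTerm.eval, hσ, List.map_ofFn]

theorem exists_term_eval_eq_mul (B : Type*) [CommRing B] (t t' : TrTerm) :
    ∃ t'' : TrTerm, t''.weight = t.weight + t'.weight ∧
      ∀ (β : Type) [Fintype β] [DecidableEq β] (H : ℕ → Matrix β β B),
        t''.eval H = t.eval H * t'.eval H := by
  obtain ⟨d, κ, σ⟩ := t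
  obtain ⟨d', κ', σ'⟩ := t'
  refine ⟨⟨d + d', Sum.elim κ κ' ∘ finSumFinEquiv.symm,
    finSumFinEquiv.permCongr (sumCongr σ σ')⟩, ?_, fun β _ _ H => ?_⟩
  · simp only [TrTerm.weight]
    rw [← Equiv.sum_comp finSumFinEquiv]
    simp [Fintype.sum_sum_type]
  · simp only [TrTerm.eval]
    rw [ptr_permCongr, ptr_add_disjoint]
    congr 2
    · funext i; simp
    · funext i; simp

theorem weight_sum_map_succ (v : List ℕ) :
    ((v.map Nat.succ).map fun k => Finsupp.single k 1 : List (ℕ →₀ ℕ)).sum 0 = 0 := by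
  induction v with
  | nil => simp
  | cons k v ih => simpa using ih

theorem exists_term_of_mem_closure {c : CPoly K m}
    (hc : c ∈ Submonoid.closure {c : CPoly K m | ∃ l : List ℕ, l ≠ [] ∧
      c = Matrix.trace ((l.map (genMat K m)).prod)}) :
    ∃ t : TrTerm, t.weight 0 = 0 ∧
      ∀ (β : Type) [Fintype β] [DecidableEq β] (H : ℕ → Matrix β β (CPoly K m))
        (ψ : CPoly K m →ₐ[K] CPoly K m), TraceCompatible H ψ → t.eval H = ψ c := by
  induction hc using Submonoid.closure_induction with
  | mem c hc =>
    obtain ⟨l, hl, rfl⟩ := hc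
    obtain ⟨t, ht, htr⟩ := exists_term_eval_eq_trace (CPoly K m) (l.map Nat.succ) (by simpa using hl)
    refine ⟨t, by rw [ht, weight_sum_map_succ], fun β _ _ H ψ hH => ?_⟩
    rw [htr, List.map_map]
    exact hH l hl
  | one =>
    refine ⟨⟨0, Fin.elim0, 1⟩, by simp [TrTerm.weight], fun β _ _ H ψ hH => ?_⟩
    simp [TrTerm.eval, ptr]
  | mul c c' _ _ h h' =>
    obtain ⟨t, ht, htr⟩ := h
    obtain ⟨t', ht', htr'⟩ := h'
    obtain ⟨t'', hw, hev⟩ := exists_term_eval_eq_mul (CPoly K m) t t'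
    refine ⟨t'', by simp [hw, ht, ht'], fun β _ _ H ψ hH => ?_⟩
    rw [hev, htr β H ψ hH, htr' β H ψ hH, map_mul]

theorem exists_formal_smul_trace {c : CPoly K m} (hc : c ∈ TnAlg K m) (w : List ℕ) :
    ∃ x ∈ Finsupp.supported K K {t : TrTerm | t.weight 0 = 1},
      ∀ (β : Type) [Fintype β] [DecidableEq β] (H : ℕ → Matrix β β (CPoly K m))
        (ψ : CPoly K m →ₐ[K] CPoly K m), TraceCompatible H ψ →
          Finsupp.linearCombination K (TrTerm.eval H) x =
            ψ c * ((w.map fun k => H (k + 1)).prod * H 0).trace := by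
  replace hc : c ∈ Subalgebra.toSubmodule (TnAlg K m) := hc
  rw [TnAlg_eq_span] at hc
  induction hc using Submodule.span_induction with
  | mem c hc =>
    obtain ⟨t, ht, hev⟩ := exists_term_of_mem_closure hc
    obtain ⟨t', ht', hev'⟩ := exists_term_eval_eq_trace (CPoly K m) (w.map Nat.succ ++ [0]) (by simp)
    obtain ⟨t'', hw, hev''⟩ := exists_term_eval_eq_mul (CPoly K m) t t'
    refine ⟨Finsupp.single t'' 1, Finsupp.single_mem_supported K 1 ?_, fun β _ _ H ψ hH => ?_⟩
    · show t''.weight 0 = 1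
      rw [hw, Finsupp.add_apply, ht, ht', List.map_append, List.sum_append, Finsupp.add_apply,
        weight_sum_map_succ]
      simp
    · rw [Finsupp.linearCombination_single, one_smul, hev'', hev β H ψ hH, hev', List.map_append,
        List.prod_append, List.map_map]
      simp [Function.comp_def]
  | zero => exact ⟨0, Submodule.zero_mem _, fun β _ _ H ψ hH => by simp⟩
  | add c c' _ _ h h' =>
    obtain ⟨x, hx, hev⟩ := h
    obtain ⟨x', hx', hev'⟩ := h'
    refine ⟨x + x', Submodule.add_mem _ hx hx', fun β _ _ H ψ hH => ?_⟩
    rw [map_add, hev β H ψ hH, hev' β H ψ hH, map_add, add_mul]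
  | smul a c _ h =>
    obtain ⟨x, hx, hev⟩ := h
    refine ⟨a • x, Submodule.smul_mem _ _ hx, fun β _ _ H ψ hH => ?_⟩
    rw [map_smul, hev β H ψ hH, map_smul, smul_mul_assoc]

theorem exists_formal (c : List ℕ →₀ TnAlg K m) :
    ∃ x ∈ Finsupp.supported K K {t : TrTerm | t.weight 0 = 1},
      ∀ (β : Type) [Fintype β] [DecidableEq β] (H : ℕ → Matrix β β (CPoly K m))
        (ψ : CPoly K m →ₐ[K] CPoly K m), TraceCompatible H ψ →
          Finsupp.linearCombination K (TrTerm.eval H) x =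
            c.sum fun w t => ψ t * ((w.map fun k => H (k + 1)).prod * H 0).trace := by
  choose x hx hev using fun w : List ℕ => exists_formal_smul_trace (c w).2 w
  refine ⟨∑ w ∈ c.support, x w, Submodule.sum_mem _ fun w _ => hx w, fun β _ _ H ψ hH => ?_⟩
  rw [map_sum, Finsupp.sum]
  exact sum_congr rfl fun w _ => hev w β H ψ hH

end Lift

section Polarization

open Finset Equiv

variable {γ β B : Type*} [Fintype γ] [DecidableEq γ] [Fintype β] [CommRing B]

theorem sum_neg_one_pow_card_ite_surjective (g : γ → γ) :
    ∑ A : Finset γ, (if ∀ j, g j ∉ A then (-1 : B) ^ #A else 0) =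
      if Function.Bijective g then 1 else 0 := by
  have h1 : (univ.filter fun A : Finset γ => ∀ j, g j ∉ A) = (univ.image g)ᶜ.powerset := by
    ext A
    simp only [mem_filter, mem_univ, true_and, mem_powerset]
    refine ⟨fun h i hi => ?_, fun h j hj => ?_⟩
    · rw [mem_compl, mem_image]
      rintro ⟨j, -, rfl⟩
      exact h j hi
    · exact mem_compl.1 (h hj) (mem_image_of_mem _ (mem_univ j))
  have h2 := congrArg (Int.cast : ℤ → B) (sum_powerset_neg_one_pow_card (x := (univ.image g)ᶜ))
  push_cast at h2
  rw [← sum_filter, h1, h2]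
  refine if_congr ?_ rfl rfl
  rw [compl_eq_empty_iff, ← Finite.surjective_iff_bijective, ← coe_inj, coe_image, coe_univ,
    Set.image_univ, Set.range_eq_univ]

/-- Ryser's formula for the permanent. -/
theorem sum_perm_prod_eq (x : γ → γ → B) :
    ∑ π : Perm γ, ∏ j, x (π j) j = ∑ A : Finset γ, (-1) ^ #A * ∏ j, ∑ i ∈ Aᶜ, x i j := by
  have h1 : ∀ A : Finset γ, (-1) ^ #A * ∏ j, ∑ i ∈ Aᶜ, x i j =
      ∑ g : γ → γ, (if ∀ j, g j ∉ A then (-1 : B) ^ #A else 0) * ∏ j, x (g j) j := by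
    intro A
    rw [prod_univ_sum, mul_sum]
    simp_rw [ite_mul, zero_mul]
    rw [← sum_filter]
    refine sum_congr ?_ fun _ _ => rfl
    ext g
    simp
  simp_rw [h1]
  rw [sum_comm]
  simp_rw [← sum_mul, sum_neg_one_pow_card_ite_surjective, ite_mul, one_mul, zero_mul]
  rw [← sum_filter]
  refine sum_bij (fun π _ => ⇑π) (fun π _ => by simp)
    (fun π _ π' _ h => DFunLike.coe_injective h) (fun g hg => ?_) fun _ _ => rfl
  exact ⟨Equiv.ofBijective g (mem_filter.1 hg).2, mem_univ _, rfl⟩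

theorem sum_perm_ptr_option (Z : Matrix β β B) (X : γ → Matrix β β B) (σ : Perm (Option γ)) :
    ∑ π : Perm γ, ptr σ (fun o : Option γ => o.elim Z (X ∘ π)) =
      ∑ A : Finset γ, (-1) ^ #A * ptr σ fun o => o.elim Z fun _ => ∑ i ∈ Aᶜ, X i := by
  unfold ptr
  simp_rw [mul_sum]
  rw [sum_comm, sum_comm (s := univ (α := Finset γ))]
  refine sum_congr rfl fun I _ => ?_
  simp_rw [Fintype.prod_option, Option.elim_none, Option.elim_some, mul_left_comm _ (Z _ _),
    ← mul_sum]
  congr 1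
  simp_rw [Matrix.sum_apply]
  exact sum_perm_prod_eq fun i j => X i (I (some j)) (I (σ (some j)))

theorem factorial_mul_altTr (Z : Matrix β β B) (X : γ → Matrix β β B) :
    ((Fintype.card γ).factorial : B) * altTr (fun o : Option γ => o.elim Z X) =
      ∑ A : Finset γ, (-1) ^ #A * altTr fun o : Option γ => o.elim Z fun _ => ∑ i ∈ Aᶜ, X i := by
  have h1 : ∀ π : Perm γ, altTr (fun o : Option γ => o.elim Z (X ∘ π)) =
      altTr (fun o : Option γ => o.elim Z X) := by
    intro π
    rw [← altTr_reindex (optionCongr π) fun o : Option γ => o.elim Z X]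
    congr 1
    funext o
    cases o <;> rfl
  have h2 : ((Fintype.card γ).factorial : B) * altTr (fun o : Option γ => o.elim Z X) =
      ∑ π : Perm γ, altTr (fun o : Option γ => o.elim Z (X ∘ π)) := by
    simp_rw [h1]
    rw [sum_const, card_univ, Fintype.card_perm, nsmul_eq_mul]
  rw [h2]
  unfold altTr
  rw [sum_comm]
  simp_rw [mul_sum]
  rw [sum_comm (s := univ (α := Finset γ))]
  refine sum_congr rfl fun σ _ => ?_
  simp_rw [mul_smul_comm, ← smul_sum, sum_perm_ptr_option]

/-- The antisymmetrisation of a trace function over more positions than the size vanishes. -/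
theorem sum_sign_smul_ptr_eq_zero {n : ℕ} (e : Fin (n + 1) ↪ γ) (σ : Perm γ)
    (H : γ → Matrix (Fin n) (Fin n) B) :
    ∑ ρ : Perm (Fin (n + 1)), (Perm.sign ρ : ℤ) • ptr (Perm.viaEmbeddingHom e ρ * σ) H = 0 := by
  unfold ptr
  simp_rw [smul_sum]
  rw [sum_comm]
  refine sum_eq_zero fun I _ => ?_
  obtain ⟨s, t, hst, heq⟩ := Fintype.exists_ne_map_eq_of_card_lt (I ∘ e) (by simp)
  have key : ∀ x, I (Perm.viaEmbeddingHom e (swap s t) x) = I x := by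
    intro x
    show I (Perm.viaEmbedding (swap s t) e x) = I x
    by_cases hr : x ∈ Set.range e
    · obtain ⟨j, rfl⟩ := hr
      rw [Perm.viaEmbedding_apply]
      rcases eq_or_ne j s with rfl | hs
      · rw [swap_apply_left]; exact heq.symm
      rcases eq_or_ne j t with rfl | ht
      · rw [swap_apply_right]; exact heq
      · rw [swap_apply_of_ne_of_ne hs ht]
    · rw [Perm.viaEmbedding_apply_of_notMem _ _ _ hr]
  refine sum_involution (fun ρ _ => swap s t * ρ) (fun ρ _ => ?_) (fun ρ _ _ h => ?_)
    (fun _ _ => mem_univ _) fun ρ _ => swap_mul_self_mul s t ρ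
  · simp only [map_mul, Perm.mul_apply, key, Perm.sign_swap hst]
    simp
  · exact hst (swap_eq_one_iff.1 (mul_eq_right.1 h))

end Polarization

section BigRepresentation

open Finset Equiv

variable {K : Type*} [Field K] {m : ℕ}

/-- Words of length at most `D` in the letters `0, …, N - 1`. -/
abbrev BWord (D N : ℕ) : Type := {l : List ℕ // l.length ≤ D ∧ ∀ k ∈ l, k < N}

instance BWord.finite (D N : ℕ) : Finite (BWord D N) := by
  have h := (List.finite_length_le (Fin N) D).image (List.map Fin.val)
  refine (h.subset ?_ : {l : List ℕ | l.length ≤ D ∧ ∀ k ∈ l, k < N}.Finite).to_subtype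
  rintro l ⟨h1, h2⟩
  refine ⟨l.pmap (fun k hk => ⟨k, hk⟩) h2, ?_, ?_⟩
  · simpa using h1
  · simp [List.map_pmap]

noncomputable instance BWord.fintype (D N : ℕ) : Fintype (BWord D N) := Fintype.ofFinite _

/-- The empty word. -/
def BWord.empty (D N : ℕ) : BWord D N := ⟨[], by simp⟩

/-- The matrix of left multiplication by the word `w` on the space spanned by `BWord D N`. -/
noncomputable def regMat (K : Type*) [Field K] (m D N : ℕ) (w : List ℕ) :
    Matrix (BWord D N) (BWord D N) (CPoly K m) :=
  Matrix.of fun a b => if a.1 = w ++ b.1 then 1 else 0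

theorem regMat_mul (D N : ℕ) (v w : List ℕ) :
    regMat K m D N v * regMat K m D N w = regMat K m D N (v ++ w) := by
  ext a b : 1
  simp only [Matrix.mul_apply, regMat, Matrix.of_apply, ite_mul, one_mul, zero_mul]
  by_cases h : a.1 = v ++ w ++ b.1
  · have hc : (w ++ b.1).length ≤ D ∧ ∀ k ∈ w ++ b.1, k < N := by
      have h1 := a.2
      rw [h, List.append_assoc] at h1
      refine ⟨le_trans ?_ h1.1, fun k hk => h1.2 k (List.mem_append_right _ hk)⟩
      rw [List.length_append (as := v)]; omega
    rw [sum_eq_single (⟨w ++ b.1, hc⟩ : BWord D N)]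
    · simp [h]
    · intro c _ hcb
      rw [if_neg (fun h' : c.1 = w ++ b.1 => hcb (Subtype.ext h')), ite_self]
    · simp
  · rw [if_neg h]
    refine sum_eq_zero fun c _ => ?_
    split_ifs with h1 h2
    · exact absurd (by rw [h1, h2, List.append_assoc]) h
    · rfl
    · rfl

theorem regMat_nil (D N : ℕ) : regMat K m D N [] = 1 := by
  ext a b : 1
  simp [regMat, Matrix.one_apply, Subtype.ext_iff]

/-- The matrix of left multiplication by `x_k`, extended by the generic matrix. -/
noncomputable def bigMat (K : Type*) [Field K] (m D N : ℕ) (k : ℕ) :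
    Matrix (Fin m ⊕ BWord D N) (Fin m ⊕ BWord D N) (CPoly K m) :=
  Matrix.fromBlocks (genMat K m k) 0 0 (regMat K m D N [k])

/-- The algebra map sending `x_k` to `bigMat K m D N k`. -/
noncomputable def bigRep (K : Type*) [Field K] (m D N : ℕ) :
    QPoly K m →ₐ[CPoly K m] Matrix (Fin m ⊕ BWord D N) (Fin m ⊕ BWord D N) (CPoly K m) :=
  FreeAlgebra.lift _ (bigMat K m D N)

theorem bigRep_ι (D N k : ℕ) : bigRep K m D N (FreeAlgebra.ι _ k) = bigMat K m D N k := by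
  simp [bigRep]

theorem bigRep_wordQ (D N : ℕ) (w : List ℕ) : bigRep K m D N (wordQ K m w) =
    Matrix.fromBlocks (wordMat K m w) 0 0 (regMat K m D N w) := by
  induction w with
  | nil => simp [wordQ, wordMat, regMat_nil]
  | cons k w ih =>
    have h1 : wordQ K m (k :: w) = FreeAlgebra.ι _ k * wordQ K m w := by simp [wordQ]
    have h2 : wordMat K m (k :: w) = genMat K m k * wordMat K m w := by simp [wordMat]
    rw [h1, map_mul, ih, bigRep_ι, bigMat, Matrix.fromBlocks_multiply, h2, regMat_mul]
    simp

theorem trace_bigRep_wordQ (D N : ℕ) {w : List ℕ} (hw : w ≠ []) :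
    (bigRep K m D N (wordQ K m w)).trace = (wordMat K m w).trace := by
  rw [bigRep_wordQ]
  simp [Matrix.trace, regMat, hw]

/-- The matrix used to read off the coefficient of the word `a`. -/
noncomputable def srcMat (K : Type*) [Field K] (m : ℕ) {D N : ℕ} (a : BWord D N) :
    Matrix (Fin m ⊕ BWord D N) (Fin m ⊕ BWord D N) (CPoly K m) :=
  Matrix.single (Sum.inr (BWord.empty D N)) (Sum.inr a) 1

/-- The span of the words of length at most `D` in the letters `0, …, N - 1`. -/
noncomputable def boundedSpan (K : Type*) [Field K] (m N D : ℕ) :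
    Submodule (CPoly K m) (QPoly K m) :=
  Submodule.span (CPoly K m) (wordQ K m '' {w | w.length ≤ D ∧ ∀ k ∈ w, k < N})

theorem sum_trace_mul_srcMat_smul (D N : ℕ) {P : QPoly K m}
    (hP : P ∈ boundedSpan K m N D) :
    ∑ a : BWord D N, (bigRep K m D N P * srcMat K m a).trace • wordQ K m a.1 = P := by
  induction hP using Submodule.span_induction with
  | mem x h =>
    obtain ⟨w, hw, rfl⟩ := h
    have h1 : ∀ a : BWord D N, (bigRep K m D N (wordQ K m w) * srcMat K m a).trace =
        if a = ⟨w, hw⟩ then 1 else 0 := by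
      intro a
      rw [srcMat, Matrix.trace_mul_single, bigRep_wordQ]
      simp [regMat, BWord.empty, Subtype.ext_iff]
    simp [h1]
  | zero => simp
  | add x y _ _ hx hy =>
    simp only [map_add, add_mul, Matrix.trace_add, add_smul, sum_add_distrib, hx, hy]
  | smul c x _ hx =>
    simp only [map_smul, smul_mul_assoc, Matrix.trace_smul, smul_assoc, ← smul_sum, hx]

theorem wordQ_mem_boundedSpan {N D : ℕ} {w : List ℕ} (h : w.length ≤ D) (h' : ∀ k ∈ w, k < N) :
    wordQ K m w ∈ boundedSpan K m N D :=
  Submodule.subset_span ⟨w, ⟨h, h'⟩, rfl⟩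

theorem boundedSpan_mono (N : ℕ) {D D' : ℕ} (h : D ≤ D') :
    boundedSpan K m N D ≤ boundedSpan K m N D' :=
  Submodule.span_mono (Set.image_mono fun _ hw => ⟨hw.1.trans h, hw.2⟩)

theorem mul_mem_boundedSpan {N D D' : ℕ} {P Q : QPoly K m} (hP : P ∈ boundedSpan K m N D)
    (hQ : Q ∈ boundedSpan K m N D') : P * Q ∈ boundedSpan K m N (D + D') := by
  have := Submodule.mul_mem_mul hP hQ
  rw [boundedSpan, boundedSpan, Submodule.span_mul_span] at this
  refine Submodule.span_mono ?_ this
  rintro _ ⟨_, ⟨v, hv, rfl⟩, _, ⟨w, hw, rfl⟩, rfl⟩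
  refine ⟨v ++ w, ⟨?_, ?_⟩, wordQ_append v w⟩
  · rw [List.length_append]; exact add_le_add hv.1 hw.1
  · intro k hk
    rcases List.mem_append.1 hk with h | h
    exacts [hv.2 k h, hw.2 k h]

theorem pow_mem_boundedSpan {N D : ℕ} {P : QPoly K m} (hP : P ∈ boundedSpan K m N D) (i : ℕ) :
    P ^ i ∈ boundedSpan K m N (i * D) := by
  induction i with
  | zero => exact wordQ_mem_boundedSpan (w := []) (by simp) (by simp)
  | succ i ih =>
    rw [pow_succ, add_mul, one_mul]
    exact mul_mem_boundedSpan ih hP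

end BigRepresentation

section CayleyHamilton

open Finset Equiv

variable {K : Type*} [Field K] {m : ℕ}

/-- The Cayley–Hamilton quasi-polynomial evaluated at `h`. -/
noncomputable def chAt (h : QPoly K m) : QPoly K m :=
  ∑ i ∈ range (m + 1), (PhiQ K m h).charpoly.coeff i • h ^ i

theorem chAt_mem [CharZero K] {I : Set (QPoly K m)} (hI : IsTIdeal K m I) (hch : chQ K m ∈ I)
    (h : QPoly K m) : chAt h ∈ I := by
  have h1 := hI.2.2.2.2 (substQ fun _ => h) (isSubstEndo_substQ _) _ hch
  convert h1 using 1
  rw [chQ, map_sum, chAt]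
  refine sum_congr rfl fun i _ => ?_
  rw [map_mul, map_pow, substQ_algebraMap, substQ_ι, Algebra.smul_def]
  congr 2
  have h2 : PhiQ K m h = (genMat K m 0).map (substC fun _ => h).toRingHom := by
    ext i j : 1
    simp [genMat, substC]
  rw [h2, Matrix.charpoly_map, Polynomial.coeff_map]
  rfl

theorem chAt_mem_boundedSpan {N d : ℕ} {h : QPoly K m} (hh : h ∈ boundedSpan K m N d) :
    chAt h ∈ boundedSpan K m N (m * d) := by
  refine Submodule.sum_mem _ fun i hi => Submodule.smul_mem _ _ ?_
  refine boundedSpan_mono N (Nat.mul_le_mul_right d ?_) (pow_mem_boundedSpan hh i)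
  exact Nat.lt_succ_iff.1 (mem_range.1 hi)

/-- The quasi-polynomials without constant term. -/
noncomputable def posSpan (K : Type*) [Field K] (m : ℕ) : Submodule (CPoly K m) (QPoly K m) :=
  Submodule.span (CPoly K m) (wordQ K m '' {w | w ≠ []})

theorem mul_mem_posSpan {P : QPoly K m} (hP : P ∈ posSpan K m) (Q : QPoly K m) :
    P * Q ∈ posSpan K m := by
  have hQ : Q ∈ Submodule.span (CPoly K m) (Set.range (wordQ K m)) := by
    rw [span_wordQ]; trivial
  have := Submodule.mul_mem_mul hP hQ
  rw [posSpan, Submodule.span_mul_span] at this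
  refine Submodule.span_mono ?_ this
  rintro _ ⟨_, ⟨v, hv, rfl⟩, _, ⟨w, rfl⟩, rfl⟩
  exact ⟨v ++ w, by simp_all, wordQ_append v w⟩

theorem trace_bigRep {P : QPoly K m} (hP : P ∈ posSpan K m) (D N : ℕ) :
    (bigRep K m D N P).trace = (PhiQ K m P).trace := by
  induction hP using Submodule.span_induction with
  | mem x h =>
    obtain ⟨w, hw, rfl⟩ := h
    rw [trace_bigRep_wordQ D N hw, PhiQ_wordQ]
  | zero => simp
  | add x y _ _ hx hy => simp only [map_add, Matrix.trace_add, hx, hy]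
  | smul c x _ hx => simp only [map_smul, Matrix.trace_smul, hx]

theorem altTrConst_bigRep {h : QPoly K m} (hh : h ∈ posSpan K m) (D N : ℕ)
    (Z : Matrix (Fin m ⊕ BWord D N) (Fin m ⊕ BWord D N) (CPoly K m)) :
    altTrConst (bigRep K m D N h) m Z =
      (m.factorial * (-1) ^ m) * (bigRep K m D N (chAt h) * Z).trace := by
  have htr : ∀ i, ((bigRep K m D N h) ^ (i + 1)).trace = ((PhiQ K m h) ^ (i + 1)).trace := by
    intro i
    rw [← map_pow, ← map_pow, pow_succ']
    exact trace_bigRep (mul_mem_posSpan hh _) D N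
  rw [altTrConst_eq (bigRep K m D N h)
    (fun i => if i ≤ m then (-1) ^ i * (PhiQ K m h).charpoly.coeff (m - i) else 0)]
  · rw [mul_assoc]
    congr 1
    rw [chAt, map_sum, sum_mul, Matrix.trace_sum, mul_sum, ← sum_range_reflect]
    refine sum_congr rfl fun i hi => ?_
    have hi' : i ≤ m := Nat.lt_succ_iff.1 (mem_range.1 hi)
    have h1 : m + 1 - 1 - i = m - i := by omega
    rw [h1, if_pos (Nat.sub_le _ _), Nat.sub_sub_self hi', map_smul, map_pow, smul_mul_assoc,
      Matrix.trace_smul, smul_eq_mul, ← mul_assoc, ← mul_assoc, ← pow_add,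
      Nat.add_sub_cancel' hi', mul_assoc]
  · intro i
    rw [altTr_const_eq_of_trace_eq _ _ htr]
    split_ifs with h
    · rw [altTr_const_eq_charpoly _ i (by simpa using h), Fintype.card_fin]
    · rw [altTr_const_eq_zero _ i (by simpa using h), mul_zero]

theorem sum_altTr_smul_mem [CharZero K] (I : Submodule (CPoly K m) (QPoly K m))
    (hmul : ∀ a b, ∀ p ∈ I, a * p * b ∈ I) (hch : ∀ h, chAt h ∈ I) {D N d : ℕ}
    (hD : (m + 2) * d ≤ D) {u v : List ℕ} {X : Fin m → List ℕ}
    (hu : u.length ≤ d ∧ ∀ k ∈ u, k < N) (hv : v.length ≤ d ∧ ∀ k ∈ v, k < N)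
    (hX : ∀ i, (X i).length ≤ d ∧ ∀ k ∈ X i, k < N) (hX' : ∀ i, X i ≠ []) :
    ∑ a : BWord D N, altTr (fun o : Option (Fin m) => o.elim
      (bigRep K m D N (wordQ K m u) * srcMat K m a * bigRep K m D N (wordQ K m v))
      fun i => bigRep K m D N (wordQ K m (X i))) • wordQ K m a.1 ∈ I := by
  have key : ∀ h ∈ boundedSpan K m N d, h ∈ posSpan K m →
      ∑ a : BWord D N, altTrConst (bigRep K m D N h) m
        (bigRep K m D N (wordQ K m u) * srcMat K m a * bigRep K m D N (wordQ K m v)) •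
          wordQ K m a.1 ∈ I := by
    intro h hb hp
    have h1 : ∀ a : BWord D N, altTrConst (bigRep K m D N h) m
        (bigRep K m D N (wordQ K m u) * srcMat K m a * bigRep K m D N (wordQ K m v)) =
        (m.factorial * (-1) ^ m) *
          (bigRep K m D N (wordQ K m v * chAt h * wordQ K m u) * srcMat K m a).trace := by
      intro a
      rw [altTrConst_bigRep hp, ← mul_assoc, Matrix.trace_mul_comm, map_mul, map_mul]
      simp only [mul_assoc]
    simp_rw [h1, mul_smul, ← smul_sum]
    rw [sum_trace_mul_srcMat_smul]
    · exact I.smul_mem _ (I.smul_mem _ (hmul _ _ _ (hch h)))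
    · have h2 := mul_mem_boundedSpan (mul_mem_boundedSpan
        (wordQ_mem_boundedSpan (K := K) (m := m) hv.1 hv.2) (chAt_mem_boundedSpan hb))
        (wordQ_mem_boundedSpan (K := K) (m := m) hu.1 hu.2)
      exact boundedSpan_mono N (by linarith) h2
  have h0 : (m.factorial : CPoly K m) • ∑ a : BWord D N, altTr (fun o : Option (Fin m) => o.elim
      (bigRep K m D N (wordQ K m u) * srcMat K m a * bigRep K m D N (wordQ K m v))
      fun i => bigRep K m D N (wordQ K m (X i))) • wordQ K m a.1 ∈ I := by
    have h2 := fun a : BWord D N => factorial_mul_altTr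
      (bigRep K m D N (wordQ K m u) * srcMat K m a * bigRep K m D N (wordQ K m v))
      (fun i => bigRep K m D N (wordQ K m (X i)))
    simp only [Fintype.card_fin] at h2
    simp_rw [smul_sum, ← mul_smul, h2, sum_smul]
    rw [sum_comm]
    refine I.sum_mem fun A _ => ?_
    simp_rw [mul_smul, ← smul_sum, ← map_sum]
    exact I.smul_mem _ (key _ (Submodule.sum_mem _ fun i _ => wordQ_mem_boundedSpan (hX i).1 (hX i).2)
      (Submodule.sum_mem _ fun i _ => Submodule.subset_span ⟨X i, hX' i, rfl⟩))
  have h3 := I.smul_mem (algebraMap K (CPoly K m) (m.factorial : K)⁻¹) h0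
  rwa [smul_smul, ← map_natCast (algebraMap K (CPoly K m)), ← map_mul,
    inv_mul_cancel₀ (by exact_mod_cast m.factorial_ne_zero), map_one, one_smul] at h3

end CayleyHamilton

section MergeWords

open Finset Equiv

variable {γ : Type} [DecidableEq γ]

/-- Append the word at `none` to the word at `some x`. -/
def mergeWords (x : γ) (l : Option γ → List ℕ) : γ → List ℕ :=
  Function.update (l ∘ some) x (l (some x) ++ l none)

theorem mergeWords_prod {M : Type*} [Monoid M] (G : ℕ → M) (x : γ) (l : Option γ → List ℕ) :
    (fun s => ((mergeWords x l s).map G).prod) =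
      Function.update ((fun o => ((l o).map G).prod) ∘ some) x
        (((l (some x)).map G).prod * ((l none).map G).prod) := by
  funext s
  by_cases h : s = x
  · subst h; simp [mergeWords]
  · simp [mergeWords, h]

theorem forall_mergeWords {p : List ℕ → Prop} (hp : ∀ u v, p u → p v → p (u ++ v)) (x : γ)
    {l : Option γ → List ℕ} (hl : ∀ o, p (l o)) (s : γ) : p (mergeWords x l s) := by
  by_cases h : s = x
  · subst h; simpa [mergeWords] using hp _ _ (hl _) (hl _)
  · simpa [mergeWords, h] using hl _

theorem sum_mergeWords [Fintype γ] {g : List ℕ → ℕ} (hg : ∀ u v, g (u ++ v) = g u + g v) (x : γ)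
    (l : Option γ → List ℕ) : ∑ s, g (mergeWords x l s) = ∑ o, g (l o) := by
  rw [Fintype.sum_option, ← add_sum_erase _ _ (mem_univ x), ← add_sum_erase univ _ (mem_univ x),
    ← add_assoc]
  refine congrArg₂ (· + ·) ?_ (sum_congr rfl fun s hs => ?_)
  · simp [mergeWords, hg, add_comm]
  · simp [mergeWords, ne_of_mem_erase hs]

theorem exists_eq_permCongr_optionCongr [Fintype γ] (s₀ : γ) (σ : Perm γ) :
    ∃ (i : Option {s // s ≠ s₀}) (τ : Perm {s // s ≠ s₀}),
      σ = (optionSubtypeNe s₀).permCongr (optionCongr τ * swap none i) := by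
  obtain ⟨⟨i, τ⟩, h⟩ := decomposeOptionRight.surjective ((optionSubtypeNe s₀).permCongr.symm σ)
  exact ⟨i, τ, by rw [← decomposeOptionRight_apply, h, Equiv.apply_symm_apply]⟩

theorem viaEmbeddingHom_eq_permCongr {δ : Type*} (e : δ ↪ γ) (s₀ : γ)
    (e' : δ ↪ {s // s ≠ s₀}) (he : ∀ x, (e' x : γ) = e x) (ρ : Perm δ) :
    Perm.viaEmbeddingHom e ρ =
      (optionSubtypeNe s₀).permCongr (optionCongr (Perm.viaEmbeddingHom e' ρ)) := by
  ext s
  rw [Equiv.permCongr_apply, Perm.viaEmbeddingHom_apply, Perm.viaEmbeddingHom_apply]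
  by_cases h : s = s₀
  · subst h
    rw [Perm.viaEmbedding_apply_of_notMem]
    · simp
    · rintro ⟨x, hx⟩; exact (e' x).2 ((he x).trans hx)
  · rw [optionSubtypeNe_symm_of_ne h]
    by_cases hx : ∃ x, e x = s
    · obtain ⟨x, rfl⟩ := hx
      have h1 : (⟨e x, h⟩ : {s // s ≠ s₀}) = e' x := Subtype.ext (he x).symm
      rw [Perm.viaEmbedding_apply, h1, optionCongr_apply, Option.map_some, Perm.viaEmbedding_apply,
        optionSubtypeNe_some, he]
    · rw [Perm.viaEmbedding_apply_of_notMem _ _ _ (by simpa using hx), optionCongr_apply,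
        Option.map_some, Perm.viaEmbedding_apply_of_notMem _ _ _
          (by rintro ⟨x, hx'⟩; exact hx ⟨x, (he x).symm.trans (congrArg Subtype.val hx')⟩),
        optionSubtypeNe_some]

omit [DecidableEq γ] in
theorem viaEmbeddingHom_toEmbedding {δ : Type*} (e : δ ≃ γ) (ρ : Perm δ) :
    Perm.viaEmbeddingHom e.toEmbedding ρ = e.permCongr ρ := by
  ext s
  obtain ⟨x, rfl⟩ := e.surjective s
  rw [Perm.viaEmbeddingHom_apply]
  have := Perm.viaEmbedding_apply ρ e.toEmbedding x
  simpa [Equiv.permCongr_apply] using this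

theorem ptr_map_prod_eq {β β' B : Type*} [Fintype β] [Fintype β'] [DecidableEq β]
    [DecidableEq β'] [CommRing B] (G : ℕ → Matrix β β B) (G' : ℕ → Matrix β' β' B)
    (p : List ℕ → Prop) (hp : ∀ u v, p u → p v → p (u ++ v))
    (h : ∀ w, p w → ((w.map G).prod).trace = ((w.map G').prod).trace) (c : ℕ) :
    ∀ (γ : Type) [Fintype γ] [DecidableEq γ] (σ : Perm γ) (l : γ → List ℕ),
      Fintype.card γ = c → (∀ s, p (l s)) →
      ptr σ (fun s => ((l s).map G).prod) = ptr σ (fun s => ((l s).map G').prod) := by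
  induction c with
  | zero =>
    intro γ _ _ σ l hc hl
    have := Fintype.card_eq_zero_iff.1 hc
    simp [ptr]
  | succ c ih =>
    intro γ _ _ σ l hc hl
    have hne : Nonempty γ := Fintype.card_pos_iff.1 (by omega)
    obtain ⟨s₀⟩ := hne
    obtain ⟨i, τ, rfl⟩ := exists_eq_permCongr_optionCongr s₀ σ
    have hc' : Fintype.card {s // s ≠ s₀} = c := by
      rw [Fintype.card_subtype_compl, Fintype.card_subtype_eq, hc, Nat.add_sub_cancel]
    rw [ptr_permCongr, ptr_permCongr]
    set l' : Option {s // s ≠ s₀} → List ℕ := l ∘ optionSubtypeNe s₀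
    have hpl : ∀ o, p (l' o) := fun o => hl _
    change ptr _ (fun o => ((l' o).map G).prod) = ptr _ (fun o => ((l' o).map G').prod)
    cases i with
    | none =>
      rw [swap_self, ← Perm.one_def, mul_one, ptr_optionCongr, ptr_optionCongr, h _ (hpl _)]
      congr 1
      exact ih _ τ (l' ∘ some) hc' fun s => hpl _
    | some x =>
      rw [ptr_optionCongr_swap, ptr_optionCongr_swap, ← mergeWords_prod, ← mergeWords_prod]
      exact ih _ τ _ hc' (forall_mergeWords hp x hpl)

end MergeWords

section AntisymmetricRelation

open Finset Equiv

variable {K : Type*} [Field K] {m : ℕ}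

/-- The matrix assigned to a letter: the letter `0` becomes `srcMat a` and the letter `k + 1`
becomes `bigMat k`. -/
noncomputable def letterMat (K : Type*) [Field K] (m : ℕ) {D N : ℕ} (a : BWord D N) :
    ℕ → Matrix (Fin m ⊕ BWord D N) (Fin m ⊕ BWord D N) (CPoly K m)
  | 0 => srcMat K m a
  | k + 1 => bigMat K m D N k

theorem prod_map_letterMat {D N : ℕ} (a : BWord D N) {w : List ℕ} (hw : 0 ∉ w) :
    (w.map (letterMat K m a)).prod = bigRep K m D N (wordQ K m (w.map Nat.pred)) := by
  rw [wordQ, map_list_prod, List.map_map, List.map_map]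
  congr 1
  refine List.map_congr_left fun k hk => ?_
  cases k with
  | zero => exact absurd hk hw
  | succ k => exact (bigRep_ι D N k).symm

/-- Read off a quasi-polynomial from a permutation and a family of words. -/
noncomputable def readOff (K : Type*) [Field K] (m D N : ℕ) {γ : Type} [Fintype γ]
    [DecidableEq γ] (σ : Perm γ) (l : γ → List ℕ) : QPoly K m :=
  ∑ a : BWord D N, ptr σ (fun s => ((l s).map (letterMat K m a)).prod) • wordQ K m a.1

theorem readOff_permCongr (D N : ℕ) {γ δ : Type} [Fintype γ] [Fintype δ] [DecidableEq γ]
    [DecidableEq δ] (e : γ ≃ δ) (σ : Perm γ) (l : δ → List ℕ) :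
    readOff K m D N (e.permCongr σ) l = readOff K m D N σ (l ∘ e) := by
  refine sum_congr rfl fun a _ => ?_
  rw [ptr_permCongr]
  rfl

theorem readOff_optionCongr_swap (D N : ℕ) {γ : Type} [Fintype γ] [DecidableEq γ]
    (x : γ) (σ : Perm γ) (l : Option γ → List ℕ) :
    readOff K m D N (optionCongr σ * swap none (some x)) l =
      readOff K m D N σ (mergeWords x l) := by
  refine sum_congr rfl fun a _ => ?_
  rw [ptr_optionCongr_swap, ← mergeWords_prod]

theorem ptr_letterMat {D N : ℕ} (a : BWord D N) {γ : Type} [Fintype γ] [DecidableEq γ]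
    (σ : Perm γ) (l : γ → List ℕ) (hl : ∀ s, l s ≠ [] ∧ 0 ∉ l s) :
    ptr σ (fun s => ((l s).map (letterMat K m a)).prod) =
      ptr σ (fun s => ((l s).map fun k => genMat K m k.pred).prod) := by
  refine ptr_map_prod_eq _ _ (fun w => w ≠ [] ∧ 0 ∉ w) ?_ ?_ _ _ σ l rfl hl
  · rintro u v ⟨hu, hu'⟩ ⟨_, hv'⟩
    exact ⟨by simp [hu], by simp [hu', hv']⟩
  · rintro w ⟨hw, hw'⟩
    rw [prod_map_letterMat a hw', trace_bigRep_wordQ _ _ (by simpa using hw), wordMat,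
      List.map_map]
    rfl

theorem sum_sign_smul_readOff_of_equiv [CharZero K] (I : Submodule (CPoly K m) (QPoly K m))
    (hmul : ∀ a b, ∀ p ∈ I, a * p * b ∈ I) (hch : ∀ h, chAt h ∈ I) {D N d : ℕ}
    (hD : (m + 2) * d ≤ D) {γ : Type} [Fintype γ] [DecidableEq γ] (e : Fin (m + 1) ≃ γ)
    (σ : Perm γ) (l : γ → List ℕ) (hl : ∀ s, l s ≠ []) (hN : ∀ s, ∀ k ∈ l s, k ≤ N)
    (hd : ∑ s, (l s).length ≤ d) (h0 : ∑ s, (l s).count 0 = 1) :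
    ∑ ρ : Perm (Fin (m + 1)), ((Perm.sign ρ : ℤ) : CPoly K m) •
      readOff K m D N (Perm.viaEmbeddingHom e.toEmbedding ρ * σ) l ∈ I := by
  have h1 : ∑ ρ : Perm (Fin (m + 1)), ((Perm.sign ρ : ℤ) : CPoly K m) •
      readOff K m D N (Perm.viaEmbeddingHom e.toEmbedding ρ * σ) l =
      ((Perm.sign σ : ℤ) : CPoly K m) • ∑ a : BWord D N,
        altTr (fun s => ((l s).map (letterMat K m a)).prod) • wordQ K m a.1 := by
    have h2 : ∑ a : BWord D N,
        altTr (fun s => ((l s).map (letterMat K m a)).prod) • wordQ K m a.1 =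
        ∑ τ : Perm γ, ((Perm.sign τ : ℤ) : CPoly K m) • readOff K m D N τ l := by
      simp only [altTr, readOff, sum_smul, smul_sum, zsmul_eq_mul, mul_smul]
      rw [sum_comm]
    rw [h2, smul_sum]
    refine Fintype.sum_equiv (e.permCongr.trans (Equiv.mulRight σ)) _ _ fun ρ => ?_
    rw [viaEmbeddingHom_toEmbedding]
    simp only [Equiv.trans_apply, Equiv.coe_mulRight, Perm.sign_mul, Perm.sign_permCongr]
    rw [smul_smul, ← Int.cast_mul, Units.val_mul, mul_comm, mul_assoc, ← Units.val_mul,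
      Int.units_mul_self, Units.val_one, mul_one]
  rw [h1]
  refine I.smul_mem _ ?_
  obtain ⟨s₀, hs₀⟩ : ∃ s₀, (l s₀).count 0 ≠ 0 := by
    by_contra! h
    simp [h] at h0
  have hs : ∀ s, s ≠ s₀ → (l s).count 0 = 0 := by
    intro s hs
    have h3 := add_sum_erase univ (fun s => (l s).count 0) (mem_univ s₀)
    have h4 := single_le_sum (f := fun s => (l s).count 0) (fun _ _ => Nat.zero_le _)
      (mem_erase.2 ⟨hs, mem_univ s⟩)
    omega
  have hs1 : (l s₀).count 0 = 1 := by
    have h4 := single_le_sum (f := fun s => (l s).count 0) (fun _ _ => Nat.zero_le _)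
      (mem_univ s₀)
    omega
  have hlen : ∀ s, (l s).length ≤ d := fun s =>
    (single_le_sum (f := fun s => (l s).length) (fun _ _ => Nat.zero_le _) (mem_univ s)).trans hd
  have hpred : ∀ s, 0 ∉ l s → ∀ k ∈ (l s).map Nat.pred, k < N := by
    intro s h5 k hk
    obtain ⟨k', hk', rfl⟩ := List.mem_map.1 hk
    have := hN s k' hk'
    have : k' ≠ 0 := fun h => h5 (h ▸ hk')
    simp only [Nat.pred_eq_sub_one]
    omega
  let ε : Option (Fin m) ≃ γ := (finSuccEquiv' (e.symm s₀)).symm.trans e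
  have hε : ε none = s₀ := by simp [ε]
  have hε' : ∀ i, ε (some i) ≠ s₀ := fun i h => by
    have := ε.injective (h.trans hε.symm)
    simp at this
  obtain ⟨u, v, huv⟩ := List.append_of_mem (List.count_pos_iff.1 (Nat.pos_of_ne_zero hs₀))
  have hu : 0 ∉ u ∧ 0 ∉ v := by
    rw [huv, List.count_append, List.count_cons_self] at hs1
    exact ⟨List.count_eq_zero.1 (by omega), List.count_eq_zero.1 (by omega)⟩
  have hlast : ∀ w : List ℕ, 0 ∉ w → (∀ k ∈ w, k ∈ l s₀) → ∀ k ∈ w.map Nat.pred, k < N := by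
    intro w h5 h6 k hk
    obtain ⟨k', hk', rfl⟩ := List.mem_map.1 hk
    have := hN s₀ k' (h6 _ hk')
    have : k' ≠ 0 := fun h => h5 (h ▸ hk')
    simp only [Nat.pred_eq_sub_one]
    omega
  have hlen0 := hlen s₀
  rw [huv, List.length_append, List.length_cons] at hlen0
  have := sum_altTr_smul_mem I hmul hch hD (u := u.map Nat.pred) (v := v.map Nat.pred)
    (X := fun i => (l (ε (some i))).map Nat.pred)
    ⟨by rw [List.length_map]; omega, hlast u hu.1 (by simp +contextual [huv])⟩
    ⟨by rw [List.length_map]; omega, hlast v hu.2 (by simp +contextual [huv])⟩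
    (fun i => ⟨by rw [List.length_map]; exact hlen _,
      hpred _ (List.count_eq_zero.1 (hs _ (hε' i)))⟩)
    (fun i => by simpa using hl _)
  convert this using 4 with a
  rw [← altTr_reindex ε]
  congr 1
  funext o
  cases o with
  | none =>
    simp only [Function.comp, hε, Option.elim_none]
    rw [huv, List.map_append, List.prod_append, List.map_cons, List.prod_cons,
      prod_map_letterMat a hu.1, prod_map_letterMat a hu.2, mul_assoc]
    rfl
  | some i =>
    exact prod_map_letterMat a (List.count_eq_zero.1 (hs _ (hε' i)))

theorem sum_sign_smul_readOff_mem [CharZero K] (I : Submodule (CPoly K m) (QPoly K m))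
    (hmul : ∀ a b, ∀ p ∈ I, a * p * b ∈ I) (hch : ∀ h, chAt h ∈ I) {D N d : ℕ}
    (hD : (m + 2) * d ≤ D) (c : ℕ) :
    ∀ (γ : Type) [Fintype γ] [DecidableEq γ] (e : Fin (m + 1) ↪ γ)
      (σ : Perm γ) (l : γ → List ℕ), Fintype.card γ = c → (∀ s, l s ≠ []) →
      (∀ s, ∀ k ∈ l s, k ≤ N) → ∑ s, (l s).length ≤ d → ∑ s, (l s).count 0 = 1 →
      ∑ ρ : Perm (Fin (m + 1)), ((Perm.sign ρ : ℤ) : CPoly K m) •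
        readOff K m D N (Perm.viaEmbeddingHom e ρ * σ) l ∈ I := by
  induction c with
  | zero =>
    intro γ _ _ e σ l hc
    have := Fintype.card_eq_zero_iff.1 hc
    exact isEmptyElim (e 0)
  | succ c ih =>
    intro γ _ _ e σ l hc hl hN hd h0
    by_cases hsurj : Function.Surjective e
    · have he : (Equiv.ofBijective e ⟨e.injective, hsurj⟩).toEmbedding = e := by ext; rfl
      rw [← he]
      exact sum_sign_smul_readOff_of_equiv I hmul hch hD _ σ l hl hN hd h0
    · obtain ⟨s₀, hs₀⟩ : ∃ s₀, ∀ x, e x ≠ s₀ := by simpa [Function.Surjective] using hsurj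
      obtain ⟨i, τ, rfl⟩ := exists_eq_permCongr_optionCongr s₀ σ
      let e' : Fin (m + 1) ↪ {s // s ≠ s₀} :=
        ⟨fun x => ⟨e x, hs₀ x⟩, fun x y h => e.injective (congrArg Subtype.val h)⟩
      have hc' : Fintype.card {s // s ≠ s₀} = c := by
        rw [Fintype.card_subtype_compl, Fintype.card_subtype_eq, hc, Nat.add_sub_cancel]
      set l' : Option {s // s ≠ s₀} → List ℕ := l ∘ optionSubtypeNe s₀
      have hsum : ∀ g : List ℕ → ℕ, ∑ o, g (l' o) = ∑ s, g (l s) := fun g =>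
        Fintype.sum_equiv (optionSubtypeNe s₀) _ _ fun _ => rfl
      have h1 : ∀ ρ : Perm (Fin (m + 1)), readOff K m D N (Perm.viaEmbeddingHom e ρ *
          (optionSubtypeNe s₀).permCongr (optionCongr τ * swap none i)) l =
          readOff K m D N (optionCongr (Perm.viaEmbeddingHom e' ρ * τ) * swap none i) l' := by
        intro ρ
        rw [viaEmbeddingHom_eq_permCongr e s₀ e' (fun _ => rfl), ← Equiv.permCongr_mul,
          readOff_permCongr, ← decomposeOptionRight_apply, optionCongr_mul_decomposeOptionRight,
          decomposeOptionRight_apply]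
      simp_rw [h1]
      have hd' := hd
      have h0' := h0
      rw [← hsum List.length] at hd'
      rw [← hsum (List.count 0)] at h0'
      cases i with
      | some x =>
        simp_rw [readOff_optionCongr_swap]
        refine ih _ e' τ _ hc' ?_ ?_ ?_ ?_
        · exact forall_mergeWords (p := fun w => w ≠ []) (fun u v hu hv => by simp [hu]) x
            fun o => hl _
        · exact forall_mergeWords (p := fun w => ∀ k ∈ w, k ≤ N)
            (fun u v hu hv k hk => (List.mem_append.1 hk).elim (hu k) (hv k)) x fun o => hN _
        · rwa [sum_mergeWords (fun u v => List.length_append)]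
        · rwa [sum_mergeWords (fun u v => List.count_append)]
      | none =>
        simp only [swap_self, ← Perm.one_def, mul_one]
        rw [Fintype.sum_option] at hd' h0'
        by_cases hz : 0 ∈ l' none
        · have h2 : ∀ x, (l' (some x)).count 0 = 0 := by
            have h3 := List.count_pos_iff.2 hz
            have h4 : ∑ x, (l' (some x)).count 0 = 0 := by omega
            simpa [sum_eq_zero_iff] using h4
          have h3 : ∑ ρ : Perm (Fin (m + 1)), ((Perm.sign ρ : ℤ) : CPoly K m) •
              readOff K m D N (optionCongr (Perm.viaEmbeddingHom e' ρ * τ)) l' = 0 := by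
            simp only [readOff, smul_sum]
            rw [sum_comm]
            refine sum_eq_zero fun a _ => ?_
            simp only [smul_smul]
            rw [← sum_smul]
            convert zero_smul _ _
            simp only [ptr_optionCongr, Function.comp_def]
            have h4 := sum_sign_smul_ptr_eq_zero e' τ
              (fun s => ((l' (some s)).map fun k => genMat K m k.pred).prod)
            simp only [ptr_letterMat a _ (fun s => l' (some s))
              (fun s => ⟨hl _, List.count_eq_zero.1 (h2 s)⟩), mul_left_comm _ (Matrix.trace _)]
            simp only [zsmul_eq_mul] at h4
            rw [← mul_sum, h4, mul_zero]
          rw [h3]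
          exact I.zero_mem
        · have h3 : ∀ ρ : Perm (Fin (m + 1)),
              readOff K m D N (optionCongr (Perm.viaEmbeddingHom e' ρ * τ)) l' =
              (((l' none).map fun k => genMat K m k.pred).prod).trace •
                readOff K m D N (Perm.viaEmbeddingHom e' ρ * τ) (l' ∘ some) := by
            intro ρ
            simp only [readOff, smul_sum]
            refine sum_congr rfl fun a _ => ?_
            have hnil : (l' none).map Nat.pred ≠ [] := fun h => hl _ (List.map_eq_nil_iff.1 h)
            rw [ptr_optionCongr, mul_smul, prod_map_letterMat a hz,
              trace_bigRep_wordQ _ _ hnil, wordMat, List.map_map]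
            rfl
          simp only [h3]
          simp only [smul_comm _ (Matrix.trace _)]
          rw [← smul_sum]
          refine I.smul_mem _ (ih _ e' τ _ hc' (fun s => hl _) (fun s => hN _) ?_ ?_)
          · simp only [Function.comp_apply]
            omega
          · rw [List.count_eq_zero.2 hz, zero_add] at h0'
            exact h0'

end AntisymmetricRelation

section Assembly

open Finset Equiv

variable {K : Type*} [Field K] {m : ℕ}

theorem TrTerm.weight_comp {d d' : ℕ} (e : Fin d ≃ Fin d') (κ : Fin d' → ℕ) (σ : Perm (Fin d'))
    (τ : Perm (Fin d)) : TrTerm.weight ⟨d, κ ∘ e, τ⟩ = TrTerm.weight ⟨d', κ, σ⟩ :=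
  Fintype.sum_equiv e _ _ fun _ => rfl

theorem TrTerm.weight_apply_zero (t : TrTerm) :
    t.weight 0 = ∑ s, List.count 0 [t.2.1 s] := by
  rw [TrTerm.weight, Finsupp.finsetSum_apply]
  refine sum_congr rfl fun s _ => ?_
  simp [Finsupp.single_apply, List.count_singleton]

theorem TrTerm.degree_weight (t : TrTerm) : t.weight.degree = t.1 := by
  rw [TrTerm.weight, map_sum]
  simp

theorem TrTerm.mem_support_weight (t : TrTerm) (s : Fin t.1) : t.2.1 s ∈ t.weight.support := by
  rw [TrTerm.weight, Finsupp.mem_support_iff, Finsupp.finsetSum_apply]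
  have := single_le_sum (f := fun s' => Finsupp.single (t.2.1 s') 1 (t.2.1 s))
    (fun _ _ => Nat.zero_le _) (mem_univ s)
  simp only [Finsupp.single_eq_same] at this
  omega

theorem traceCompatible_genMat : TraceCompatible (genMat K m) (shiftC K m) := by
  intro v _
  rw [shiftC_trace_wordMat, wordMat, List.map_map]
  rfl

theorem prod_map_letterMat_succ {D N : ℕ} (a : BWord D N) (v : List ℕ) :
    (v.map fun k => letterMat K m a (k + 1)).prod = bigRep K m D N (wordQ K m v) := by
  rw [wordQ, map_list_prod, List.map_map]
  congr 1
  exact List.map_congr_left fun k _ => (bigRep_ι D N k).symm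

theorem traceCompatible_letterMat {D N : ℕ} (a : BWord D N) :
    TraceCompatible (letterMat K m a) (AlgHom.id K _) := by
  intro v hv
  rw [prod_map_letterMat_succ, trace_bigRep_wordQ _ _ hv]
  rfl

theorem mul_viaEmbeddingHom {δ γ : Type*} (σ : Perm γ) (e : δ ↪ γ) (ρ : Perm δ) :
    σ * Perm.viaEmbeddingHom e ρ = Perm.viaEmbeddingHom (e.trans σ.toEmbedding) ρ * σ := by
  ext s
  simp only [Perm.mul_apply, Perm.viaEmbeddingHom_apply]
  by_cases h : s ∈ Set.range e
  · obtain ⟨x, rfl⟩ := h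
    rw [Perm.viaEmbedding_apply]
    exact (Perm.viaEmbedding_apply ρ (e.trans σ.toEmbedding) x).symm
  · rw [Perm.viaEmbedding_apply_of_notMem _ _ _ h, Perm.viaEmbedding_apply_of_notMem]
    rintro ⟨x, hx⟩
    exact h ⟨x, σ.injective hx⟩

theorem readOff_singleton (D N : ℕ) {d : ℕ} (κ : Fin d → ℕ) (σ : Perm (Fin d)) :
    readOff K m D N σ (fun s => [κ s]) =
      ∑ a : BWord D N, TrTerm.eval (letterMat K m a) ⟨d, κ, σ⟩ • wordQ K m a.1 := by
  simp only [readOff, List.map_cons, List.map_nil, List.prod_singleton]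
  rfl

theorem sum_smul_wordQ_mem [CharZero K] (I : Submodule (CPoly K m) (QPoly K m))
    (hmul : ∀ a b, ∀ p ∈ I, a * p * b ∈ I) (hch : ∀ h, chAt h ∈ I) (c : List ℕ →₀ TnAlg K m)
    (hc : (c.sum fun w t => (t : CPoly K m) • wordMat K m w) = 0) :
    (c.sum fun w t => (t : CPoly K m) • wordQ K m w) ∈ I := by
  classical
  obtain ⟨x, hx, hev⟩ := exists_formal c
  let G : Finset (ℕ →₀ ℕ) := x.support.image TrTerm.weight
  have hG0 : ∀ w ∈ G, w 0 = 1 := by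
    intro w hw
    obtain ⟨t, ht, rfl⟩ := mem_image.1 hw
    exact (Finsupp.mem_supported K x).1 hx ht
  let d₀ : ℕ := G.sup Finsupp.degree + c.support.sup List.length
  let N : ℕ := G.sup (fun w => w.support.sup id) + c.support.sup List.sum + 1
  let D : ℕ := (m + 2) * d₀
  let f : TrTerm → QPoly K m ⧸ I := fun t =>
    if t.weight ∈ G then I.mkQ (readOff K m D N t.2.2 fun s => [t.2.1 s]) else 0
  have h1 : (x.sum fun t c => c • f t) = 0 := by
    refine sum_smul_eq_zero_of_eval_eq_zero (m := m) x f ?_ ?_ ?_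
    · have h2 := hev (Fin m) (genMat K m) (shiftC K m) traceCompatible_genMat
      rw [Finsupp.linearCombination_apply] at h2
      rw [h2]
      have h3 : ∀ w, (w.map fun k => genMat K m (k + 1)).prod =
          (shiftC K m).mapMatrix (wordMat K m w) := by
        intro w
        rw [shiftC_wordMat, wordMat, List.map_map]
        rfl
      have h4 : ∀ (t : CPoly K m) (w : List ℕ), shiftC K m t *
          ((w.map fun k => genMat K m (k + 1)).prod * genMat K m 0).trace =
          ((shiftC K m).mapMatrix (t • wordMat K m w) * genMat K m 0).trace := by
        intro t w
        rw [h3, shiftC_smul, smul_mul_assoc, Matrix.trace_smul, smul_eq_mul]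
      simp only [h4]
      rw [Finsupp.sum, ← Matrix.trace_sum, ← sum_mul, ← map_sum]
      rw [Finsupp.sum] at hc
      rw [hc, map_zero, zero_mul, Matrix.trace_zero]
    · intro d d' e κ σ
      simp only [f, TrTerm.weight_comp e κ σ]
      congr 2
      have h2 := readOff_permCongr (K := K) (m := m) D N e (e.symm.permCongr σ) fun s => [κ s]
      refine Eq.trans h2.symm ?_
      congr 1
      ext s
      simp [Equiv.permCongr_apply]
    · intro d κ σ e
      by_cases hw : TrTerm.weight ⟨d, κ, σ⟩ ∈ G
      · have h2 : ∀ τ : Perm (Fin d), f ⟨d, κ, τ⟩ = I.mkQ (readOff K m D N τ fun s => [κ s]) :=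
          fun τ => if_pos hw
        have h3 := sum_sign_smul_readOff_mem I hmul hch (D := D) (N := N) (d := d₀) le_rfl _ (Fin d)
          (e.trans σ.toEmbedding) σ (fun s => [κ s]) rfl (by simp)
          (by
            intro s k hk
            rw [List.mem_singleton.1 hk]
            have h4 := le_sup (f := id) (TrTerm.mem_support_weight ⟨d, κ, σ⟩ s)
            have h5 := le_sup (f := fun w : ℕ →₀ ℕ => w.support.sup id) hw
            have h6 := h4.trans h5
            simp only [id] at h6
            simp only [N]
            omega)
          (by
            have h5 := le_sup (f := Finsupp.degree) hw
            rw [TrTerm.degree_weight] at h5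
            simp only [List.length_singleton, sum_const, card_univ, Fintype.card_fin, smul_eq_mul,
              mul_one]
            exact h5.trans (Nat.le_add_right _ _))
          (by rw [← TrTerm.weight_apply_zero ⟨d, κ, σ⟩]; exact hG0 _ hw)
        rw [← Submodule.Quotient.mk_eq_zero, ← Submodule.mkQ_apply, map_sum] at h3
        refine Eq.trans (sum_congr rfl fun ρ _ => ?_) h3
        rw [h2, mul_viaEmbeddingHom, map_smul]
        rw [← algebraMap_smul (CPoly K m), map_intCast]
      · refine sum_eq_zero fun ρ _ => ?_
        have : f ⟨d, κ, σ * Perm.viaEmbeddingHom e ρ⟩ = 0 := if_neg hw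
        rw [this, smul_zero]
  have h2 : (x.sum fun t c => c • f t) = I.mkQ (c.sum fun w t => (t : CPoly K m) • wordQ K m w) := by
    have h3 : (x.sum fun t c => c • f t) =
        I.mkQ (∑ a : BWord D N, (x.sum fun t c => c • t.eval (letterMat K m a)) • wordQ K m a.1) := by
      simp only [Finsupp.sum, sum_smul]
      rw [sum_comm, map_sum]
      refine sum_congr rfl fun t ht => ?_
      simp only [f]
      rw [if_pos (mem_image_of_mem _ ht), readOff_singleton]
      simp only [smul_assoc]
      rw [← smul_sum, ← algebraMap_smul (CPoly K m) (x t), ← algebraMap_smul (CPoly K m) (x t),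
        map_smul]
    rw [h3]
    congr 1
    have h4 : ∀ a : BWord D N, (x.sum fun t c => c • t.eval (letterMat K m a)) =
        (bigRep K m D N (c.sum fun w t => (t : CPoly K m) • wordQ K m w) * srcMat K m a).trace := by
      intro a
      have h5 := hev _ (letterMat K m a) (AlgHom.id K _) (traceCompatible_letterMat a)
      rw [Finsupp.linearCombination_apply] at h5
      rw [h5, Finsupp.sum, Finsupp.sum, map_sum, sum_mul, Matrix.trace_sum]
      refine sum_congr rfl fun w _ => ?_
      rw [prod_map_letterMat_succ, map_smul, smul_mul_assoc, Matrix.trace_smul]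
      rfl
    simp only [h4]
    refine sum_trace_mul_srcMat_smul D N (Submodule.sum_mem _ fun w hw => Submodule.smul_mem _ _ ?_)
    refine wordQ_mem_boundedSpan ?_ fun k hk => ?_
    · have h6 := le_sup (f := List.length) hw
      calc w.length ≤ d₀ := h6.trans (Nat.le_add_left _ _)
        _ ≤ D := Nat.le_mul_of_pos_left _ (by omega)
    · have h6 := le_sup (f := List.sum) hw
      have h7 := List.le_sum_of_mem hk
      simp only [N]
      omega
  rw [h1] at h2
  exact (Submodule.Quotient.mk_eq_zero I).1 h2.symm

theorem exists_linearMap_of_retraction {R M N ι : Type*} [Ring R] [AddCommGroup M]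
    [AddCommGroup N] [Module R M] [Module R N] (v : ι → M) (u : ι → N)
    (hker : ∀ c : ι →₀ R, Finsupp.linearCombination R v c = 0 → Finsupp.linearCombination R u c = 0)
    (r : M →ₗ[R] M) (hr : ∀ y, r y ∈ Submodule.span R (Set.range v)) (hrv : ∀ i, r (v i) = v i) :
    ∃ θ : M →ₗ[R] N, ∀ i, θ (v i) = u i := by
  set L₁ := Finsupp.linearCombination R v with hL₁
  set L₂ := Finsupp.linearCombination R u with hL₂
  have hr' : ∀ y, r y ∈ LinearMap.range L₁ := fun y => by
    rw [hL₁, Finsupp.range_linearCombination]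
    exact hr y
  have hker' : LinearMap.ker L₁ ≤ LinearMap.ker L₂ := hker
  refine ⟨(LinearMap.ker L₁).liftQ L₂ hker' ∘ₗ L₁.quotKerEquivRange.symm.toLinearMap ∘ₗ
    r.codRestrict _ hr', fun i => ?_⟩
  have h1 : r.codRestrict _ hr' (v i) =
      L₁.quotKerEquivRange ((LinearMap.ker L₁).mkQ (Finsupp.single i 1)) :=
    Subtype.ext ((hrv i).trans (by simp [hL₁, LinearMap.quotKerEquivRange_apply_mk]))
  simp only [LinearMap.comp_apply, h1, LinearEquiv.coe_coe, LinearEquiv.symm_apply_apply]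
  refine (Submodule.liftQ_apply _ _ _).trans ?_
  simp [hL₂]

theorem exists_linearMap_wordMat [CharZero K] (I : Submodule (CPoly K m) (QPoly K m))
    (hmul : ∀ a b, ∀ p ∈ I, a * p * b ∈ I) (hch : ∀ h, chAt h ∈ I) :
    ∃ θ : Matrix (Fin m) (Fin m) (CPoly K m) →ₗ[TnAlg K m] (QPoly K m ⧸ I),
      ∀ w, θ (wordMat K m w) = I.mkQ (wordQ K m w) := by
  obtain ⟨r, hr, hrw⟩ := exists_matrix_retraction K m
  refine exists_linearMap_of_retraction (wordMat K m) (fun w => I.mkQ (wordQ K m w)) ?_ r hr hrw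
  intro c hc
  rw [Finsupp.linearCombination_apply] at hc ⊢
  have h := (Submodule.Quotient.mk_eq_zero I).2 (sum_smul_wordQ_mem I hmul hch c hc)
  rw [← Submodule.mkQ_apply, Finsupp.sum, map_sum] at h
  exact h

theorem mem_of_jmap_eq_zero [CharZero K] (I : Submodule (CPoly K m) (QPoly K m))
    (hmul : ∀ a b, ∀ p ∈ I, a * p * b ∈ I) (hch : ∀ h, chAt h ∈ I) {P : QPoly K m}
    (hP : jmap K m P = 0) : P ∈ I := by
  obtain ⟨θ, hθw⟩ := exists_linearMap_wordMat I hmul hch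
  let Θ : Fin m → Fin m → CCTensor K m →ₗ[TnAlg K m] (QPoly K m ⧸ I) := fun i j =>
    TensorProduct.lift (LinearMap.mk₂ (TnAlg K m) (fun c f => c • θ (Matrix.single i j f))
      (fun c c' f => add_smul _ _ _) (fun t c f => smul_assoc _ _ _)
      (fun c f f' => by rw [Matrix.single_add, map_add, smul_add])
      (fun t c f => by rw [← Matrix.smul_single, map_smul, smul_comm]))
  obtain ⟨p, rfl⟩ : ∃ p : List ℕ →₀ CPoly K m, (p.sum fun w c => c • wordQ K m w) = P := by
    rw [← Finsupp.mem_span_range_iff_exists_finsupp, span_wordQ]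
    trivial
  let Λ : Matrix (Fin m) (Fin m) (CCTensor K m) →+ (QPoly K m ⧸ I) :=
    { toFun := fun M => ∑ i, ∑ j, Θ i j (M i j)
      map_zero' := by simp
      map_add' := fun M M' => by simp only [Matrix.add_apply, map_add, sum_add_distrib] }
  have h1 : Λ (jmap K m (p.sum fun w c => c • wordQ K m w)) =
      I.mkQ (p.sum fun w c => c • wordQ K m w) := by
    rw [Finsupp.sum, map_sum, map_sum, map_sum]
    have h2 : ∀ w, ∑ i, ∑ j, Θ i j (jmap K m (p w • wordQ K m w) i j) =
        I.mkQ (p w • wordQ K m w) := by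
      intro w
      rw [(I.mkQ).map_smul, ← hθw]
      conv_rhs => rw [Matrix.matrix_eq_sum_single (wordMat K m w)]
      simp only [map_sum, smul_sum]
      refine sum_congr rfl fun i _ => sum_congr rfl fun j _ => ?_
      rw [jmap_smul, jmap_wordQ, Matrix.smul_apply, RingHom.mapMatrix_apply, Matrix.map_apply,
        inclR_apply, smul_eq_mul, Algebra.TensorProduct.tmul_mul_tmul, mul_one, one_mul]
      exact TensorProduct.lift.tmul _ _
    exact sum_congr rfl fun w _ => h2 w
  rw [hP, map_zero] at h1
  exact (Submodule.Quotient.mk_eq_zero I).1 h1.symm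

theorem mem_of_isTIdeal_of_jmap_eq_zero [CharZero K] {I : Set (QPoly K m)} (hI : IsTIdeal K m I)
    (hch : chQ K m ∈ I) {P : QPoly K m} (hP : jmap K m P = 0) : P ∈ I :=
  mem_of_jmap_eq_zero
    { carrier := I
      zero_mem' := hI.1
      add_mem' := hI.2.1 _ _
      smul_mem' := fun c p hp => by rw [Algebra.smul_def]; exact hI.2.2.1 _ _ hp }
    (fun a b p hp => hI.2.2.2.1 _ _ (hI.2.2.1 _ _ hp)) (fun h => chAt_mem hI hch h) hP

end Assembly

theorem stmt5 (F : Type*) [Field F] [CharZero F] (n : ℕ) (hn : 1 ≤ n) :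
    {P : QPoly F n | jmap F n P = 0} = TIdealSpan F n {chQ F n} := by
  ext P
  constructor
  · rintro hP I ⟨hI, hS⟩
    exact mem_of_isTIdeal_of_jmap_eq_zero hI (hS rfl) hP
  · intro hP
    exact hP _ ⟨isTIdeal_ker_jmap, Set.singleton_subset_iff.2 jmap_chQ⟩
end

section
/- Noncommutative polynomials f_1,…,f_t ∈ F⟨x_1,…,x_m⟩ are M_n-locally linearly dependent if and only if there exist central polynomials c_1,…,c_t of M_n (in possibly additional variables), not all of which are polynomial identities of M_n, such that Σ_{i=1}^t c_i f_i is a polynomial identity of M_n. -/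
open scoped TensorProduct

variable (F : Type*) [Field F] [CharZero F] (n : ℕ)

/-- Evaluation of a noncommutative polynomial in `m` variables at matrices. -/
noncomputable def evalNCFin (m : ℕ) (A : Fin m → Matrix (Fin n) (Fin n) F) :
    FreeAlgebra F (Fin m) →ₐ[F] Matrix (Fin n) (Fin n) F :=
  FreeAlgebra.lift F A

/-- `f_1, …, f_t` are `M_n`-locally linearly dependent. -/
def MLocallyLinDep (m t : ℕ) (f : Fin t → FreeAlgebra F (Fin m)) : Prop :=
  ∀ A : Fin m → Matrix (Fin n) (Fin n) F,
    ¬ LinearIndependent F (fun i => evalNCFin F n m A (f i))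

/-- The inclusion `F⟨x_1,…,x_m⟩ → F⟨X⟩`. -/
noncomputable def inclNC (m : ℕ) : FreeAlgebra F (Fin m) →ₐ[F] NCPoly F :=
  FreeAlgebra.lift F (fun i : Fin m => FreeAlgebra.ι F (i : ℕ))

/-- An alternating form in as many variables as the dimension satisfies Cramer's rule. -/
theorem AlternatingMap.sum_map_update_smul {K M κ : Type*} [CommRing K] [AddCommGroup M]
    [Module K M] [Fintype κ] [DecidableEq κ] (e : Module.Basis κ K M) (D : M [⋀^κ]→ₗ[K] K)
    (v : κ → M) (w : M) :
    ∑ k, D (Function.update v k w) • v k = D v • w := by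
  rw [D.eq_smul_basis_det e]
  apply e.equivFun.injective
  have h := Matrix.mulVec_cramer (e.toMatrix v) (e.equivFun w)
  funext j
  have hj := congrFun h j
  simp only [Matrix.mulVec, dotProduct, Matrix.cramer_apply, Pi.smul_apply, smul_eq_mul,
    Module.Basis.equivFun_apply] at hj
  simp only [map_sum, map_smul, AlternatingMap.smul_apply, Module.Basis.det_apply,
    Module.Basis.toMatrix_update, Module.Basis.equivFun_apply, Finset.sum_apply, Pi.smul_apply,
    smul_eq_mul]
  rw [mul_assoc, ← hj, Finset.mul_sum]
  refine Finset.sum_congr rfl fun k _ => ?_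
  rw [Module.Basis.toMatrix_apply]
  ring

/-- A linear endomorphism acts on alternating forms of top degree, as a derivation, by its
trace. -/
theorem AlternatingMap.sum_map_update_apply {K M κ : Type*} [CommRing K] [AddCommGroup M]
    [Module K M] [Fintype κ] [DecidableEq κ] (e : Module.Basis κ K M) (D : M [⋀^κ]→ₗ[K] K)
    (T : M →ₗ[K] M) (v : κ → M) :
    ∑ k, D (Function.update v k (T (v k))) = LinearMap.trace K M T * D v := by
  rw [D.eq_smul_basis_det e, LinearMap.trace_eq_matrix_trace K e]
  simp only [AlternatingMap.smul_apply, Module.Basis.det_apply, smul_eq_mul,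
    Module.Basis.toMatrix_update]
  have h (k : κ) : ((e.toMatrix v).updateCol k (e.repr (T (v k)))).det =
      ((e.toMatrix v).adjugate * (LinearMap.toMatrix e e T * e.toMatrix v)) k k := by
    rw [← Matrix.cramer_apply, Matrix.cramer_eq_adjugate_mulVec]
    simp only [Matrix.mulVec, dotProduct, Matrix.mul_apply (M := Matrix.adjugate _)]
    refine Finset.sum_congr rfl fun j _ => ?_
    congr 1
    have := congrFun (LinearMap.toMatrix_mulVec_repr e e T (v k)) j
    rw [← this]
    rfl
  simp only [h]
  rw [← Finset.mul_sum]
  have : ∑ k, ((e.toMatrix v).adjugate * (LinearMap.toMatrix e e T * e.toMatrix v)) k k =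
      (LinearMap.toMatrix e e T).trace * (e.toMatrix v).det := by
    change Matrix.trace _ = _
    rw [Matrix.trace_mul_comm, mul_assoc, Matrix.mul_adjugate, Matrix.mul_smul, mul_one,
      Matrix.trace_smul, smul_eq_mul, mul_comm]
  rw [this]
  ring

theorem Matrix.trace_mulLeft {K ι : Type*} [CommRing K] [Fintype ι] [DecidableEq ι]
    (a : Matrix ι ι K) :
    LinearMap.trace K _ (LinearMap.mulLeft K a) = Fintype.card ι * a.trace := by
  rw [LinearMap.trace_eq_matrix_trace K (Matrix.stdBasis K ι ι), Matrix.trace,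
    Fintype.sum_prod_type]
  have h (i j : ι) : (LinearMap.toMatrix (Matrix.stdBasis K ι ι) (Matrix.stdBasis K ι ι)
      (LinearMap.mulLeft K a)).diag (i, j) = a i i := by
    have hr (x : Matrix ι ι K) : (Matrix.stdBasis K ι ι).repr x (i, j) = x i j := by
      simp [Matrix.stdBasis]
    rw [Matrix.diag_apply, LinearMap.toMatrix_apply, hr, Matrix.stdBasis_eq_single]
    simp
  change ∑ i, ∑ j, _ = _
  simp only [h, Finset.sum_const, Finset.card_univ, nsmul_eq_mul, ← Finset.mul_sum]
  rfl

/-- The alternating sum of the traces of the words `y (σ 0) * z 0 * y (σ 1) * z 1 * ⋯`. -/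
noncomputable def traceCapelli {K ι : Type*} [CommRing K] [Fintype ι] [DecidableEq ι] {N : ℕ}
    (z : Fin N → Matrix ι ι K) : Matrix ι ι K [⋀^Fin N]→ₗ[K] K :=
  MultilinearMap.alternatization
    ((Matrix.traceLinearMap ι K K).compMultilinearMap
      ((MultilinearMap.mkPiAlgebraFin K N (Matrix ι ι K)).compLinearMap
        fun i => LinearMap.mulRight K (z i)))

theorem traceCapelli_apply {K ι : Type*} [CommRing K] [Fintype ι] [DecidableEq ι] {N : ℕ}
    (y z : Fin N → Matrix ι ι K) :
    traceCapelli z y = ∑ σ : Equiv.Perm (Fin N),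
      Equiv.Perm.sign σ • Matrix.trace (List.ofFn fun i => y (σ i) * z i).prod := by
  simp [traceCapelli, MultilinearMap.alternatization_apply]

/-- The alternating sum of all cyclic rotations of the words
`y (σ 0) * z 0 * y (σ 1) * z 1 * ⋯`. -/
def cyclicCapelli {R : Type*} [Ring R] {N : ℕ} (y z : Fin N → R) : R :=
  ∑ σ : Equiv.Perm (Fin N), ∑ p : Fin N, Equiv.Perm.sign σ •
    (((List.ofFn fun i => y (σ i) * z i).drop p).prod *
      ((List.ofFn fun i => y (σ i) * z i).take p).prod)

theorem map_cyclicCapelli {R S : Type*} [Ring R] [Ring S] (φ : R →+* S) {N : ℕ}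
    (y z : Fin N → R) :
    φ (cyclicCapelli y z) = cyclicCapelli (fun i => φ (y i)) (fun i => φ (z i)) := by
  simp only [cyclicCapelli, map_sum, Units.smul_def, map_zsmul, map_mul, map_list_prod,
    List.map_drop, List.map_take, List.map_ofFn, Function.comp_def]

theorem List.prod_ofFn_update_mul {R : Type*} [Monoid R] {N : ℕ} (g : Fin N → R)
    (a : R) (p : Fin N) :
    (List.ofFn (Function.update g p (a * g p))).prod =
      ((List.ofFn g).take p).prod * (a * ((List.ofFn g).drop p).prod) := by
  have h : List.ofFn (Function.update g p (a * g p)) = (List.ofFn g).set p (a * g p) := by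
    apply List.ext_getElem
    · simp
    · intro i h1 h2
      simp only [List.getElem_ofFn, List.getElem_set, Function.update_apply, Fin.ext_iff]
      grind
  have hd : (List.ofFn g).drop p = g p :: (List.ofFn g).drop (p + 1) := by
    rw [List.drop_eq_getElem_cons (by simp)]
    simp
  rw [h, List.prod_set, hd]
  simp [mul_assoc]

theorem trace_mul_cyclicCapelli {K ι : Type*} [CommRing K] [Fintype ι] [DecidableEq ι] {N : ℕ}
    (y z : Fin N → Matrix ι ι K) (a : Matrix ι ι K) :
    (a * cyclicCapelli y z).trace =
      ∑ k, traceCapelli z (Function.update y k (a * y k)) := by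
  simp only [traceCapelli_apply, cyclicCapelli, Finset.mul_sum, Matrix.trace_sum]
  rw [Finset.sum_comm (s := (Finset.univ : Finset (Fin N)))]
  refine Finset.sum_congr rfl fun σ _ => ?_
  refine Fintype.sum_equiv σ _ _ fun p => ?_
  have h : (fun i => Function.update y (σ p) (a * y (σ p)) (σ i) * z i) =
      Function.update (fun i => y (σ i) * z i) p (a * (y (σ p) * z p)) := by
    funext i
    rcases eq_or_ne i p with rfl | hi
    · simp [mul_assoc]
    · simp [hi]
  rw [h, List.prod_ofFn_update_mul (fun i => y (σ i) * z i), mul_smul_comm, Matrix.trace_smul,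
    ← mul_assoc, Matrix.trace_mul_comm, ← mul_assoc]

/-- The rotated Capelli polynomial in `(card ι) ^ 2` alternating variables is central on matrices. -/
theorem cyclicCapelli_eq_smul_one {K ι : Type*} [CommRing K] [Fintype ι] [DecidableEq ι] {N : ℕ}
    (e : Module.Basis (Fin N) K (Matrix ι ι K)) (y z : Fin N → Matrix ι ι K) :
    cyclicCapelli y z = (Fintype.card ι * traceCapelli z y) • (1 : Matrix ι ι K) := by
  rw [Matrix.ext_iff_trace_mul_left]
  intro a
  rw [trace_mul_cyclicCapelli]
  have := (traceCapelli z).sum_map_update_apply e (LinearMap.mulLeft K a) y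
  simp only [LinearMap.mulLeft_apply] at this
  rw [this, Matrix.trace_mulLeft, mul_smul_comm, mul_one, Matrix.trace_smul, smul_eq_mul]
  ring

theorem Matrix.prod_ofFn_single {K ι : Type*} [CommSemiring K] [Fintype ι] [DecidableEq ι] {N : ℕ}
    (u v : Fin (N + 1) → ι) :
    (List.ofFn fun i => Matrix.single (u i) (v i) (1 : K)).prod =
      if ∀ i : Fin N, v i.castSucc = u i.succ then Matrix.single (u 0) (v (Fin.last N)) 1
      else 0 := by
  induction N with
  | zero => simp
  | succ N ih =>
    rw [List.ofFn_succ, List.prod_cons, ih (fun i => u i.succ) (fun i => v i.succ)]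
    simp only [Fin.forall_fin_succ (n := N), Fin.castSucc_zero, Fin.castSucc_succ]
    by_cases h0 : v 0 = u (Fin.succ 0)
    · by_cases h1 : ∀ i : Fin N, v i.castSucc.succ = u i.succ.succ
      · rw [if_pos h1, if_pos ⟨h0, h1⟩, h0, Matrix.single_mul_single_same, mul_one, Fin.succ_last]
      · rw [if_neg h1, if_neg (show ¬(_ ∧ _) from fun h => h1 h.2), mul_zero]
    · rw [if_neg (show ¬(_ ∧ _) from fun h => h0 h.1)]
      split_ifs
      · exact Matrix.single_mul_single_of_ne _ _ _ _ h0 _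
      · exact mul_zero _

theorem exists_traceCapelli_single_eq_one {K ι : Type*} [CommRing K] [Fintype ι] [DecidableEq ι]
    {N : ℕ} (e : Fin (N + 1) ≃ ι × ι) :
    ∃ z : Fin (N + 1) → Matrix ι ι K,
      traceCapelli z (fun i => Matrix.single (e i).1 (e i).2 1) = 1 := by
  refine ⟨fun i => Matrix.single (e i).2 (e (i + 1)).1 1, ?_⟩
  rw [traceCapelli_apply, Fintype.sum_eq_single 1]
  · simp only [Equiv.Perm.sign_one, one_smul, Equiv.Perm.one_apply, Matrix.single_mul_single_same,
      mul_one]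
    rw [Matrix.prod_ofFn_single, if_pos fun i => by rw [Fin.coeSucc_eq_succ], Fin.last_add_one,
      Matrix.trace_single_eq_same]
  · intro σ hσ
    by_cases hb : ∀ i, (e (σ i)).2 = (e i).2
    · simp only [hb, Matrix.single_mul_single_same, mul_one]
      rw [Matrix.prod_ofFn_single (fun i => (e (σ i)).1), if_neg, Matrix.trace_zero, smul_zero]
      intro h
      have hs (i : Fin N) : σ i.succ = i.succ := by
        apply e.injective
        refine Prod.ext ?_ (hb _)
        rw [← h i, Fin.coeSucc_eq_succ]
      refine hσ (Equiv.ext fun i => ?_)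
      rcases Fin.eq_zero_or_eq_succ i with rfl | ⟨j, rfl⟩
      · rcases Fin.eq_zero_or_eq_succ (σ 0) with h0 | ⟨j, hj⟩
        · exact h0
        · exact absurd (σ.injective (hj.trans (hs j).symm)) (Fin.succ_ne_zero j).symm
      · exact hs j
    · obtain ⟨i, hi⟩ := not_forall.mp hb
      rw [List.prod_eq_zero, Matrix.trace_zero, smul_zero]
      exact List.mem_ofFn.mpr ⟨i, Matrix.single_mul_single_of_ne _ _ _ _ hi _⟩

theorem exists_traceCapelli_ne_zero {K ι : Type*} [Field K] [Fintype ι] [DecidableEq ι]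
    {N : ℕ} (e : Fin (N + 1) ≃ ι × ι) (b : Module.Basis (Fin (N + 1)) K (Matrix ι ι K)) :
    ∃ z : Fin (N + 1) → Matrix ι ι K, traceCapelli z b ≠ 0 := by
  obtain ⟨z, hz⟩ := exists_traceCapelli_single_eq_one (K := K) e
  refine ⟨z, fun h => ?_⟩
  rw [(traceCapelli z).eq_smul_basis_det b, h, zero_smul] at hz
  exact zero_ne_one hz

theorem LinearIndependent.exists_basis_fin {K V κ : Type*} [Field K] [AddCommGroup V] [Module K V]
    [Module.Finite K V] {v : κ → V} (hv : LinearIndependent K v) {N : ℕ}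
    (hN : Module.finrank K V = N) :
    ∃ (b : Module.Basis (Fin N) K V) (e : κ → Fin N),
      Function.Injective e ∧ ∀ i, b (e i) = v i := by
  let b₀ := Module.Basis.extend hv.linearIndepOn_id
  have := Module.Finite.finite_basis b₀
  let := Fintype.ofFinite (hv.linearIndepOn_id.extend (Set.subset_univ _))
  let E := Fintype.equivFinOfCardEq ((Module.finrank_eq_card_basis b₀).symm.trans hN)
  let g (i : κ) : hv.linearIndepOn_id.extend (Set.subset_univ _) :=
    ⟨v i, Module.Basis.subset_extend hv.linearIndepOn_id (Set.mem_range_self i)⟩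
  refine ⟨b₀.reindex E, fun i => E (g i), fun i j h => ?_, fun i => ?_⟩
  · exact hv.injective (congrArg Subtype.val (E.injective h))
  · rw [Module.Basis.reindex_apply, Equiv.symm_apply_apply, Module.Basis.extend_apply_self]

theorem evalNC_inclNC (F : Type*) [Field F] [CharZero F] (n m : ℕ)
    (A : ℕ → Matrix (Fin n) (Fin n) F) (g : FreeAlgebra F (Fin m)) :
    evalNC F n A (inclNC F m g) = evalNCFin F n m (fun i => A i) g := by
  have : (evalNC F n A).comp (inclNC F m) = evalNCFin F n m (fun i => A i) := by
    apply FreeAlgebra.hom_ext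
    funext i
    simp [evalNC, inclNC, evalNCFin]
  exact DFunLike.congr_fun this g

/-- Along an affine line of tuples of matrices, the entries of the values of a noncommutative
polynomial are polynomial functions of the parameter. -/
theorem exists_polynomial_matrix_evalNC_line (F : Type*) [Field F] [CharZero F] (n : ℕ)
    (A B : ℕ → Matrix (Fin n) (Fin n) F) (g : NCPoly F) :
    ∃ Q : Matrix (Fin n) (Fin n) (Polynomial F), ∀ τ : F,
      evalNC F n (fun k => A k + τ • B k) g = Q.map (Polynomial.eval τ) := by
  let G (k : ℕ) : Matrix (Fin n) (Fin n) (Polynomial F) :=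
    (A k).map Polynomial.C + (Polynomial.X : Polynomial F) • (B k).map Polynomial.C
  refine ⟨FreeAlgebra.lift F G g, fun τ => ?_⟩
  have : evalNC F n (fun k => A k + τ • B k) =
      ((Polynomial.aeval τ).mapMatrix).comp (FreeAlgebra.lift F G) := by
    apply FreeAlgebra.hom_ext
    funext k
    ext i j
    simp [evalNC, G, mul_comm τ]
  rw [this]
  ext i j
  simp [Polynomial.coe_aeval_eq_eval]

/-- Linear independence of the values of noncommutative polynomials is an open condition along
affine lines. -/
theorem exists_polynomial_linearIndependent_line (F : Type*) [Field F] [CharZero F] (n t : ℕ)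
    (A B : ℕ → Matrix (Fin n) (Fin n) F) (g : Fin t → NCPoly F)
    (h : LinearIndependent F fun i => evalNC F n A (g i)) :
    ∃ q : Polynomial F, q ≠ 0 ∧ ∀ τ : F, q.eval τ ≠ 0 →
      LinearIndependent F fun i => evalNC F n (fun k => A k + τ • B k) (g i) := by
  choose Q hQ using fun i => exists_polynomial_matrix_evalNC_line F n A B (g i)
  obtain ⟨L, hL⟩ := LinearMap.exists_leftInverse_of_injective
    (Fintype.linearCombination F fun i => evalNC F n A (g i))
    (LinearMap.ker_eq_bot.mpr (linearIndependent_iff_injective_fintypeLinearCombination.mp h))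
  let M : Matrix (Fin t) (Fin t) (Polynomial F) := Matrix.of fun i j =>
    ∑ a, ∑ b, Q i a b * Polynomial.C (L (Matrix.single a b 1) j)
  have hM (τ : F) : M.map (Polynomial.eval τ) =
      Matrix.of fun i => L (evalNC F n (fun k => A k + τ • B k) (g i)) := by
    ext i j
    rw [Matrix.of_apply, hQ, Matrix.matrix_eq_sum_single ((Q i).map _)]
    simp only [M, Matrix.map_apply, Matrix.of_apply, Polynomial.eval_finsetSum,
      Polynomial.eval_mul, Polynomial.eval_C, map_sum, Finset.sum_apply]
    refine Finset.sum_congr rfl fun a _ => Finset.sum_congr rfl fun b _ => ?_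
    have h1 : Matrix.single a b (Polynomial.eval τ (Q i a b)) =
        Polynomial.eval τ (Q i a b) • Matrix.single a b (1 : F) := by
      rw [Matrix.smul_single, smul_eq_mul, mul_one]
    rw [h1, map_smul, Pi.smul_apply, smul_eq_mul]
  have hdet (τ : F) : M.det.eval τ =
      (Matrix.of fun i => L (evalNC F n (fun k => A k + τ • B k) (g i))).det := by
    rw [← hM, ← Polynomial.coe_evalRingHom, RingHom.map_det]
    rfl
  refine ⟨M.det, fun h0 => ?_, fun τ hτ => ?_⟩
  · have h1 := hdet 0
    have : (Matrix.of fun i => L (evalNC F n (fun k => A k + (0 : F) • B k) (g i))) = 1 := by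
      ext i j
      have := DFunLike.congr_fun hL (Pi.single i 1)
      simp only [LinearMap.comp_apply, Fintype.linearCombination_apply_single, one_smul,
        LinearMap.id_apply] at this
      simp only [zero_smul, add_zero, Matrix.of_apply, this, Matrix.one_apply, Pi.single_apply,
        eq_comm]
    rw [this, h0] at h1
    simp at h1
  · rw [hdet] at hτ
    exact LinearIndependent.of_comp L (Matrix.linearIndependent_rows_of_det_ne_zero hτ)

theorem not_linearIndependent_of_central_relation (F : Type*) [Field F] [CharZero F] (n m t : ℕ)
    (f : Fin t → FreeAlgebra F (Fin m)) (c : Fin t → NCPoly F)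
    (hc : ∀ i, IsCentralPoly F n (c i)) (hne : ∃ i, ¬ IsPolyIdentity F n (c i))
    (hrel : IsPolyIdentity F n (∑ i, c i * inclNC F m (f i))) : MLocallyLinDep F n m t f := by
  intro A₀ hA₀
  obtain ⟨i, hi⟩ := hne
  obtain ⟨A₁, hA₁⟩ := not_forall.mp hi
  let A (k : ℕ) : Matrix (Fin n) (Fin n) F := if h : k < m then A₀ ⟨k, h⟩ else 0
  have hA : LinearIndependent F fun j => evalNC F n A (inclNC F m (f j)) := by
    simpa only [evalNC_inclNC, A, Fin.is_lt, dif_pos, Fin.eta] using hA₀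
  obtain ⟨q, hq, hind⟩ := exists_polynomial_linearIndependent_line F n t A (fun k => A₁ k - A k)
    (fun j => inclNC F m (f j)) hA
  obtain ⟨Q, hQ⟩ := exists_polynomial_matrix_evalNC_line F n A (fun k => A₁ k - A k) (c i)
  obtain ⟨a, b, hab⟩ : ∃ a b, Q a b ≠ 0 := by
    by_contra! h0
    have h1 := hQ 1
    simp only [one_smul, add_sub_cancel] at h1
    refine hA₁ (h1.trans ?_)
    ext a b
    simp [h0]
  obtain ⟨τ, hτ⟩ : ∃ τ, (q * Q a b).eval τ ≠ 0 := by
    by_contra! h0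
    exact mul_ne_zero hq hab (Polynomial.funext fun τ => by simpa using h0 τ)
  rw [Polynomial.eval_mul] at hτ
  choose α hα using fun j => hc j (fun k => A k + τ • (A₁ k - A k))
  have hsum := hrel (fun k => A k + τ • (A₁ k - A k))
  simp only [map_sum, map_mul, hα, smul_mul_assoc, one_mul] at hsum
  have hz := Fintype.linearIndependent_iff.mp (hind τ (left_ne_zero_of_mul hτ)) α hsum i
  have h2 := hQ τ
  rw [hα, hz, zero_smul] at h2
  exact right_ne_zero_of_mul hτ (congrFun (congrFun h2 a) b).symm

theorem exists_central_relation (F : Type*) [Field F] [CharZero F] (n : ℕ) (hn : 1 ≤ n)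
    (m t : ℕ) (f : Fin t → FreeAlgebra F (Fin m)) (hf : MLocallyLinDep F n m t f) :
    ∃ c : Fin t → NCPoly F,
      (∀ i, IsCentralPoly F n (c i)) ∧
      (∃ i, ¬ IsPolyIdentity F n (c i)) ∧
      IsPolyIdentity F n (∑ i, c i * inclNC F m (f i)) := by
  classical
  obtain ⟨N, hN⟩ : ∃ N, Fintype.card (Fin n × Fin n) = N + 1 :=
    Nat.exists_eq_succ_of_ne_zero (by simp; omega)
  let E := (Fintype.equivFinOfCardEq hN).symm
  have hfin : Module.finrank F (Matrix (Fin n) (Fin n) F) = N + 1 := by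
    rw [Module.finrank_eq_card_basis (Matrix.stdBasis F (Fin n) (Fin n)), hN]
  let bstd := (Matrix.stdBasis F (Fin n) (Fin n)).reindex E.symm
  obtain ⟨S, ⟨A₀, hA₀⟩, hmax⟩ := (Set.toFinite {S : Finset (Fin t) |
    ∃ A, LinearIndepOn F (fun i => evalNCFin F n m A (f i)) (S : Set (Fin t))}).exists_maximal
    ⟨∅, 0, by simp⟩
  obtain ⟨j, hj⟩ : ∃ j, j ∉ S := by
    by_contra! h
    have hS : S = Finset.univ := Finset.eq_univ_iff_forall.mpr h
    rw [hS, Finset.coe_univ, linearIndepOn_univ_iff] at hA₀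
    exact hf A₀ hA₀
  have hdep (A) : ¬ LinearIndepOn F (fun i => evalNCFin F n m A (f i))
      (insert j S : Finset (Fin t)) := fun h =>
    hj (hmax (show _ ∈ {S | _} from ⟨A, h⟩) (Finset.subset_insert j S) (Finset.mem_insert_self j S))
  obtain ⟨b, e, he, hb⟩ := LinearIndependent.exists_basis_fin hA₀ hfin
  obtain ⟨z₀, hz₀⟩ := exists_traceCapelli_ne_zero E b
  let y : Fin (N + 1) → NCPoly F :=
    Function.extend e (fun i => inclNC F m (f i)) fun k => FreeAlgebra.ι F (m + k)
  let z (k : Fin (N + 1)) : NCPoly F := FreeAlgebra.ι F (m + (N + 1) + k)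
  have hye (i : S) : y (e i) = inclNC F m (f i) := he.extend_apply _ _ i
  have heval (A) (u : Fin (N + 1) → NCPoly F) : evalNC F n A (cyclicCapelli u z) =
      (n * traceCapelli (fun k => evalNC F n A (z k)) fun k => evalNC F n A (u k)) •
        (1 : Matrix (Fin n) (Fin n) F) := by
    have := map_cyclicCapelli (evalNC F n A).toRingHom u z
    simp only [AlgHom.toRingHom_eq_coe, RingHom.coe_coe] at this
    rw [this, cyclicCapelli_eq_smul_one bstd, Fintype.card_fin]
  have hcentral (u : Fin (N + 1) → NCPoly F) : IsCentralPoly F n (cyclicCapelli u z) :=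
    fun A => ⟨_, heval A u⟩
  let c (i : Fin t) : NCPoly F :=
    if i = j then -cyclicCapelli y z
    else if h : i ∈ S then cyclicCapelli (Function.update y (e ⟨i, h⟩) (inclNC F m (f j))) z
    else 0
  refine ⟨c, fun i => ?_, ⟨j, fun h => ?_⟩, fun A => ?_⟩
  · simp only [c]
    split_ifs
    · intro A
      obtain ⟨α, hα⟩ := hcentral y A
      exact ⟨-α, by rw [map_neg, hα, neg_smul]⟩
    · exact hcentral _
    · exact fun A => ⟨0, by simp⟩
  · let A (k : ℕ) : Matrix (Fin n) (Fin n) F :=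
      if h : k < m then A₀ ⟨k, h⟩
      else if h : k - m < N + 1 then b ⟨k - m, h⟩
      else if h : k - m - (N + 1) < N + 1 then z₀ ⟨k - m - (N + 1), h⟩
      else 0
    have hAz (k) : evalNC F n A (z k) = z₀ k := by
      have h1 : ¬ m + (N + 1) + (k : ℕ) < m := by omega
      have h2 : ¬ m + (N + 1) + (k : ℕ) - m < N + 1 := by omega
      have h3 : m + (N + 1) + (k : ℕ) - m - (N + 1) = k := by omega
      simp only [z, evalNC, FreeAlgebra.lift_ι_apply, A, dif_neg h1, dif_neg h2, h3, k.is_lt,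
        dif_pos, Fin.eta]
    have hAy (k) : evalNC F n A (y k) = b k := by
      by_cases hk : ∃ i, e i = k
      · obtain ⟨i, rfl⟩ := hk
        rw [hye, evalNC_inclNC, hb]
        simp only [A, Fin.is_lt, dif_pos, Fin.eta]
      · have h1 : ¬ m + (k : ℕ) < m := by omega
        have h2 : m + (k : ℕ) - m = k := by omega
        simp only [y, Function.extend_apply' _ _ _ hk, evalNC, FreeAlgebra.lift_ι_apply, A,
          dif_neg h1, h2, k.is_lt, dif_pos, Fin.eta]
    have h0 := h A
    simp only [c, if_true, map_neg, heval, hAz, hAy, neg_eq_zero] at h0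
    have : Nonempty (Fin n) := ⟨⟨0, hn⟩⟩
    rcases smul_eq_zero.mp h0 with h0 | h0
    · rcases mul_eq_zero.mp h0 with h0 | h0
      · exact absurd (Nat.cast_eq_zero.mp h0) (by omega)
      · exact hz₀ h0
    · exact one_ne_zero h0
  · have hvanish (k) (hk : ¬ ∃ i, e i = k) :
        evalNC F n A (cyclicCapelli (Function.update y k (inclNC F m (f j))) z) = 0 := by
      rw [heval, AlternatingMap.map_linearDependent, mul_zero, zero_smul]
      intro hind
      apply hdep fun i => A i
      let φ (i : (insert j S : Finset (Fin t))) : Fin (N + 1) :=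
        if h : i.1 ∈ S then e ⟨i, h⟩ else k
      have hφ : Function.Injective φ := by
        rintro ⟨a, ha⟩ ⟨a', ha'⟩ h
        have := Finset.mem_insert.mp ha
        have := Finset.mem_insert.mp ha'
        simp only [φ] at h
        split_ifs at h with h1 h2 h2
        · simpa using he h
        · exact absurd ⟨_, h⟩ hk
        · exact absurd ⟨_, h.symm⟩ hk
        · grind
      have h2 := hind.comp φ hφ
      have h3 : ((fun k' => evalNC F n A (Function.update y k (inclNC F m (f j)) k')) ∘ φ) =
          fun i : (insert j S : Finset (Fin t)) => evalNCFin F n m (fun i => A i) (f i) := by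
        funext i
        by_cases hi : i.1 ∈ S
        · have : φ i = e ⟨i, hi⟩ := dif_pos hi
          have hne : e ⟨i, hi⟩ ≠ k := fun h => hk ⟨_, h⟩
          rw [Function.comp_apply, this, Function.update_of_ne hne, hye, evalNC_inclNC]
        · have : φ i = k := dif_neg hi
          have hij : i.1 = j := (Finset.mem_insert.mp i.2).resolve_right hi
          rw [Function.comp_apply, this, Function.update_self, evalNC_inclNC, hij]
      rw [h3] at h2
      exact h2
    have hcramer : ∑ k, evalNC F n A (cyclicCapelli (Function.update y k (inclNC F m (f j))) z) *
        evalNC F n A (y k) =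
        evalNC F n A (cyclicCapelli y z) * evalNC F n A (inclNC F m (f j)) := by
      have h1 := (traceCapelli fun k => evalNC F n A (z k)).sum_map_update_smul bstd
        (fun k => evalNC F n A (y k)) (evalNC F n A (inclNC F m (f j)))
      have h2 (k) : (fun k' => evalNC F n A (Function.update y k (inclNC F m (f j)) k')) =
          Function.update (fun k => evalNC F n A (y k)) k (evalNC F n A (inclNC F m (f j))) := by
        funext k'
        rcases eq_or_ne k' k with rfl | hk
        · simp
        · simp [hk]
      simp only [heval, h2, smul_mul_assoc, one_mul, mul_smul]
      rw [← Finset.smul_sum, h1]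
    have hsumS : ∑ i : S, evalNC F n A (c i) * evalNC F n A (inclNC F m (f i)) =
        evalNC F n A (cyclicCapelli y z) * evalNC F n A (inclNC F m (f j)) := by
      rw [← hcramer]
      refine Fintype.sum_of_injective e he _ _ (fun k hk => ?_) fun i => ?_
      · rw [hvanish k hk, zero_mul]
      · have hij : i.1 ≠ j := fun h => hj (h ▸ i.2)
        have hci : c i = cyclicCapelli (Function.update y (e i) (inclNC F m (f j))) z := by
          simp only [c, if_neg hij]
          exact dif_pos i.2
        rw [hci, hye]
    have hcj : c j = -cyclicCapelli y z := if_pos rfl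
    rw [← Finset.sum_subset (Finset.subset_univ (insert j S)), Finset.sum_insert hj, map_add,
      map_sum, ← Finset.sum_coe_sort S]
    · simp only [map_mul]
      rw [hsumS, hcj, map_neg, neg_mul, neg_add_cancel]
    · intro i _ hi
      have h1 : i ≠ j := fun h => hi (h ▸ Finset.mem_insert_self _ _)
      have h2 : i ∉ S := fun h => hi (Finset.mem_insert_of_mem h)
      simp only [c, if_neg h1, dif_neg h2, zero_mul]

theorem stmt6 (F : Type*) [Field F] [CharZero F] (n : ℕ) (hn : 1 ≤ n)
    (m t : ℕ) (f : Fin t → FreeAlgebra F (Fin m)) :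
    MLocallyLinDep F n m t f ↔
      ∃ c : Fin t → NCPoly F,
        (∀ i, IsCentralPoly F n (c i)) ∧
        (∃ i, ¬ IsPolyIdentity F n (c i)) ∧
        IsPolyIdentity F n (∑ i, c i * inclNC F m (f i)) := by
  exact ⟨exists_central_relation F n hn m t f, fun ⟨c, hc, hne, hrel⟩ =>
    not_linearIndependent_of_central_relation F n m t f c hc hne hrel⟩
end
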